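/- (Asymptotic Kelvin–Hicks relation.) For every κ, W, δ₀, m₀ > 0 and every η > 0 there exist ε₀ > 0 and d₀ > 0 such that: whenever ε ∈ (0, ε₀] and ψ is a centralized stream function of a steady vortex ring with parameters (ε, W, μ), μ ≥ m₀, whose circulation equals κ and whose cross-section A is simply connected, contained in {x : δ₀ ≤ x₁ ≤ 1/δ₀}, and of diameter at most d₀, and p = (p₁, 0) ∈ A is a point at which ψ attains its maximum over the closure of A, then, with σ := (1/2)·diam A, one has |W p₁ ln(1/ε) − (κ/(4π)) ln(8 p₁/σ) + κ/(16π)| ≤ η. -/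

import Mathlib

open MeasureTheory Real Filter
open scoped RealInnerProductSpace

noncomputable section

/-- The plane `ℝ²` with the Euclidean norm. -/
abbrev Plane : Type := EuclideanSpace ℝ (Fin 2)

/-- The point `(a, b)` of the plane. -/
def mk2 (a b : ℝ) : Plane := (WithLp.equiv 2 (Fin 2 → ℝ)).symm ![a, b]

/-- The open right half plane `Π = {x : x₁ > 0}`. -/
def halfPlane : Set Plane := {x : Plane | 0 < x 0}

/-- The reflection `x̄ = (−x₁, x₂)` of a point `x = (x₁, x₂)`. -/
def reflPt (x : Plane) : Plane := mk2 (-(x 0)) (x 1)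

/-- The Green function `G_*` on the half plane of the operator `−(1/x₁)div((1/x₁)∇)`. -/
def Gstar (x x' : Plane) : ℝ :=
  x 0 * (x' 0) ^ 2 / (4 * π) *
    ∫ θ in (-π)..π, Real.cos θ /
      Real.sqrt ((x 1 - x' 1) ^ 2 + (x 0) ^ 2 + (x' 0) ^ 2 - 2 * x 0 * x' 0 * Real.cos θ)

/-- The Green function of `−Δ` on the half plane. -/
def Gfun (x x' : Plane) : ℝ :=
  (1 / (4 * π)) * Real.log
    (((x 0 + x' 0) ^ 2 + (x 1 - x' 1) ^ 2) / ((x 0 - x' 0) ^ 2 + (x 1 - x' 1) ^ 2))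

/-- The regular part `H_c(x,x') = G_*(x,x') − c² G(x,x')`. -/
def Hker (c : ℝ) (x x' : Plane) : ℝ := Gstar x x' - c ^ 2 * Gfun x x'

/-- The regular part `H_c`, extended continuously to the diagonal. -/
def HkerExt (c : ℝ) (x x' : Plane) : ℝ := by
  classical
  exact if x = x' then limUnder (nhdsWithin x' {x'}ᶜ) (fun y => Hker c y x')
    else Hker c x x'

/-- The cross-section `A = {x ∈ Π : ψ(x) − (W/2) x₁² ln(1/ε) > μ}`. -/
def crossSection (ψ : Plane → ℝ) (ε W μ : ℝ) : Set Plane :=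
  {x : Plane | x ∈ halfPlane ∧ μ < ψ x - W / 2 * (x 0) ^ 2 * Real.log (1 / ε)}

/-- `ψ` is a stream function of a steady vortex ring with parameters `(ε, W, μ)`. -/
structure IsVortexRingStream (ψ : Plane → ℝ) (ε W μ : ℝ) : Prop where
  continuousOn : ContinuousOn ψ halfPlane
  bounded : Bornology.IsBounded (crossSection ψ ε W μ)
  closure_subset : closure (crossSection ψ ε W μ) ⊆ halfPlane
  repr : ∀ x ∈ halfPlane, ψ x = (∫ x' in crossSection ψ ε W μ, Gstar x x') / ε ^ 2

/-- The circulation `ε⁻² ∫_A x₁ dx` of a vortex ring. -/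
def circulation (ψ : Plane → ℝ) (ε W μ : ℝ) : ℝ :=
  (∫ x in crossSection ψ ε W μ, x 0) / ε ^ 2

/-- `ψ` is centralized: it is even in the second variable. -/
def Centralized (ψ : Plane → ℝ) : Prop :=
  ∀ a b : ℝ, ψ (mk2 a (-b)) = ψ (mk2 a b)

section

theorem integral_polar (f : ℂ → ℝ) :
    ∫ z, f z = ∫ p in Set.Ioi (0 : ℝ) ×ˢ Set.Ioo (-π) π, p.1 * f (circleMap 0 p.1 p.2) := by
  rw [← Complex.integral_comp_polarCoord_symm, polarCoord_target]
  refine setIntegral_congr_fun (measurableSet_Ioi.prod measurableSet_Ioo) fun p _ => ?_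
  simp only [Complex.polarCoord_symm_apply, smul_eq_mul, circleMap, zero_add, Complex.exp_mul_I,
    Complex.ofReal_cos, Complex.ofReal_sin]

theorem integral_inv_norm_ball_zero {R : ℝ} (hR : 0 < R) :
    ∫ y in Metric.ball (0 : ℂ) R, ‖y‖⁻¹ = 2 * π * R := by
  rw [← integral_indicator Metric.isOpen_ball.measurableSet, integral_polar]
  have h : ∀ p ∈ Set.Ioi (0 : ℝ) ×ˢ Set.Ioo (-π) π,
      p.1 * (Metric.ball (0 : ℂ) R).indicator (fun y => ‖y‖⁻¹) (circleMap 0 p.1 p.2)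
        = (Set.Ioo 0 R ×ˢ Set.univ).indicator (fun _ => (1 : ℝ)) p := by
    rintro ⟨r, θ⟩ ⟨hr, -⟩
    have hr' : 0 < r := hr
    by_cases h : r < R
    · rw [Set.indicator_of_mem (by simpa [abs_of_pos hr'] using h),
        Set.indicator_of_mem (by simp [hr', h])]
      simp [abs_of_pos hr', hr'.ne']
    · rw [Set.indicator_of_notMem (by simpa [abs_of_pos hr'] using h),
        Set.indicator_of_notMem (by simp [h]), mul_zero]
  rw [setIntegral_congr_fun (measurableSet_Ioi.prod measurableSet_Ioo) h,
    setIntegral_indicator (measurableSet_Ioo.prod MeasurableSet.univ), Set.prod_inter_prod]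
  have h2 : Set.Ioi (0 : ℝ) ∩ Set.Ioo 0 R = Set.Ioo 0 R := by
    ext; simp
  rw [h2, Set.inter_univ, setIntegral_const, Measure.volume_eq_prod, measureReal_prod_prod]
  simp [hR.le, pi_pos.le]; ring

theorem integral_inv_norm_ball (x : ℂ) {R : ℝ} (hR : 0 < R) :
    ∫ y in Metric.ball x R, ‖x - y‖⁻¹ = 2 * π * R := by
  rw [← integral_inv_norm_ball_zero hR]
  have := (measurePreserving_add_left volume x).setIntegral_preimage_emb
    (MeasurableEquiv.addLeft x).measurableEmbedding (fun y => ‖x - y‖⁻¹) (Metric.ball x R)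
  rw [← this]
  simp

theorem integrableOn_inv_norm_ball (x : ℂ) (R : ℝ) :
    IntegrableOn (fun y => ‖x - y‖⁻¹) (Metric.ball x R) := by
  rcases le_or_gt R 0 with h | h
  · simp [Metric.ball_eq_empty.2 h]
  · exact Integrable.of_integral_ne_zero (by rw [integral_inv_norm_ball x h]; positivity)

theorem integrableOn_inv_norm (x : ℂ) {E : Set ℂ} (hE : Bornology.IsBounded E) :
    IntegrableOn (fun y => ‖x - y‖⁻¹) E := by
  obtain ⟨R, hR⟩ := hE.subset_ball x
  exact (integrableOn_inv_norm_ball x R).mono_set hR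

theorem setIntegral_inv_norm_le_aux (x : ℂ) {E : Set ℂ} (hE : Bornology.IsBounded E)
    (hm : MeasurableSet E) {R : ℝ} (hR : 0 < R) :
    ∫ y in E, ‖x - y‖⁻¹ ≤ 2 * π * R + volume.real E / R := by
  have hi := integrableOn_inv_norm x hE
  have hfin := hE.measure_lt_top (μ := volume)
  rw [← integral_inter_add_sdiff (Metric.isOpen_ball (x := x) (ε := R)).measurableSet hi]
  gcongr
  · rw [← integral_inv_norm_ball x hR]
    exact setIntegral_mono_set (integrableOn_inv_norm_ball x R)
      (ae_of_all _ fun y => by positivity) (Set.inter_subset_right).eventuallyLE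
  · have h1 : ∫ y in E \ Metric.ball x R, ‖x - y‖⁻¹ ≤ ∫ y in E \ Metric.ball x R, R⁻¹ := by
      refine setIntegral_mono_on (hi.mono_set Set.sdiff_subset) ?_
        (hm.diff Metric.isOpen_ball.measurableSet) ?_
      · exact integrableOn_const ((measure_mono Set.sdiff_subset).trans_lt hfin).ne
      · intro y hy
        have := hy.2
        rw [Metric.mem_ball, not_lt, dist_comm, Complex.dist_eq] at this
        gcongr
    refine h1.trans ?_
    rw [setIntegral_const, smul_eq_mul, div_eq_mul_inv]
    gcongr
    · exact hfin.ne
    · exact Set.sdiff_subset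

theorem setIntegral_inv_norm_le (x : ℂ) {E : Set ℂ} (hE : Bornology.IsBounded E)
    (hm : MeasurableSet E) : ∫ y in E, ‖x - y‖⁻¹ ≤ 2 * √(2 * π * volume.real E) := by
  rcases (measureReal_nonneg (μ := volume) (s := E)).eq_or_lt with h | h
  · have h0 : volume E = 0 := by
      rwa [eq_comm, measureReal_eq_zero_iff hE.measure_lt_top.ne] at h
    rw [Measure.restrict_eq_zero.2 h0, integral_zero_measure]; positivity
  · set a := volume.real E
    have h2 := setIntegral_inv_norm_le_aux x hE hm (R := √(2 * π * a) / (2 * π)) (by positivity)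
    refine h2.trans (le_of_eq ?_)
    have h3 : √(2 * π * a) * √(2 * π * a) = 2 * π * a := mul_self_sqrt (by positivity)
    have h4 : 0 < √(2 * π * a) := by positivity
    field_simp
    nlinarith

theorem abs_log_le_inv_add {r : ℝ} (hr : 0 ≤ r) : |log r| ≤ r⁻¹ + r := by
  rcases hr.eq_or_lt with rfl | h
  · simp
  · have h1 := Real.log_le_sub_one_of_pos h
    have h2 := Real.log_le_sub_one_of_pos (inv_pos.2 h)
    rw [Real.log_inv] at h2
    have := inv_pos.2 h
    rw [abs_le]; constructor <;> linarith

theorem integrableOn_log_norm (x : ℂ) {E : Set ℂ} (hE : Bornology.IsBounded E) :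
    IntegrableOn (fun y => log ‖x - y‖) E := by
  obtain ⟨R, hR⟩ := hE.subset_ball x
  refine IntegrableOn.mono_set ?_ hR
  have h : IntegrableOn (fun y => ‖x - y‖⁻¹ + R) (Metric.ball x R) :=
    (integrableOn_inv_norm_ball x R).add (integrableOn_const measure_ball_lt_top.ne)
  refine h.mono' (by exact (Real.measurable_log.comp (by fun_prop)).aestronglyMeasurable) ?_
  refine (ae_restrict_iff' Metric.isOpen_ball.measurableSet).2 (ae_of_all _ fun y hy => ?_)
  rw [Metric.mem_ball, dist_comm, Complex.dist_eq] at hy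
  have := abs_log_le_inv_add (norm_nonneg (x - y))
  rw [Real.norm_eq_abs]; linarith

/-- The logarithmic potential (without normalisation) of a set. -/
def logPot (E : Set ℂ) (x : ℂ) : ℝ := ∫ y in E, log ‖x - y‖

theorem abs_log_sub_log_le {a b : ℝ} (ha : 0 < a) (hb : 0 < b) :
    |log a - log b| ≤ |a - b| * (a⁻¹ + b⁻¹) := by
  have key : ∀ {a b : ℝ}, 0 < a → 0 < b → log a - log b ≤ |a - b| * (a⁻¹ + b⁻¹) := by
    intro a b ha hb
    have h1 := Real.log_le_sub_one_of_pos (div_pos ha hb)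
    rw [Real.log_div ha.ne' hb.ne'] at h1
    have h2 : a / b - 1 = (a - b) * b⁻¹ := by field_simp
    have h3 : (a - b) * b⁻¹ ≤ |a - b| * b⁻¹ := by gcongr; exact le_abs_self _
    have h4 : 0 ≤ |a - b| * a⁻¹ := by positivity
    linarith [mul_add |a - b| a⁻¹ b⁻¹]
  rw [abs_le]
  have h1 := key ha hb
  have h2 := key hb ha
  rw [abs_sub_comm b a, add_comm b⁻¹] at h2
  constructor <;> linarith

theorem abs_logPot_sub_le {E : Set ℂ} (hE : Bornology.IsBounded E) (hm : MeasurableSet E)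
    (x y : ℂ) : |logPot E x - logPot E y| ≤ 4 * √(2 * π * volume.real E) * ‖x - y‖ := by
  unfold logPot
  rw [← integral_sub (integrableOn_log_norm x hE) (integrableOn_log_norm y hE)]
  have hae : ∀ᵐ z ∂(volume.restrict E), z ≠ x ∧ z ≠ y :=
    (Measure.ae_ne _ x).and (Measure.ae_ne _ y)
  have h1 : |∫ z in E, (log ‖x - z‖ - log ‖y - z‖)| ≤
      ∫ z in E, ‖x - y‖ * (‖x - z‖⁻¹ + ‖y - z‖⁻¹) := by
    refine norm_integral_le_of_norm_le (f := fun z => log ‖x - z‖ - log ‖y - z‖)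
      (((integrableOn_inv_norm x hE).add (integrableOn_inv_norm y hE)).const_mul _) ?_
    filter_upwards [hae] with z hz
    have hx : 0 < ‖x - z‖ := norm_pos_iff.2 (sub_ne_zero.2 hz.1.symm)
    have hy : 0 < ‖y - z‖ := norm_pos_iff.2 (sub_ne_zero.2 hz.2.symm)
    refine (abs_log_sub_log_le hx hy).trans ?_
    gcongr
    have := abs_norm_sub_norm_le (x - z) (y - z)
    rwa [sub_sub_sub_cancel_right] at this
  refine h1.trans ?_
  rw [integral_const_mul, integral_add (integrableOn_inv_norm x hE) (integrableOn_inv_norm y hE)]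
  have h2 := setIntegral_inv_norm_le x hE hm
  have h3 := setIntegral_inv_norm_le y hE hm
  calc _ ≤ ‖x - y‖ * (2 * √(2 * π * volume.real E) + 2 * √(2 * π * volume.real E)) := by gcongr
    _ = _ := by ring

theorem integrable_polar {f : ℂ → ℝ} (hfm : Measurable f) (hf : Integrable f) :
    IntegrableOn (fun p : ℝ × ℝ => p.1 * f (circleMap 0 p.1 p.2))
      (Set.Ioi (0 : ℝ) ×ˢ Set.Ioo (-π) π) := by
  have hc : Measurable fun p : ℝ × ℝ => circleMap 0 p.1 p.2 := by
    unfold circleMap; fun_prop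
  refine ⟨(measurable_fst.mul (hfm.comp hc)).aestronglyMeasurable, ?_⟩
  have h := hf.2
  rw [HasFiniteIntegral, ← Complex.lintegral_comp_polarCoord_symm, polarCoord_target] at h
  refine lt_of_le_of_lt (le_of_eq ?_) h
  refine setLIntegral_congr_fun (measurableSet_Ioi.prod measurableSet_Ioo) fun p hp => ?_
  have hp' : (0 : ℝ) < p.1 := hp.1
  simp only [Complex.polarCoord_symm_apply, smul_eq_mul, circleMap, zero_add, Complex.exp_mul_I,
    Complex.ofReal_cos, Complex.ofReal_sin, enorm_mul, Real.enorm_eq_ofReal hp'.le]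

theorem integral_eq_integral_circleAverage {f : ℂ → ℝ} (hfm : Measurable f) (hf : Integrable f) :
    ∫ z, f z = ∫ r in Set.Ioi (0 : ℝ), 2 * π * r * circleAverage f 0 r := by
  rw [integral_polar, Measure.volume_eq_prod, setIntegral_prod _ (integrable_polar hfm hf)]
  refine setIntegral_congr_fun measurableSet_Ioi fun r _ => ?_
  simp only []
  rw [integral_const_mul, circleAverage_def, smul_eq_mul, ← integral_Ioc_eq_integral_Ioo,
    ← intervalIntegral.integral_of_le (by linarith [pi_pos])]
  have h := ((periodic_circleMap 0 r).comp f).intervalIntegral_add_eq (-π) 0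
  rw [show -π + 2 * π = π by ring, zero_add] at h
  simp only [Function.comp_apply] at h
  rw [h]
  field_simp

theorem circleAverage_log_norm_sub {x : ℂ} {r : ℝ} (hr : 0 < r) :
    circleAverage (fun y => log ‖x - y‖) 0 r = log (max r ‖x‖) := by
  simp_rw [norm_sub_rev x]
  rw [circleAverage_log_norm_sub_const_eq_log_radius_add_posLog hr.ne', zero_sub, norm_neg]
  rcases le_or_gt ‖x‖ r with h | h
  · rw [max_eq_left h, (posLog_eq_zero_iff _).2, add_zero]
    rw [abs_of_nonneg (by positivity), inv_mul_le_iff₀ hr]; linarith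
  · rw [max_eq_right h.le, posLog_eq_log, log_mul (by positivity) (by linarith), log_inv]
    · ring
    · rw [abs_of_nonneg (by positivity), le_inv_mul_iff₀ hr]; linarith

theorem integral_mul_log {a b : ℝ} (ha : 0 < a) (hab : a ≤ b) :
    ∫ r in a..b, 2 * π * r * log r =
      2 * π * ((b ^ 2 / 2 * log b - b ^ 2 / 4) - (a ^ 2 / 2 * log a - a ^ 2 / 4)) := by
  have hd : ∀ r ∈ Set.uIcc a b, HasDerivAt
      (fun r => 2 * π * (r ^ 2 / 2 * log r - r ^ 2 / 4)) (2 * π * r * log r) r := by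
    intro r hr
    rw [Set.uIcc_of_le hab] at hr
    have hr0 : r ≠ 0 := by linarith [hr.1]
    have h := ((((hasDerivAt_pow 2 r).div_const 2).mul (Real.hasDerivAt_log hr0)).sub
      ((hasDerivAt_pow 2 r).div_const 4)).const_mul (2 * π)
    refine h.congr_deriv ?_
    field_simp; push_cast; ring
  rw [intervalIntegral.integral_eq_sub_of_hasDerivAt hd]
  · ring
  · refine ContinuousOn.intervalIntegrable ?_
    rw [Set.uIcc_of_le hab]
    refine ContinuousOn.mul (by fun_prop) (continuousOn_log.mono fun r hr => ?_)
    simp; linarith [hr.1]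

theorem logPot_ball_zero (x : ℂ) : logPot (Metric.ball 0 1) x =
    if ‖x‖ ≤ 1 then -(π / 2) * (1 - ‖x‖ ^ 2) else π * log ‖x‖ := by
  have hi := integrableOn_log_norm x (Metric.isBounded_ball (x := (0 : ℂ)) (r := 1))
  have hm : Measurable ((Metric.ball (0 : ℂ) 1).indicator fun y => log ‖x - y‖) :=
    (Real.measurable_log.comp (by fun_prop)).indicator Metric.isOpen_ball.measurableSet
  rw [logPot, ← integral_indicator Metric.isOpen_ball.measurableSet,
    integral_eq_integral_circleAverage hm
      (hi.integrable_indicator Metric.isOpen_ball.measurableSet)]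
  have h1 : ∀ r ∈ Set.Ioi (0 : ℝ), 2 * π * r *
      circleAverage ((Metric.ball (0 : ℂ) 1).indicator fun y => log ‖x - y‖) 0 r =
      (Set.Ioo 0 1).indicator (fun r => 2 * π * r * log (max r ‖x‖)) r := by
    intro r hr
    have hr' : 0 < r := hr
    by_cases h : r < 1
    · rw [Set.indicator_of_mem (show r ∈ Set.Ioo 0 1 from ⟨hr, h⟩),
        ← circleAverage_log_norm_sub hr']
      congr 1
      simp only [circleAverage_def]
      congr 1
      refine intervalIntegral.integral_congr fun θ _ => ?_
      exact Set.indicator_of_mem (by simpa [abs_of_pos hr'] using h) _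
    · rw [Set.indicator_of_notMem (by simp [h])]
      rw [circleAverage_def]
      have : ∀ θ : ℝ, (Metric.ball (0 : ℂ) 1).indicator (fun y => log ‖x - y‖) (circleMap 0 r θ)
          = 0 := fun θ => Set.indicator_of_notMem (by simpa [abs_of_pos hr'] using h) _
      simp [this]
  rw [setIntegral_congr_fun measurableSet_Ioi h1, setIntegral_indicator measurableSet_Ioo,
    show Set.Ioi (0 : ℝ) ∩ Set.Ioo 0 1 = Set.Ioo 0 1 by ext; simp,
    ← integral_Ioc_eq_integral_Ioo, ← intervalIntegral.integral_of_le zero_le_one]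
  have hlin : ∀ a b c : ℝ, ∫ r in a..b, 2 * π * r * c = π * c * (b ^ 2 - a ^ 2) := by
    intro a b c
    simp_rw [show ∀ r : ℝ, 2 * π * r * c = (2 * π * c) * r by intro r; ring]
    rw [intervalIntegral.integral_const_mul, integral_id]; ring
  split_ifs with hx
  · rcases (norm_nonneg x).eq_or_lt with h0 | h0
    · rw [← h0]
      have hd : ∀ r ∈ Set.Ioo (0 : ℝ) 1, HasDerivAt
          (fun r => 2 * π * (r / 2 * (r * log r) - r ^ 2 / 4)) (2 * π * r * log (max r 0)) r := by
        intro r hr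
        have hr0 : r ≠ 0 := hr.1.ne'
        rw [max_eq_left hr.1.le]
        have h := ((((hasDerivAt_id r).div_const 2).mul
          ((hasDerivAt_id r).mul (Real.hasDerivAt_log hr0))).sub
          ((hasDerivAt_pow 2 r).div_const 4)).const_mul (2 * π)
        refine h.congr_deriv ?_
        simp; field_simp; ring
      rw [intervalIntegral.integral_eq_sub_of_hasDerivAt_of_le zero_le_one ?_ hd ?_]
      · simp; ring
      · exact (Continuous.mul continuous_const (((continuous_id.div_const 2).mul
          Real.continuous_mul_log).sub (by fun_prop))).continuousOn
      · have : Continuous fun r : ℝ => 2 * π * (r * log r) :=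
          continuous_const.mul Real.continuous_mul_log
        refine (this.intervalIntegrable 0 1).congr fun r hr => ?_
        rw [Set.uIoc_of_le zero_le_one] at hr
        simp [max_eq_left hr.1.le]; ring
    · have hI : ∀ a b, IntervalIntegrable (fun r => 2 * π * r * log (max r ‖x‖)) volume a b := by
        intro a b
        refine Continuous.intervalIntegrable ?_ _ _
        refine Continuous.mul (by fun_prop) (Continuous.log (by fun_prop) fun r => ?_)
        exact (lt_of_lt_of_le h0 (le_max_right _ _)).ne'
      rw [← intervalIntegral.integral_add_adjacent_intervals (hI 0 ‖x‖) (hI ‖x‖ 1)]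
      rw [intervalIntegral.integral_congr (g := fun r => 2 * π * r * log ‖x‖) (a := 0) (b := ‖x‖),
        intervalIntegral.integral_congr (g := fun r => 2 * π * r * log r) (a := ‖x‖) (b := 1),
        hlin, integral_mul_log h0 hx]
      · simp; ring
      · intro r hr
        rw [Set.uIcc_of_le hx] at hr
        simp [max_eq_left hr.1]
      · intro r hr
        rw [Set.uIcc_of_le h0.le] at hr
        simp [max_eq_right hr.2]
  · rw [intervalIntegral.integral_congr (g := fun r => 2 * π * r * log ‖x‖), hlin]
    · ring
    · intro r hr
      rw [Set.uIcc_of_le zero_le_one] at hr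
      simp [max_eq_right (hr.2.trans (not_le.1 hx).le)]

theorem logPot_ball (q x : ℂ) : logPot (Metric.ball q 1) x =
    if ‖x - q‖ ≤ 1 then -(π / 2) * (1 - ‖x - q‖ ^ 2) else π * log ‖x - q‖ := by
  rw [← logPot_ball_zero, logPot, logPot]
  have := (measurePreserving_add_left volume q).setIntegral_preimage_emb
    (MeasurableEquiv.addLeft q).measurableEmbedding (fun y => log ‖x - y‖) (Metric.ball q 1)
  rw [← this]
  simp [sub_sub]

end

section

theorem integrable_prod_inv_norm {α : Type*} [MeasurableSpace α] {μ : Measure α}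
    [IsFiniteMeasure μ] {φ : α → ℂ} (hφ : Measurable φ) {A : Set ℂ} (hA : Bornology.IsBounded A)
    (hm : MeasurableSet A) :
    Integrable (fun p : α × ℂ => ‖φ p.1 - p.2‖⁻¹) (μ.prod (volume.restrict A)) := by
  have hfin : IsFiniteMeasure (volume.restrict A) := ⟨by simpa using hA.measure_lt_top⟩
  have hmeas : AEStronglyMeasurable (fun p : α × ℂ => ‖φ p.1 - p.2‖⁻¹)
      (μ.prod (volume.restrict A)) := by fun_prop
  rw [integrable_prod_iff hmeas]
  refine ⟨ae_of_all _ fun x => integrableOn_inv_norm (φ x) hA, ?_⟩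
  refine Integrable.mono' (integrable_const (2 * √(2 * π * volume.real A)))
    hmeas.norm.integral_prod_right' (ae_of_all _ fun x => ?_)
  have h0 : 0 ≤ ∫ y in A, ‖φ x - y‖⁻¹ := integral_nonneg fun y => by positivity
  simp only [norm_inv, norm_norm]
  rw [Real.norm_of_nonneg h0]
  exact setIntegral_inv_norm_le (φ x) hA hm

theorem setIntegral_inv_norm_inter_ball_le (x : ℂ) (A : Set ℂ) {δ : ℝ} (hδ : 0 < δ) :
    ∫ y in A ∩ Metric.ball x δ, ‖x - y‖⁻¹ ≤ 2 * π * δ := by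
  rw [← integral_inv_norm_ball x hδ]
  exact setIntegral_mono_set (integrableOn_inv_norm_ball x δ)
      (ae_of_all _ fun y => by positivity) (Set.inter_subset_right).eventuallyLE

/-- A kernel with an integrable singularity of its gradient on the diagonal. -/
structure SingularKernel (Ω A : Set ℂ) (C : ℝ) (K : ℂ → ℂ → ℝ) (G : ℂ → ℂ → ℂ) : Prop where
  isOpen : IsOpen Ω
  bdd : Bornology.IsBounded A
  meas : MeasurableSet A
  measurable : Measurable (Function.uncurry G)
  integrable : ∀ x ∈ Ω, IntegrableOn (K x) A
  bound : ∀ x ∈ Ω, ∀ y ∈ A, x ≠ y → ‖G x y‖ ≤ C * ‖x - y‖⁻¹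
  cont : ∀ y ∈ A, ∀ x ∈ Ω, x ≠ y → ContinuousAt (fun x => G x y) x
  deriv : ∀ y ∈ A, ∀ x ∈ Ω, x ≠ y → ∀ e, HasLineDerivAt ℝ (fun x => K x y) ⟪G x y, e⟫ x e

namespace SingularKernel

variable {Ω A : Set ℂ} {C : ℝ} {K : ℂ → ℂ → ℝ} {G : ℂ → ℂ → ℂ}

theorem ae_bound (h : SingularKernel Ω A C K G) {x : ℂ} (hx : x ∈ Ω) :
    ∀ᵐ y ∂(volume.restrict A), ‖G x y‖ ≤ C * ‖x - y‖⁻¹ := by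
  filter_upwards [ae_restrict_mem h.meas, Measure.ae_ne _ x] with y hy hne
  exact h.bound x hx y hy hne.symm

theorem integrable_grad (h : SingularKernel Ω A C K G) {x : ℂ} (hx : x ∈ Ω) :
    IntegrableOn (G x) A :=
  Integrable.mono' ((integrableOn_inv_norm x h.bdd).const_mul C)
    (h.measurable.comp measurable_prodMk_left).aestronglyMeasurable (h.ae_bound hx)

theorem continuousOn_grad (h : SingularKernel Ω A C K G) (hC : 0 ≤ C) :
    ContinuousOn (fun x => ∫ y in A, G x y) Ω := by
  have hcut : ∀ δ > 0, ContinuousOn (fun x => ∫ y in A, (min 1 (‖x - y‖ / δ)) • G x y) Ω := by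
    intro δ hδ x hx
    refine continuousWithinAt_of_dominated (bound := fun _ => C / δ) ?_ ?_ ?_ ?_
    · refine Eventually.of_forall fun x => ?_
      have : Measurable (G x) := h.measurable.comp measurable_prodMk_left
      exact Measurable.aestronglyMeasurable (by fun_prop)
    · filter_upwards [self_mem_nhdsWithin] with x hx
      filter_upwards [h.ae_bound hx, Measure.ae_ne _ x] with y hy hne
      have hp : 0 < ‖x - y‖ := norm_pos_iff.2 (sub_ne_zero.2 hne.symm)
      rw [norm_smul, Real.norm_eq_abs, abs_of_nonneg (by positivity)]
      calc _ ≤ (‖x - y‖ / δ) * (C * ‖x - y‖⁻¹) := by gcongr; exact min_le_right _ _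
        _ = C / δ := by field_simp
    · exact integrableOn_const h.bdd.measure_lt_top.ne
    · filter_upwards [ae_restrict_mem h.meas, Measure.ae_ne _ x] with y hy hne
      refine ContinuousAt.continuousWithinAt ?_
      have h1 : ContinuousAt (fun x : ℂ => min 1 (‖x - y‖ / δ)) x := by fun_prop
      exact h1.smul (h.cont y hy x hx hne.symm)
  refine continuousOn_of_uniform_approx_of_continuousOn fun u hu => ?_
  obtain ⟨ε, hε, hu⟩ := Metric.mem_uniformity_dist.1 hu
  have hδ : 0 < ε / (2 * π * (C + 1)) := by positivity
  refine ⟨_, hcut _ hδ, fun x hx => hu ?_⟩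
  set δ := ε / (2 * π * (C + 1)) with hδd
  have hi := h.integrable_grad hx
  have hb := h.ae_bound hx
  have hGm : Measurable (G x) := h.measurable.comp measurable_prodMk_left
  have hi2 : IntegrableOn (fun y => (min 1 (‖x - y‖ / δ)) • G x y) A := by
    have hm : Measurable fun y => (min 1 (‖x - y‖ / δ)) • G x y := by fun_prop
    refine Integrable.mono hi hm.aestronglyMeasurable (ae_of_all _ fun y => ?_)
    rw [norm_smul, Real.norm_eq_abs, abs_of_nonneg (by positivity)]
    exact mul_le_of_le_one_left (norm_nonneg _) (min_le_left _ _)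
  rw [dist_eq_norm, ← integral_sub hi hi2]
  have h1 : ‖∫ y in A, (G x y - (min 1 (‖x - y‖ / δ)) • G x y)‖ ≤
      ∫ y in A, (Metric.ball x δ).indicator (fun y => C * ‖x - y‖⁻¹) y := by
    refine norm_integral_le_of_norm_le
      (((integrableOn_inv_norm x h.bdd).const_mul C).indicator Metric.isOpen_ball.measurableSet) ?_
    filter_upwards [hb] with y hy
    by_cases hy2 : y ∈ Metric.ball x δ
    · rw [Set.indicator_of_mem hy2, ← one_smul ℝ (G x y), smul_smul, ← sub_smul, norm_smul]
      refine (mul_le_of_le_one_left (norm_nonneg _) ?_).trans hy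
      rw [mul_one, Real.norm_eq_abs, abs_le]
      have : 0 ≤ min 1 (‖x - y‖ / δ) := by positivity
      constructor <;> linarith [min_le_left 1 (‖x - y‖ / δ)]
    · rw [Set.indicator_of_notMem hy2]
      rw [Metric.mem_ball, not_lt, dist_comm, Complex.dist_eq] at hy2
      rw [min_eq_left ((one_le_div hδ).2 hy2)]
      simp
  refine h1.trans_lt ?_
  rw [setIntegral_indicator Metric.isOpen_ball.measurableSet, integral_const_mul]
  calc _ ≤ C * (2 * π * δ) := by
        gcongr; exact setIntegral_inv_norm_inter_ball_le x A hδ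
    _ = ε * (C / (C + 1)) := by rw [hδd]; field_simp
    _ < ε * 1 := by
        gcongr
        rw [div_lt_one (by positivity)]; linarith
    _ = ε := mul_one _

theorem hasLineDerivAt (h : SingularKernel Ω A C K G) (hC : 0 ≤ C) {x : ℂ} (hx : x ∈ Ω) (e : ℂ) :
    HasLineDerivAt ℝ (fun x => ∫ y in A, K x y) ⟪∫ y in A, G x y, e⟫ x e := by
  rcases eq_or_ne e 0 with rfl | he
  · simpa [HasLineDerivAt] using hasDerivAt_const (0 : ℝ) (∫ y in A, K x y)
  have hcontl : Continuous fun t : ℝ => x + t • e := by fun_prop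
  obtain ⟨r, hr, hball⟩ := Metric.isOpen_iff.1 (h.isOpen.preimage hcontl) 0 (by simpa using hx)
  have hseg : ∀ t ∈ Metric.ball (0 : ℝ) r, ∀ s ∈ Set.uIcc 0 t, x + s • e ∈ Ω := by
    intro t ht s hs
    apply hball
    rw [Metric.mem_ball, Real.dist_eq, sub_zero] at ht ⊢
    refine lt_of_le_of_lt ?_ ht
    simpa using Set.abs_sub_left_of_mem_uIcc hs
  have hline : ∀ᵐ y : ℂ, y ∉ (AffineSubspace.mk' x (Submodule.span ℝ {e}) : Set ℂ) := by
    rw [ae_iff]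
    simp only [not_not]
    refine Measure.addHaar_affineSubspace volume _ fun htop => ?_
    have h1 : (AffineSubspace.mk' x (Submodule.span ℝ {e})).direction = ⊤ := by
      rw [htop]; exact AffineSubspace.direction_top ℝ ℂ ℂ
    rw [AffineSubspace.direction_mk'] at h1
    have h2 := finrank_span_singleton (K := ℝ) he
    rw [h1, finrank_top, Complex.finrank_real_complex] at h2
    omega
  have hne : ∀ᵐ y : ℂ, ∀ s : ℝ, x + s • e ≠ y := by
    filter_upwards [hline] with y hy s hs
    apply hy
    rw [← hs]
    simp only [SetLike.mem_coe, AffineSubspace.mem_mk', vsub_eq_sub, add_sub_cancel_left]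
    exact Submodule.smul_mem _ _ (Submodule.mem_span_singleton_self e)
  have hFTC : ∀ t ∈ Metric.ball (0 : ℝ) r, (∫ y in A, K (x + t • e) y) =
      (∫ y in A, K x y) + ∫ s in (0:ℝ)..t, ⟪∫ y in A, G (x + s • e) y, e⟫ := by
    intro t ht
    have hxt := hseg t ht t Set.right_mem_uIcc
    have h1 : ∀ᵐ y ∂(volume.restrict A), K (x + t • e) y - K x y =
        ∫ s in (0:ℝ)..t, ⟪G (x + s • e) y, e⟫ := by
      filter_upwards [ae_restrict_of_ae hne, ae_restrict_mem h.meas] with y hy hyA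
      rw [intervalIntegral.integral_eq_sub_of_hasDerivAt (f := fun s => K (x + s • e) y)]
      · simp
      · intro s hs
        have h2 := h.deriv y hyA _ (hseg t ht s hs) (hy s) e
        rw [HasLineDerivAt] at h2
        have h3 := HasDerivAt.comp_sub_const s s (f := fun u => K (x + s • e + u • e) y)
          (f' := ⟪G (x + s • e) y, e⟫) (by simpa using h2)
        refine h3.congr_of_eventuallyEq (Eventually.of_forall fun u => ?_)
        simp only []
        congr 1
        rw [sub_smul]; ring
      · refine ContinuousOn.intervalIntegrable fun s hs => ?_
        have h2 := h.cont y hyA _ (hseg t ht s hs) (hy s)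
        have h3 : ContinuousAt (fun s : ℝ => G (x + s • e) y) s :=
          ContinuousAt.comp (f := fun s : ℝ => x + s • e) h2 (by fun_prop)
        exact (h3.inner continuousAt_const).continuousWithinAt
    have hint : Integrable (fun p : ℝ × ℂ => ⟪G (x + p.1 • e) p.2, e⟫)
        ((volume.restrict (Set.uIoc 0 t)).prod (volume.restrict A)) := by
      have hfin : IsFiniteMeasure (volume.restrict (Set.uIoc 0 t)) :=
        ⟨by simp [Set.uIoc]⟩
      have hb := (integrable_prod_inv_norm (μ := volume.restrict (Set.uIoc 0 t))
        (φ := fun s : ℝ => x + s • e) (by fun_prop) h.bdd h.meas).const_mul (C * ‖e‖)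
      refine hb.mono' ?_ ?_
      · have : Measurable fun p : ℝ × ℂ => G (x + p.1 • e) p.2 :=
          h.measurable.comp (f := fun p : ℝ × ℂ => (x + p.1 • e, p.2)) (by fun_prop)
        exact (this.inner measurable_const).aestronglyMeasurable
      · rw [Measure.prod_restrict]
        refine (ae_restrict_iff' (measurableSet_uIoc.prod h.meas)).2 ?_
        have hp : ∀ᵐ p : ℝ × ℂ, x + p.1 • e ≠ p.2 := by
          refine Measure.ae_prod_iff_ae_ae ?_ |>.2 (ae_of_all _ fun s => ?_)
          · exact (measurableSet_eq_fun (by fun_prop) (by fun_prop)).compl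
          · exact (Measure.ae_ne volume (x + s • e)).mono fun y hy => Ne.symm hy
        filter_upwards [hp] with p hp hpm
        have h2 := h.bound _ (hseg t ht p.1 (Set.uIoc_subset_uIcc hpm.1)) p.2 hpm.2 hp
        calc _ ≤ ‖G (x + p.1 • e) p.2‖ * ‖e‖ := norm_inner_le_norm _ _
          _ ≤ (C * ‖x + p.1 • e - p.2‖⁻¹) * ‖e‖ := by gcongr
          _ = _ := by ring
    have h4 : (∫ y in A, K (x + t • e) y) - ∫ y in A, K x y =
        ∫ y in A, ∫ s in (0:ℝ)..t, ⟪G (x + s • e) y, e⟫ := by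
      rw [← integral_sub (h.integrable _ hxt) (h.integrable _ hx)]
      exact integral_congr_ae h1
    rw [← sub_eq_iff_eq_add', h4, ← intervalIntegral_integral_swap hint]
    refine intervalIntegral.integral_congr fun s hs => ?_
    have := integral_inner (𝕜 := ℝ) (h.integrable_grad (hseg t ht s hs)) e
    rw [real_inner_comm, ← this]
    simp_rw [real_inner_comm]
  have hcG : ContinuousOn (fun s : ℝ => ⟪∫ y in A, G (x + s • e) y, e⟫) (Metric.ball 0 r) := by
    refine ContinuousOn.inner ?_ continuousOn_const
    exact (h.continuousOn_grad hC).comp (f := fun s : ℝ => x + s • e) hcontl.continuousOn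
      fun s hs => hball hs
  have hd : HasDerivAt (fun t : ℝ => (∫ y in A, K x y) +
      ∫ s in (0:ℝ)..t, ⟪∫ y in A, G (x + s • e) y, e⟫) ⟪∫ y in A, G (x + (0:ℝ) • e) y, e⟫ 0 := by
    refine HasDerivAt.const_add _ ?_
    refine intervalIntegral.integral_hasDerivAt_right (by simp) ?_ ?_
    · exact hcG.stronglyMeasurableAtFilter Metric.isOpen_ball 0 (Metric.mem_ball_self hr)
    · exact hcG.continuousAt (Metric.ball_mem_nhds 0 hr)
  rw [zero_smul, add_zero] at hd
  exact hd.congr_of_eventuallyEq (eventually_of_mem (Metric.ball_mem_nhds 0 hr) hFTC)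

end SingularKernel

end

section

/-- The gradient `(x - y) / |x - y|²` of `log |x - y|`. -/
def logGrad (x y : ℂ) : ℂ := (‖x - y‖ ^ 2)⁻¹ • (x - y)

theorem norm_logGrad (x y : ℂ) : ‖logGrad x y‖ = ‖x - y‖⁻¹ := by
  rw [logGrad, norm_smul, norm_inv, norm_pow, norm_norm]
  rcases (norm_nonneg (x - y)).eq_or_lt with h | h
  · rw [← h]; simp
  · field_simp

theorem measurable_logGrad : Measurable (Function.uncurry logGrad) := by
  unfold logGrad Function.uncurry
  fun_prop

theorem hasLineDerivAt_log_norm {x y : ℂ} (h : x ≠ y) (e : ℂ) :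
    HasLineDerivAt ℝ (fun x => log ‖x - y‖) ⟪logGrad x y, e⟫ x e := by
  have h0 : x - y ≠ 0 := sub_ne_zero.2 h
  have h1 : HasDerivAt (fun t : ℝ => x + t • e - y) e 0 := by
    simpa using (((hasDerivAt_id (0 : ℝ)).smul_const e).const_add x).sub_const y
  have h2 := h1.norm_sq
  have h3 : ‖x + (0 : ℝ) • e - y‖ ^ 2 ≠ 0 := by simpa using h0
  have h4 := (h2.log h3).const_mul (1 / 2 : ℝ)
  refine (h4.congr_of_eventuallyEq (Eventually.of_forall fun t => ?_)).congr_deriv ?_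
  · simp [Real.log_pow]
  · simp only [zero_smul, add_zero, logGrad, inner_smul_left]
    simp
    field_simp

theorem singularKernel_log {Ω A : Set ℂ} (hΩ : IsOpen Ω) (hA : Bornology.IsBounded A)
    (hm : MeasurableSet A) : SingularKernel Ω A 1 (fun x y => log ‖x - y‖) logGrad where
  isOpen := hΩ
  bdd := hA
  meas := hm
  measurable := measurable_logGrad
  integrable x _ := integrableOn_log_norm x hA
  bound x _ y _ _ := by rw [norm_logGrad, one_mul]
  cont y _ x _ h := by
    have h0 : ‖x - y‖ ^ 2 ≠ 0 := by simpa using sub_ne_zero.2 h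
    unfold logGrad
    fun_prop (disch := assumption)
  deriv y _ x _ h e := hasLineDerivAt_log_norm h e

/-- The gradient of `logPot E`. -/
def logPotGrad (E : Set ℂ) (x : ℂ) : ℂ := ∫ y in E, logGrad x y

theorem hasLineDerivAt_logPot {E : Set ℂ} (hE : Bornology.IsBounded E) (hm : MeasurableSet E)
    (x e : ℂ) : HasLineDerivAt ℝ (logPot E) ⟪logPotGrad E x, e⟫ x e :=
  (singularKernel_log isOpen_univ hE hm).hasLineDerivAt zero_le_one (Set.mem_univ x) e

theorem continuous_logPotGrad {E : Set ℂ} (hE : Bornology.IsBounded E) (hm : MeasurableSet E) :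
    Continuous (logPotGrad E) :=
  continuousOn_univ.1 ((singularKernel_log isOpen_univ hE hm).continuousOn_grad zero_le_one)

theorem norm_logPotGrad_le {E : Set ℂ} (hE : Bornology.IsBounded E) (hm : MeasurableSet E)
    (x : ℂ) : ‖logPotGrad E x‖ ≤ 2 * √(2 * π * volume.real E) := by
  refine (norm_integral_le_integral_norm _).trans ?_
  simp_rw [norm_logGrad]
  exact setIntegral_inv_norm_le x hE hm

/-- A compactly supported function `φ` with continuous gradient `G`. -/
structure TestFun (φ : ℂ → ℝ) (G : ℂ → ℂ) : Prop where
  cont : Continuous φ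
  contG : Continuous G
  compact : HasCompactSupport φ
  compactG : HasCompactSupport G
  deriv : ∀ x e, HasLineDerivAt ℝ φ ⟪G x, e⟫ x e

namespace TestFun

variable {φ : ℂ → ℝ} {G : ℂ → ℂ}

theorem integrable (h : TestFun φ G) : Integrable φ :=
  h.cont.integrable_of_hasCompactSupport h.compact

theorem measurable_inner (h : TestFun φ G) {F : ℂ → ℂ} (hF : Measurable F) :
    Measurable fun x => ⟪G x, F x⟫ := h.contG.measurable.inner hF

theorem measurable_inner_logGrad (h : TestFun φ G) (y : ℂ) :
    Measurable fun x => ⟪G x, logGrad x y⟫ :=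
  h.measurable_inner (F := fun x => logGrad x y)
    (measurable_logGrad.comp (f := fun x => (x, y)) (by fun_prop))

theorem integrable_logGrad (h : TestFun φ G) (y : ℂ) :
    Integrable fun x => ⟪G x, logGrad x y⟫ := by
  obtain ⟨C, hC⟩ := h.contG.bounded_above_of_compact_support h.compactG
  have hb : Bornology.IsBounded (tsupport G) := h.compactG.isCompact.isBounded
  have h1 : IntegrableOn (fun x => ⟪G x, logGrad x y⟫) (tsupport G) := by
    refine Integrable.mono' ((integrableOn_inv_norm y hb).const_mul C)
      (h.measurable_inner_logGrad y).aestronglyMeasurable (ae_of_all _ fun x => ?_)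
    refine (norm_inner_le_norm _ _).trans ?_
    rw [norm_logGrad, norm_sub_rev]
    gcongr
    exact hC x
  refine (integrableOn_iff_integrable_of_support_subset fun x hx => ?_).1 h1
  by_contra hn
  exact hx (by simp [image_eq_zero_of_notMem_tsupport hn])

theorem integral_logGrad (h : TestFun φ G) (y : ℂ) :
    ∫ x, ⟪G x, logGrad x y⟫ = -(2 * π) * φ y := by
  have hi := (h.integrable_logGrad y).comp_add_left y
  rw [← integral_add_left_eq_self _ y, integral_polar]
  have hmeas : Measurable fun z => ⟪G (y + z), logGrad (y + z) y⟫ :=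
    (h.measurable_inner_logGrad y).comp (measurable_const_add y)
  have hp := integrable_polar hmeas hi
  have hcongr : ∀ p ∈ Set.Ioi (0 : ℝ) ×ˢ Set.Ioo (-π) π,
      p.1 * ⟪G (y + circleMap 0 p.1 p.2), logGrad (y + circleMap 0 p.1 p.2) y⟫ =
        ⟪G (y + p.1 • circleMap 0 1 p.2), circleMap 0 1 p.2⟫ := by
    rintro ⟨r, θ⟩ ⟨hr, -⟩
    have hr : 0 < r := hr
    have h1 : circleMap 0 r θ = r • circleMap 0 1 θ := by simp [circleMap]
    simp only [h1, logGrad, add_sub_cancel_left, norm_smul, norm_circleMap_zero, inner_smul_right]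
    simp
    field_simp
  have hms : MeasurableSet (Set.Ioi (0 : ℝ) ×ˢ Set.Ioo (-π) π) :=
    measurableSet_Ioi.prod measurableSet_Ioo
  rw [setIntegral_congr_fun hms hcongr]
  replace hp := (integrableOn_congr_fun hcongr hms).1 hp
  rw [IntegrableOn, Measure.volume_eq_prod, ← Measure.prod_restrict] at hp
  rw [Measure.volume_eq_prod, ← Measure.prod_restrict, integral_prod_symm _ hp]
  have hbd : ∃ R, ∀ x, R < ‖x‖ → φ x = 0 ∧ G x = 0 := by
    obtain ⟨R, hR⟩ := (h.compact.isCompact.isBounded.union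
      h.compactG.isCompact.isBounded).subset_closedBall 0
    refine ⟨R, fun x hx => ⟨?_, ?_⟩⟩ <;> refine image_eq_zero_of_notMem_tsupport fun hn => ?_
    · have := hR (Or.inl hn); simp at this; linarith
    · have := hR (Or.inr hn); simp at this; linarith
  obtain ⟨R, hR⟩ := hbd
  have hray : ∀ θ : ℝ, ∫ r in Set.Ioi (0 : ℝ),
      ⟪G (y + r • circleMap 0 1 θ), circleMap 0 1 θ⟫ = -φ y := by
    intro θ
    have hn : ‖circleMap 0 1 θ‖ = 1 := by simp
    generalize circleMap 0 1 θ = e at hn ⊢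
    have hout : ∀ r : ℝ, R + ‖y‖ < |r| → R < ‖y + r • e‖ := by
      intro r hr
      have h1 : ‖r • e‖ = |r| := by rw [norm_smul, hn, mul_one, Real.norm_eq_abs]
      have h2 := norm_sub_norm_le (r • e) (-y)
      rw [sub_neg_eq_add, add_comm, norm_neg] at h2
      linarith
    have h0 : φ (y + (0 : ℝ) • e) = φ y := by simp
    rw [integral_Ioi_of_hasDerivAt_of_tendsto (f := fun r => φ (y + r • e)) (m := 0), h0, zero_sub]
    · exact (h.cont.comp (by fun_prop)).continuousWithinAt
    · intro r _
      have h2 := h.deriv (y + r • e) e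
      rw [HasLineDerivAt] at h2
      have h3 := HasDerivAt.comp_sub_const r r (f := fun u => φ (y + r • e + u • e))
        (f' := ⟪G (y + r • e), e⟫) (by simpa using h2)
      refine h3.congr_of_eventuallyEq (Eventually.of_forall fun u => ?_)
      simp only []
      congr 1
      rw [sub_smul]; ring
    · refine (Continuous.integrable_of_hasCompactSupport ?_ ?_).integrableOn
      · exact (h.contG.comp (by fun_prop)).inner continuous_const
      · refine HasCompactSupport.intro (isCompact_Icc (a := -(R + ‖y‖)) (b := R + ‖y‖))
          fun r hr => ?_
        rw [(hR _ (hout r ?_)).2, inner_zero_left]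
        by_contra hc
        exact hr (abs_le.1 (not_lt.1 hc))
    · refine tendsto_const_nhds.congr' ?_
      filter_upwards [eventually_gt_atTop (R + ‖y‖)] with r hr
      exact ((hR _ (hout r (hr.trans_le (le_abs_self r)))).1).symm
  simp_rw [hray]
  rw [setIntegral_const]
  simp [Measure.real, pi_pos.le]
  left; ring

theorem integral_logPotGrad (h : TestFun φ G) {A : Set ℂ} (hA : Bornology.IsBounded A)
    (hm : MeasurableSet A) : ∫ x, ⟪G x, logPotGrad A x⟫ = -(2 * π) * ∫ y in A, φ y := by
  obtain ⟨C, hC⟩ := h.contG.bounded_above_of_compact_support h.compactG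
  have hC0 : 0 ≤ C := (norm_nonneg _).trans (hC 0)
  have hb : Bornology.IsBounded (tsupport G) := h.compactG.isCompact.isBounded
  have hfin : IsFiniteMeasure (volume.restrict (tsupport G)) :=
    ⟨by simpa using hb.measure_lt_top⟩
  have hint : Integrable (fun p : ℂ × ℂ => ⟪G p.1, logGrad p.1 p.2⟫)
      ((volume.restrict (tsupport G)).prod (volume.restrict A)) := by
    refine ((integrable_prod_inv_norm (μ := volume.restrict (tsupport G)) measurable_id hA
      hm).const_mul C).mono' ?_ (ae_of_all _ fun p => ?_)
    · exact ((h.contG.measurable.comp measurable_fst).inner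
        measurable_logGrad).aestronglyMeasurable
    · refine (norm_inner_le_norm _ _).trans ?_
      rw [norm_logGrad]
      exact mul_le_mul_of_nonneg_right (hC _) (by positivity)
  have hsupp : ∀ F : ℂ → ℂ, ∫ x in tsupport G, ⟪G x, F x⟫ = ∫ x, ⟪G x, F x⟫ := by
    intro F
    refine setIntegral_eq_integral_of_forall_compl_eq_zero fun x hx => ?_
    rw [image_eq_zero_of_notMem_tsupport hx, inner_zero_left]
  rw [← hsupp, ← integral_const_mul]
  have h1 : ∀ x, ⟪G x, logPotGrad A x⟫ = ∫ y in A, ⟪G x, logGrad x y⟫ := fun x =>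
    (integral_inner ((singularKernel_log isOpen_univ hA hm).integrable_grad
      (Set.mem_univ x)) (G x)).symm
  simp_rw [h1]
  rw [integral_integral_swap hint]
  refine integral_congr_ae (ae_of_all _ fun y => ?_)
  simp only [hsupp (fun x => logGrad x y), h.integral_logGrad]

/-- Integration by parts against a function that is differentiable near the support. -/
theorem integral_mul_deriv (h : TestFun φ G) {S : Set ℂ} (hS : IsCompact S)
    (hφ : tsupport φ ⊆ S) (hG : Function.support G ⊆ S)
    {T T' : ℂ → ℝ} {e : ℂ} (hT : ContinuousOn T S) (hT' : ContinuousOn T' S)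
    (hd : ∀ x ∈ S, HasLineDerivAt ℝ T (T' x) x e) :
    ∫ x, φ x * T' x = -∫ x, ⟪G x, e⟫ * T x := by
  have hint : ∀ {f g : ℂ → ℝ}, Continuous f → Function.support f ⊆ S →
      ContinuousOn g S → Integrable fun x => f x * g x := by
    intro f g hf hfs hg
    rw [← integrableOn_iff_integrable_of_support_subset
      ((Function.support_mul_subset_left f g).trans hfs)]
    exact (hf.continuousOn.mul hg).integrableOn_compact hS
  have hGe : Continuous fun x => ⟪G x, e⟫ := h.contG.inner continuous_const
  have hGs : Function.support (fun x => ⟪G x, e⟫) ⊆ S := by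
    intro x hx
    refine hG fun h0 => hx ?_
    simp [h0]
  have hφ' := (subset_tsupport φ).trans hφ
  exact integral_bilinear_hasLineDerivAt_right_eq_neg_left_of_integrable (v := e)
    (B := ContinuousLinearMap.mul ℝ ℝ) (hint hGe hGs hT) (hint h.cont hφ' hT')
    (hint h.cont hφ' hT) (fun x _ => h.deriv x e) fun x hx => hd x (hφ hx)

end TestFun

end

section

theorem strictMono_segArea : StrictMono fun α : ℝ => α - sin α * cos α := by
  intro a b hab
  have h1 : sin b * cos b - sin a * cos a = sin (b - a) * cos (b + a) := by
    rw [sin_sub, cos_add]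
    linear_combination (-sin b * cos b) * sin_sq_add_cos_sq a
      + (sin a * cos a) * sin_sq_add_cos_sq b
  have h2 : |sin (b - a)| < b - a := by
    have := Real.abs_sin_lt_abs (x := b - a) (by linarith)
    rwa [abs_of_pos (show 0 < b - a by linarith)] at this
  have h3 := abs_cos_le_one (b + a)
  have h4 : sin (b - a) * cos (b + a) ≤ |sin (b - a)| := by
    refine (le_abs_self _).trans ?_
    rw [abs_mul]
    exact mul_le_of_le_one_right (abs_nonneg _) h3
  simp only []
  linarith

theorem surjective_segArea : Function.Surjective fun α : ℝ => α - sin α * cos α := by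
  have hb : ∀ α : ℝ, |sin α * cos α| ≤ 1 := fun α => by
    rw [abs_mul]
    exact mul_le_one₀ (abs_sin_le_one α) (abs_nonneg _) (abs_cos_le_one α)
  refine Continuous.surjective (by fun_prop) ?_ ?_
  · refine tendsto_atTop_mono (f := fun α : ℝ => α - 1) (fun α => ?_)
      (tendsto_atTop_add_const_right _ (-1) tendsto_id)
    linarith [(abs_le.1 (hb α)).2]
  · refine tendsto_atBot_mono (fun α => ?_)
      (tendsto_atBot_add_const_right atBot (1 : ℝ) tendsto_id)
    simp only [id]
    linarith [(abs_le.1 (hb α)).1]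

/-- The opening angle of a segment of the unit disc in terms of its area. -/
def segAngle : ℝ ≃ₜ ℝ :=
  (strictMono_segArea.orderIsoOfSurjective _ surjective_segArea).symm.toHomeomorph

theorem segAngle_area (α : ℝ) : segAngle (α - sin α * cos α) = α :=
  (strictMono_segArea.orderIsoOfSurjective _ surjective_segArea).symm_apply_apply α

theorem area_segAngle (v : ℝ) : segAngle v - sin (segAngle v) * cos (segAngle v) = v :=
  (strictMono_segArea.orderIsoOfSurjective _ surjective_segArea).apply_symm_apply v

theorem strictMono_segAngle : StrictMono segAngle :=
  (strictMono_segArea.orderIsoOfSurjective _ surjective_segArea).symm.strictMono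

theorem segAngle_zero : segAngle 0 = 0 := by simpa using segAngle_area 0

theorem segAngle_pi : segAngle π = π := by simpa using segAngle_area π

theorem hasDerivAt_segArea (α : ℝ) :
    HasDerivAt (fun α : ℝ => α - sin α * cos α) (2 * sin α ^ 2) α := by
  refine ((hasDerivAt_id α).sub ((hasDerivAt_sin α).mul (hasDerivAt_cos α))).congr_deriv ?_
  nlinarith [sin_sq_add_cos_sq α]

theorem hasDerivAt_segAngle {v : ℝ} (hv : 0 < v) (hv' : v < π) :
    HasDerivAt segAngle (2 * sin (segAngle v) ^ 2)⁻¹ v ∧ 0 < sin (segAngle v) := by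
  have h0 := strictMono_segAngle hv
  have h1 := strictMono_segAngle hv'
  rw [segAngle_zero] at h0
  rw [segAngle_pi] at h1
  have hs := sin_pos_of_pos_of_lt_pi h0 h1
  exact ⟨HasDerivAt.of_local_left_inverse segAngle.continuous.continuousAt
    (hasDerivAt_segArea _) (by positivity) (Eventually.of_forall area_segAngle), hs⟩

/-- Mean over a chord of the disc of radius `s` of a function of the squared radius. -/
def chordMean (s : ℝ) (h : ℝ → ℝ) (α : ℝ) : ℝ :=
  ∫ τ in (0:ℝ)..1, h (s ^ 2 * cos α ^ 2 + 4 * s ^ 2 * sin α ^ 2 * (τ - 1 / 2) ^ 2)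

theorem continuous_chordMean (s : ℝ) {h : ℝ → ℝ} (hh : Continuous h) :
    Continuous (chordMean s h) := by
  unfold chordMean
  exact intervalIntegral.continuous_parametric_intervalIntegral_of_continuous (by fun_prop)
    continuous_const

/-- The integral over the disc of radius `s` of a function of the squared radius. -/
def discInt (s : ℝ) (h : ℝ → ℝ) : ℝ :=
  ∫ α in (0:ℝ)..π, chordMean s h α * (s ^ 2 * (2 * sin α ^ 2))

theorem discInt_id (s : ℝ) : discInt s id = π * s ^ 4 / 2 := by
  have h1 : ∀ α, chordMean s id α = s ^ 2 * (cos α ^ 2 + sin α ^ 2 / 3) := by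
    intro α
    have h2 : ∀ τ ∈ Set.uIcc (0:ℝ) 1, HasDerivAt
        (fun τ => s ^ 2 * cos α ^ 2 * τ + 4 * s ^ 2 * sin α ^ 2 * ((τ - 1 / 2) ^ 3 / 3))
        (s ^ 2 * cos α ^ 2 + 4 * s ^ 2 * sin α ^ 2 * (τ - 1 / 2) ^ 2) τ := by
      intro τ _
      have h3 := (((hasDerivAt_id τ).sub_const (1 / 2)).pow 3).div_const 3
      refine (((hasDerivAt_id τ).const_mul (s ^ 2 * cos α ^ 2)).add
        (h3.const_mul (4 * s ^ 2 * sin α ^ 2))).congr_deriv ?_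
      simp
    simp only [chordMean, id]
    rw [intervalIntegral.integral_eq_sub_of_hasDerivAt h2
      (Continuous.intervalIntegrable (by fun_prop) _ _)]
    ring
  unfold discInt
  have h2 : ∀ α ∈ Set.uIcc (0:ℝ) π, HasDerivAt
      (fun α => s ^ 4 * (α / 2 - sin α * cos α / 2 + sin α ^ 3 * cos α * (1 / 3)))
      (chordMean s id α * (s ^ 2 * (2 * sin α ^ 2))) α := by
    intro α _
    rw [h1]
    have hs := hasDerivAt_sin α
    have hc := hasDerivAt_cos α
    have e1 := (hs.mul hc)
    have e2 := ((hs.pow 3).mul hc)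
    refine (((((hasDerivAt_id α).div_const 2).sub (e1.div_const 2)).add (e2.mul_const (1 / 3))).const_mul
      (s ^ 4)).congr_of_eventuallyEq (Eventually.of_forall fun x => ?_) |>.congr_deriv ?_
    · simp
    · simp
      linear_combination (s ^ 4 * (-1 / 2 - sin α ^ 2)) * sin_sq_add_cos_sq α
  rw [intervalIntegral.integral_eq_sub_of_hasDerivAt h2]
  · simp; ring
  · exact Continuous.intervalIntegrable
      ((continuous_chordMean s continuous_id).mul (by fun_prop)) _ _
theorem integral_max_sub_sq {R : ℝ} (hR : 0 ≤ R) :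
    Integrable (fun z : ℂ => max (R - ‖z‖ ^ 2) 0) ∧
      ∫ z : ℂ, max (R - ‖z‖ ^ 2) 0 = π * R ^ 2 / 2 := by
  have hc : Continuous fun z : ℂ => max (R - ‖z‖ ^ 2) 0 := by fun_prop
  have hi : Integrable fun z : ℂ => max (R - ‖z‖ ^ 2) 0 := by
    refine hc.integrable_of_hasCompactSupport
      (HasCompactSupport.intro (isCompact_closedBall 0 (√R)) fun z hz => ?_)
    have h1 : √R < ‖z‖ := by simpa using hz
    have h2 := (Real.sqrt_lt_sqrt_iff_of_pos (x := R) (y := ‖z‖ ^ 2) (by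
      have := (Real.sqrt_nonneg R).trans_lt h1
      positivity)).1 (by rwa [Real.sqrt_sq (norm_nonneg z)])
    exact max_eq_right (by linarith)
  refine ⟨hi, ?_⟩
  rw [integral_eq_integral_circleAverage hc.measurable hi]
  have h1 : ∀ r ∈ Set.Ioi (0:ℝ), 2 * π * r * circleAverage (fun z : ℂ => max (R - ‖z‖ ^ 2) 0) 0 r =
      (Set.Ioc 0 √R).indicator (fun r => 2 * π * r * (R - r ^ 2)) r := by
    intro r hr
    have hr : 0 < r := hr
    rw [circleAverage_def]
    simp only [norm_circleMap_zero, abs_of_pos hr, intervalIntegral.integral_const, smul_eq_mul,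
      Set.indicator, Set.mem_Ioc, hr, true_and, sub_zero]
    split_ifs with h
    · have h2 := (Real.le_sqrt hr.le hR).1 h
      rw [max_eq_left (by linarith)]
      field_simp
    · have h2 := (Real.sqrt_lt' hr).1 (not_le.1 h)
      rw [max_eq_right (by linarith)]
      simp
  rw [setIntegral_congr_fun measurableSet_Ioi h1, setIntegral_indicator measurableSet_Ioc,
    Set.inter_eq_self_of_subset_right Set.Ioc_subset_Ioi_self,
    ← intervalIntegral.integral_of_le (Real.sqrt_nonneg R)]
  have h2 : ∀ r ∈ Set.uIcc (0:ℝ) (√R), HasDerivAt (fun r => π * (R * r ^ 2 - r ^ 4 / 2))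
      (2 * π * r * (R - r ^ 2)) r := by
    intro r _
    refine ((((hasDerivAt_pow 2 r).const_mul R).sub
      ((hasDerivAt_pow 4 r).div_const 2)).const_mul π).congr_deriv ?_
    simp
    ring
  rw [intervalIntegral.integral_eq_sub_of_hasDerivAt h2
    (Continuous.intervalIntegrable (by fun_prop) _ _)]
  have h3 : √R ^ 4 = R ^ 2 := by
    rw [show (4:ℕ) = 2 * 2 from rfl, pow_mul, Real.sq_sqrt hR]
  rw [h3, Real.sq_sqrt hR]
  ring

theorem integral_complex_eq {f : ℂ → ℝ} (hf : Integrable f) :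
    ∫ z, f z = ∫ x : ℝ, ∫ y : ℝ, f ⟨x, y⟩ := by
  rw [← Complex.volume_preserving_equiv_real_prod.symm.integral_comp
    Complex.measurableEquivRealProd.symm.measurableEmbedding, Measure.volume_eq_prod,
    integral_prod]
  · rfl
  · exact (Complex.volume_preserving_equiv_real_prod.symm.integrable_comp_emb
      Complex.measurableEquivRealProd.symm.measurableEmbedding).2 hf

theorem discInt_le {s R : ℝ} (hs : 0 ≤ s) (hR : 0 ≤ R) :
    discInt s (fun r => max (R - r) 0) ≤ π * R ^ 2 / 2 := by
  obtain ⟨hi, hval⟩ := integral_max_sub_sq hR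
  set D : Set ℂ := {z | ‖z‖ ^ 2 < s ^ 2} with hD
  have hDm : MeasurableSet D := measurableSet_lt (by fun_prop) (by fun_prop)
  have hle : ∫ z, D.indicator (fun z : ℂ => max (R - ‖z‖ ^ 2) 0) z ≤ π * R ^ 2 / 2 := by
    rw [← hval]
    refine integral_mono (hi.indicator hDm) hi fun z => ?_
    exact Set.indicator_le_self' (fun z _ => le_max_right _ _) z
  refine le_trans (le_of_eq ?_) hle
  rw [integral_complex_eq (hi.indicator hDm)]
  set Q : ℝ → ℝ := fun x => ∫ y in (-√(s ^ 2 - x ^ 2))..√(s ^ 2 - x ^ 2),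
    max (R - (x ^ 2 + y ^ 2)) 0 with hQ
  have hQc : Continuous Q := by
    have h1 : ∀ x, Q x = (∫ y in (0:ℝ)..√(s ^ 2 - x ^ 2), max (R - (x ^ 2 + y ^ 2)) 0) -
        ∫ y in (0:ℝ)..(-√(s ^ 2 - x ^ 2)), max (R - (x ^ 2 + y ^ 2)) 0 := by
      intro x
      rw [hQ]
      exact (intervalIntegral.integral_interval_sub_left
        (Continuous.intervalIntegrable (by fun_prop) _ _)
        (Continuous.intervalIntegrable (by fun_prop) _ _)).symm
    rw [show Q = _ from funext h1]
    exact (intervalIntegral.continuous_parametric_intervalIntegral_of_continuous (by fun_prop)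
      (by fun_prop)).sub (intervalIntegral.continuous_parametric_intervalIntegral_of_continuous
        (by fun_prop) (by fun_prop))
  have hin : ∀ x : ℝ, ∫ y : ℝ, D.indicator (fun z : ℂ => max (R - ‖z‖ ^ 2) 0) ⟨x, y⟩ =
      (Set.Ioc (-s) s).indicator Q x := by
    intro x
    have h1 : ∀ y : ℝ, ‖(⟨x, y⟩ : ℂ)‖ ^ 2 = x ^ 2 + y ^ 2 := fun y => by
      rw [← Complex.normSq_eq_norm_sq, Complex.normSq_mk]; ring
    have h2 : ∀ y : ℝ, D.indicator (fun z : ℂ => max (R - ‖z‖ ^ 2) 0) ⟨x, y⟩ =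
        (Set.Ioo (-√(s ^ 2 - x ^ 2)) √(s ^ 2 - x ^ 2)).indicator
          (fun y => max (R - (x ^ 2 + y ^ 2)) 0) y := by
      intro y
      simp only [Set.indicator, hD, Set.mem_ofPred_eq, h1, Set.mem_Ioo]
      refine if_congr ?_ rfl rfl
      rw [← abs_lt, Real.lt_sqrt (abs_nonneg y), sq_abs]
      constructor <;> intro h <;> linarith
    simp_rw [h2]
    rw [integral_indicator measurableSet_Ioo, ← integral_Ioc_eq_integral_Ioo,
      ← intervalIntegral.integral_of_le (by linarith [Real.sqrt_nonneg (s ^ 2 - x ^ 2)])]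
    by_cases hx : x ∈ Set.Ioc (-s) s
    · rw [Set.indicator_of_mem hx]
    · rw [Set.indicator_of_notMem hx, Real.sqrt_eq_zero_of_nonpos]
      · simp
      · have : s ≤ |x| := by
          by_contra hc
          have := abs_lt.1 (not_le.1 hc)
          exact hx ⟨this.1, this.2.le⟩
        nlinarith [sq_abs x]
  simp_rw [hin]
  rw [integral_indicator measurableSet_Ioc, ← intervalIntegral.integral_of_le (by linarith)]
  have hsub : ∫ x in (-s)..s, Q x = ∫ α in (0:ℝ)..π, Q (-s * cos α) * (s * sin α) := by
    have := intervalIntegral.integral_comp_mul_deriv (a := 0) (b := π) (f := fun α => -s * cos α)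
      (f' := fun α => s * sin α) (g := Q) (fun α _ => by
        simpa using (hasDerivAt_cos α).const_mul (-s)) (by fun_prop) hQc
    simpa [Function.comp_def] using this.symm
  rw [hsub]
  refine intervalIntegral.integral_congr fun α hα => ?_
  rw [Set.uIcc_of_le pi_pos.le] at hα
  have hsin := sin_nonneg_of_mem_Icc hα
  have h4 : √(s ^ 2 - (-s * cos α) ^ 2) = s * sin α := by
    rw [show s ^ 2 - (-s * cos α) ^ 2 = (s * sin α) ^ 2 by
      linear_combination (-s ^ 2) * sin_sq_add_cos_sq α]
    exact Real.sqrt_sq (by positivity)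
  simp only [hQ, h4]
  have h5 : chordMean s (fun r => max (R - r) 0) α * (2 * s * sin α) =
      ∫ y in (-(s * sin α))..(s * sin α), max (R - ((-s * cos α) ^ 2 + y ^ 2)) 0 := by
    have := intervalIntegral.mul_integral_comp_mul_sub (a := 0) (b := 1)
      (f := fun y => max (R - ((-s * cos α) ^ 2 + y ^ 2)) 0) (c := 2 * s * sin α) (d := s * sin α)
    rw [show 2 * s * sin α * 0 - s * sin α = -(s * sin α) by ring,
      show 2 * s * sin α * 1 - s * sin α = s * sin α by ring] at this
    rw [← this, mul_comm, chordMean]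
    congr 1
    refine intervalIntegral.integral_congr fun τ _ => ?_
    congr 2
    ring
  rw [← h5]
  ring

end

section

/-- A map `T` transporting the density `ρ` to the uniform density on a centred disc, together with
the diagonal entries of its triangular derivative. -/
structure TransportMap (ρ : ℂ → ℝ) (T : ℂ → ℂ) (T₁ T₂ : ℂ → ℝ) : Prop where
  measurable : Measurable T
  contRe : ContinuousOn (fun z => (T z).re) {z | 0 < ρ z}
  contIm : ContinuousOn (fun z => (T z).im) {z | 0 < ρ z}
  cont₁ : ContinuousOn T₁ {z | 0 < ρ z}
  cont₂ : ContinuousOn T₂ {z | 0 < ρ z}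
  deriv₁ : ∀ z, 0 < ρ z → HasLineDerivAt ℝ (fun z => (T z).re) (T₁ z) z 1
  deriv₂ : ∀ z, 0 < ρ z → HasLineDerivAt ℝ (fun z => (T z).im) (T₂ z) z Complex.I
  two_le : ∀ z, ρ z = 1 → 2 ≤ T₁ z + T₂ z
  nonneg : ∀ z, 0 < ρ z → 0 ≤ T₁ z + T₂ z
  bound : ∀ z, 0 < ρ z → ‖T z‖ ^ 2 ≤ (∫ z, ρ z) / π
  transport : ∀ h : ℝ → ℝ, Continuous h →
    ∫ z, ρ z * h (‖T z‖ ^ 2) = discInt √((∫ z, ρ z) / π) h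

namespace Knothe

/-- Mass of `ρ` on the vertical half line below `z`. -/
def colPrim (ρ : ℂ → ℝ) (R : ℝ) (z : ℂ) : ℝ := ∫ y in (-R)..z.im, ρ ⟨z.re, y⟩

/-- First marginal of `ρ`. -/
def col (ρ : ℂ → ℝ) (R x : ℝ) : ℝ := ∫ y in (-R)..R, ρ ⟨x, y⟩

/-- Mass of `ρ` to the left of the abscissa `x`. -/
def rowPrim (ρ : ℂ → ℝ) (R x : ℝ) : ℝ := ∫ t in (-R)..x, col ρ R t

variable {ρ : ℂ → ℝ} {R : ℝ}

theorem continuous_mk (hc : Continuous ρ) : Continuous fun p : ℝ × ℝ => ρ ⟨p.1, p.2⟩ :=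
  hc.comp Complex.equivRealProdCLM.symm.continuous

theorem continuous_line (hc : Continuous ρ) (x : ℝ) : Continuous fun y : ℝ => ρ ⟨x, y⟩ :=
  (continuous_mk hc).comp (by fun_prop : Continuous fun y : ℝ => (x, y))

theorem continuous_colPrim (hc : Continuous ρ) : Continuous (colPrim ρ R) := by
  refine intervalIntegral.continuous_parametric_intervalIntegral_of_continuous
    (f := fun z : ℂ => fun y => ρ ⟨z.re, y⟩) ?_ Complex.continuous_im
  exact (continuous_mk hc).comp (by fun_prop : Continuous fun p : ℂ × ℝ => (p.1.re, p.2))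

theorem continuous_col (hc : Continuous ρ) : Continuous (col ρ R) :=
  intervalIntegral.continuous_parametric_intervalIntegral_of_continuous
    (f := fun x : ℝ => fun y => ρ ⟨x, y⟩) (continuous_mk hc) continuous_const

theorem hasDerivAt_rowPrim (hc : Continuous ρ) (x : ℝ) :
    HasDerivAt (rowPrim ρ R) (col ρ R x) x :=
  ((continuous_col hc).integral_hasStrictDerivAt (-R) x).hasDerivAt

theorem hasDerivAt_colPrim (hc : Continuous ρ) (x y : ℝ) :
    HasDerivAt (fun y => colPrim ρ R ⟨x, y⟩) (ρ ⟨x, y⟩) y :=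
  ((continuous_line hc x).integral_hasStrictDerivAt (-R) y).hasDerivAt

theorem col_nonneg (h0 : ∀ z, 0 ≤ ρ z) (hR : 0 < R) (x : ℝ) : 0 ≤ col ρ R x :=
  intervalIntegral.integral_nonneg (by linarith) fun _ _ => h0 _

theorem col_pos (hc : Continuous ρ) (h0 : ∀ z, 0 ≤ ρ z)
    (hout : ∀ z, ρ z ≠ 0 → |z.re| < R ∧ |z.im| < R) {z : ℂ} (hz : 0 < ρ z) : 0 < col ρ R z.re := by
  have h := abs_lt.1 (hout z hz.ne').2
  exact intervalIntegral.integral_pos (by linarith) (continuous_line hc z.re).continuousOn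
    (fun _ _ => h0 _) ⟨z.im, ⟨h.1.le, h.2.le⟩, hz⟩

theorem col_eq_zero (hout : ∀ z, ρ z ≠ 0 → |z.re| < R ∧ |z.im| < R) {x : ℝ} (hx : R ≤ |x|) :
    col ρ R x = 0 := by
  have : ∀ y : ℝ, ρ ⟨x, y⟩ = 0 := fun y => by
    by_contra h
    exact absurd (hout _ h).1 (not_lt.2 hx)
  simp [col, this]

theorem integral_eq_rowPrim (hR : 0 < R)
    (hout : ∀ z, ρ z ≠ 0 → |z.re| < R ∧ |z.im| < R) (hi : Integrable ρ) :
    ∫ z, ρ z = rowPrim ρ R R := by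
  rw [integral_complex_eq hi, rowPrim, intervalIntegral.integral_of_le (by linarith),
    ← setIntegral_eq_integral_of_forall_compl_eq_zero (s := Set.Ioc (-R) R)]
  · refine integral_congr_ae (ae_of_all _ fun x => ?_)
    simp only [col]
    rw [intervalIntegral.integral_of_le (by linarith),
      setIntegral_eq_integral_of_forall_compl_eq_zero]
    intro y hy
    by_contra h
    have := abs_lt.1 (hout _ h).2
    exact hy ⟨this.1, this.2.le⟩
  · intro x hx
    have h1 : ∀ y : ℝ, ρ ⟨x, y⟩ = 0 := fun y => by
      by_contra h
      have := abs_lt.1 (hout _ h).1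
      exact hx ⟨this.1, this.2.le⟩
    simp [h1]

theorem rowPrim_mem (hc : Continuous ρ) (h0 : ∀ z, 0 ≤ ρ z) (hR : 0 < R)
    (hout : ∀ z, ρ z ≠ 0 → |z.re| < R ∧ |z.im| < R) {x : ℝ} (hx : 0 < col ρ R x) :
    0 < rowPrim ρ R x ∧ rowPrim ρ R x < rowPrim ρ R R := by
  have hx' : |x| < R := by
    by_contra h
    exact hx.ne' (col_eq_zero hout (not_lt.1 h))
  obtain ⟨h1, h2⟩ := abs_lt.1 hx'
  have hcc := continuous_col (R := R) hc
  have e1 : 0 < rowPrim ρ R x := intervalIntegral.integral_pos h1 hcc.continuousOn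
    (fun _ _ => col_nonneg h0 hR _) ⟨x, ⟨h1.le, le_rfl⟩, hx⟩
  have e2 : 0 < ∫ t in x..R, col ρ R t := intervalIntegral.integral_pos h2 hcc.continuousOn
    (fun _ _ => col_nonneg h0 hR _) ⟨x, ⟨le_rfl, h2.le⟩, hx⟩
  refine ⟨e1, ?_⟩
  have := intervalIntegral.integral_add_adjacent_intervals
    (hcc.intervalIntegrable (μ := volume) (-R) x) (hcc.intervalIntegrable x R)
  unfold rowPrim
  linarith

theorem colPrim_mem (hc : Continuous ρ) (h0 : ∀ z, 0 ≤ ρ z) {z : ℂ} (hz : |z.im| < R) :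
    0 ≤ colPrim ρ R z ∧ colPrim ρ R z ≤ col ρ R z.re := by
  obtain ⟨h1, h2⟩ := abs_lt.1 hz
  have e1 : 0 ≤ colPrim ρ R z := intervalIntegral.integral_nonneg h1.le fun _ _ => h0 _
  have e2 : 0 ≤ ∫ y in z.im..R, ρ ⟨z.re, y⟩ := intervalIntegral.integral_nonneg h2.le fun _ _ => h0 _
  refine ⟨e1, ?_⟩
  have hcl := continuous_line hc z.re
  have := intervalIntegral.integral_add_adjacent_intervals
    (hcl.intervalIntegrable (μ := volume) (-R) z.im) (hcl.intervalIntegrable z.im R)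
  unfold colPrim col
  linarith

/-- The angle coordinate of the Knothe map. -/
def angle (ρ : ℂ → ℝ) (R x : ℝ) : ℝ := segAngle (π / rowPrim ρ R R * rowPrim ρ R x)

/-- The Knothe map from the density `ρ` to a disc. -/
def map (ρ : ℂ → ℝ) (R : ℝ) (z : ℂ) : ℂ :=
  ⟨-√(rowPrim ρ R R / π) * cos (angle ρ R z.re),
    2 * √(rowPrim ρ R R / π) * sin (angle ρ R z.re) * (colPrim ρ R z / col ρ R z.re - 1 / 2)⟩

theorem continuous_angle (hc : Continuous ρ) : Continuous (angle ρ R) := by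
  have h2 : Continuous (rowPrim ρ R) := continuous_iff_continuousAt.2 fun x =>
    (hasDerivAt_rowPrim hc x).continuousAt
  exact segAngle.continuous.comp (continuous_const.mul h2)

theorem norm_map_sq (z : ℂ) :
    ‖map ρ R z‖ ^ 2 = √(rowPrim ρ R R / π) ^ 2 * cos (angle ρ R z.re) ^ 2 +
      4 * √(rowPrim ρ R R / π) ^ 2 * sin (angle ρ R z.re) ^ 2 *
        (colPrim ρ R z / col ρ R z.re - 1 / 2) ^ 2 := by
  rw [← Complex.normSq_eq_norm_sq, map, Complex.normSq_mk]
  ring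

theorem hasDerivAt_angle (hc : Continuous ρ) (h0 : ∀ z, 0 ≤ ρ z) (hR : 0 < R)
    (hout : ∀ z, ρ z ≠ 0 → |z.re| < R ∧ |z.im| < R) {x : ℝ} (hx : 0 < col ρ R x) :
    HasDerivAt (angle ρ R)
      ((2 * sin (angle ρ R x) ^ 2)⁻¹ * (π / rowPrim ρ R R * col ρ R x)) x ∧
      0 < sin (angle ρ R x) := by
  obtain ⟨h1, h2⟩ := rowPrim_mem hc h0 hR hout hx
  have ha : 0 < rowPrim ρ R R := h1.trans h2
  have hv : 0 < π / rowPrim ρ R R * rowPrim ρ R x := by positivity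
  have hv' : π / rowPrim ρ R R * rowPrim ρ R x < π := by
    rw [div_mul_eq_mul_div, div_lt_iff₀ ha]
    exact mul_lt_mul_of_pos_left h2 pi_pos
  obtain ⟨h3, h4⟩ := hasDerivAt_segAngle hv hv'
  exact ⟨h3.comp x ((hasDerivAt_rowPrim hc x).const_mul _), h4⟩

theorem norm_map_sq_le (hc : Continuous ρ) (h0 : ∀ z, 0 ≤ ρ z) (hR : 0 < R)
    (hout : ∀ z, ρ z ≠ 0 → |z.re| < R ∧ |z.im| < R) {z : ℂ} (hz : 0 < ρ z) :
    ‖map ρ R z‖ ^ 2 ≤ rowPrim ρ R R / π := by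
  have hcol := col_pos hc h0 hout hz
  obtain ⟨h1, h2⟩ := rowPrim_mem hc h0 hR hout hcol
  have ha : 0 < rowPrim ρ R R := h1.trans h2
  obtain ⟨h3, h4⟩ := colPrim_mem hc h0 (hout z hz.ne').2
  rw [norm_map_sq, Real.sq_sqrt (by positivity)]
  set q := colPrim ρ R z / col ρ R z.re with hq
  have hq0 : 0 ≤ q := by positivity
  have hq1 : q ≤ 1 := (div_le_one hcol).2 h4
  have hq2 : (q - 1 / 2) ^ 2 ≤ 1 / 4 := by nlinarith
  have h5 := sin_sq_add_cos_sq (angle ρ R z.re)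
  have h6 : 0 < rowPrim ρ R R / π := by positivity
  calc _ ≤ rowPrim ρ R R / π * cos (angle ρ R z.re) ^ 2 +
        4 * (rowPrim ρ R R / π) * sin (angle ρ R z.re) ^ 2 * (1 / 4) := by gcongr
    _ = _ := by linear_combination (rowPrim ρ R R / π) * h5

theorem transport (hc : Continuous ρ) (h0 : ∀ z, 0 ≤ ρ z) (hR : 0 < R)
    (hout : ∀ z, ρ z ≠ 0 → |z.re| < R ∧ |z.im| < R) (ha : 0 < rowPrim ρ R R)
    (hm : Measurable (map ρ R)) (h : ℝ → ℝ) (hh : Continuous h) :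
    ∫ z, ρ z * h (‖map ρ R z‖ ^ 2) = discInt √(rowPrim ρ R R / π) h := by
  set s := √(rowPrim ρ R R / π) with hs
  have hcpt : IsCompact (Metric.closedBall (0:ℂ) (R + R)) := isCompact_closedBall _ _
  have hz : ∀ z, z ∉ Metric.closedBall (0:ℂ) (R + R) → ρ z = 0 := by
    intro z hz
    by_contra hn
    have h1 := hout z hn
    have h2 := Complex.norm_le_abs_re_add_abs_im z
    exact hz (by simp; linarith)
  obtain ⟨C, hC⟩ := (isCompact_Icc (a := 0) (b := rowPrim ρ R R / π)).exists_bound_of_continuousOn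
    hh.continuousOn
  have hρi : Integrable ρ := hc.integrable_of_hasCompactSupport (HasCompactSupport.intro hcpt hz)
  have hi : Integrable fun z => ρ z * h (‖map ρ R z‖ ^ 2) := by
    refine (hρi.mul_const C).mono' (hc.measurable.mul
      (hh.measurable.comp (hm.norm.pow_const 2))).aestronglyMeasurable (ae_of_all _ fun z => ?_)
    rcases (h0 z).eq_or_lt with h1 | h1
    · simp [← h1]
    · rw [norm_mul, Real.norm_of_nonneg h1.le]
      gcongr
      exact hC _ ⟨by positivity, norm_map_sq_le hc h0 hR hout h1⟩
  rw [integral_complex_eq hi]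
  have hin : ∀ x : ℝ, ∫ y : ℝ, ρ ⟨x, y⟩ * h (‖map ρ R ⟨x, y⟩‖ ^ 2) =
      col ρ R x * chordMean s h (angle ρ R x) := by
    intro x
    rcases (col_nonneg h0 hR x).eq_or_lt with h1 | h1
    · have : ∀ y : ℝ, ρ ⟨x, y⟩ = 0 := fun y => by
        by_contra hn
        exact (col_pos hc h0 hout ((h0 _).lt_of_ne' hn)).ne h1
      simp [this, ← h1]
    · rw [← setIntegral_eq_integral_of_forall_compl_eq_zero (s := Set.Ioc (-R) R) (by
        intro y hy
        by_contra hn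
        have := abs_lt.1 (hout ⟨x, y⟩ (left_ne_zero_of_mul hn)).2
        exact hy ⟨this.1, this.2.le⟩), ← intervalIntegral.integral_of_le (by linarith)]
      have h2 := intervalIntegral.integral_comp_mul_deriv (a := -R) (b := R)
        (f := fun y => colPrim ρ R ⟨x, y⟩ / col ρ R x) (f' := fun y => ρ ⟨x, y⟩ / col ρ R x)
        (g := fun τ => h (s ^ 2 * cos (angle ρ R x) ^ 2 + 4 * s ^ 2 * sin (angle ρ R x) ^ 2 *
          (τ - 1 / 2) ^ 2)) (fun y _ => (hasDerivAt_colPrim hc x y).div_const _)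
        ((continuous_line hc x).div_const _).continuousOn (by fun_prop)
      have e0 : colPrim ρ R ⟨x, -R⟩ / col ρ R x = 0 := by simp [colPrim]
      have e1 : colPrim ρ R ⟨x, R⟩ / col ρ R x = 1 := div_self h1.ne'
      rw [e0, e1] at h2
      rw [chordMean, ← h2, ← intervalIntegral.integral_const_mul]
      refine intervalIntegral.integral_congr fun y _ => ?_
      simp only [norm_map_sq, Function.comp_apply, ← hs]
      field_simp
  simp_rw [hin]
  rw [← setIntegral_eq_integral_of_forall_compl_eq_zero (s := Set.Ioc (-R) R) (by
    intro x hx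
    rw [col_eq_zero hout, zero_mul]
    by_contra hn
    have := abs_lt.1 (not_le.1 hn)
    exact hx ⟨this.1, this.2.le⟩), ← intervalIntegral.integral_of_le (by linarith)]
  have hcm := continuous_chordMean s hh
  have h2 := intervalIntegral.integral_comp_mul_deriv (a := -R) (b := R)
    (f := fun x => π / rowPrim ρ R R * rowPrim ρ R x)
    (f' := fun x => π / rowPrim ρ R R * col ρ R x)
    (g := fun v => chordMean s h (segAngle v)) (fun x _ => (hasDerivAt_rowPrim hc x).const_mul _)
    (continuous_const.mul (continuous_col hc)).continuousOn (hcm.comp segAngle.continuous)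
  have h3 := intervalIntegral.integral_comp_mul_deriv (a := 0) (b := π)
    (f := fun α => α - sin α * cos α) (f' := fun α => 2 * sin α ^ 2)
    (g := fun v => chordMean s h (segAngle v)) (fun x _ => hasDerivAt_segArea x)
    (by fun_prop) (hcm.comp segAngle.continuous)
  have e0 : rowPrim ρ R (-R) = 0 := by simp [rowPrim]
  rw [e0, mul_zero, div_mul_cancel₀ _ ha.ne'] at h2
  simp only [Function.comp_def, segAngle_area, sin_zero, zero_mul, sub_zero, sin_pi] at h3
  rw [← h3] at h2
  have hs2 : s ^ 2 = rowPrim ρ R R / π := Real.sq_sqrt (by positivity)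
  unfold discInt
  simp_rw [show ∀ α : ℝ, chordMean s h α * (s ^ 2 * (2 * sin α ^ 2)) =
    s ^ 2 * (chordMean s h α * (2 * sin α ^ 2)) from fun α => by ring]
  rw [intervalIntegral.integral_const_mul, ← h2, ← intervalIntegral.integral_const_mul]
  refine intervalIntegral.integral_congr fun x _ => ?_
  simp only [Function.comp_apply, hs2, angle]
  field_simp

end Knothe

theorem exists_transportMap {ρ : ℂ → ℝ} (hc : Continuous ρ) (hcs : HasCompactSupport ρ)
    (h0 : ∀ z, 0 ≤ ρ z) (ha : 0 < ∫ z, ρ z) :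
    ∃ T T₁ T₂, TransportMap ρ T T₁ T₂ := by
  obtain ⟨R, hR, hout⟩ : ∃ R > 0, ∀ z, ρ z ≠ 0 → |z.re| < R ∧ |z.im| < R := by
    obtain ⟨R, hR⟩ := hcs.isCompact.isBounded.subset_closedBall 0
    refine ⟨|R| + 1, by positivity, fun z hz => ?_⟩
    have h1 : ‖z‖ ≤ R := by simpa using hR (subset_tsupport ρ hz)
    have := le_abs_self R
    exact ⟨by linarith [Complex.abs_re_le_norm z], by linarith [Complex.abs_im_le_norm z]⟩
  have hint := Knothe.integral_eq_rowPrim hR hout (hc.integrable_of_hasCompactSupport hcs)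
  rw [hint] at ha
  set a := Knothe.rowPrim ρ R R with hadef
  set s := √(a / π) with hs
  have hspos : 0 < s := Real.sqrt_pos.2 (by positivity)
  have hs2 : s ^ 2 = a / π := Real.sq_sqrt (by positivity)
  have hcα := Knothe.continuous_angle (R := R) hc
  have hccol := Knothe.continuous_col (R := R) hc
  have hcp := Knothe.continuous_colPrim (R := R) hc
  have hcolne : ∀ z ∈ {z | 0 < ρ z}, Knothe.col ρ R z.re ≠ 0 := fun z hz =>
    (Knothe.col_pos hc h0 hout hz).ne'
  have hsin : ∀ z ∈ {z | 0 < ρ z}, 0 < sin (Knothe.angle ρ R z.re) := fun z hz =>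
    (Knothe.hasDerivAt_angle hc h0 hR hout (Knothe.col_pos hc h0 hout hz)).2
  have hm : Measurable (Knothe.map ρ R) := by
    refine measurable_of_re_im ?_ ?_
    · exact (by fun_prop : Continuous fun z : ℂ => -s * cos (Knothe.angle ρ R z.re)).measurable
    · refine Measurable.mul (Continuous.measurable (by fun_prop)) (Measurable.sub_const ?_ _)
      exact hcp.measurable.div (hccol.measurable.comp Complex.measurable_re)
  refine ⟨Knothe.map ρ R, fun z => Knothe.col ρ R z.re / (2 * s * sin (Knothe.angle ρ R z.re)),
    fun z => 2 * s * sin (Knothe.angle ρ R z.re) * (ρ z / Knothe.col ρ R z.re),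
    hm, ?_, ?_, ?_, ?_, ?_, ?_, ?_, ?_, ?_, ?_⟩
  · exact (by fun_prop : Continuous fun z : ℂ => -s * cos (Knothe.angle ρ R z.re)).continuousOn
  · refine ContinuousOn.mul (Continuous.continuousOn (by fun_prop)) (ContinuousOn.sub ?_
      continuousOn_const)
    exact hcp.continuousOn.div (Continuous.continuousOn (by fun_prop)) hcolne
  · refine ContinuousOn.div (Continuous.continuousOn (by fun_prop))
      (Continuous.continuousOn (by fun_prop)) fun z hz => ?_
    have := hsin z hz
    positivity
  · exact ContinuousOn.mul (Continuous.continuousOn (by fun_prop))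
      (hc.continuousOn.div (Continuous.continuousOn (by fun_prop)) hcolne)
  · intro z hz
    have hd := Knothe.hasDerivAt_angle hc h0 hR hout (Knothe.col_pos hc h0 hout hz)
    have h1 := (hd.1.cos.const_mul (-s))
    have h2 : HasDerivAt (fun t : ℝ => z.re + t) 1 0 := by
      simpa using (hasDerivAt_id (0:ℝ)).const_add z.re
    have h3 := HasDerivAt.comp (0:ℝ) (h₂ := fun x => -s * cos (Knothe.angle ρ R x))
      (h := fun t : ℝ => z.re + t) (by simpa using h1) h2
    refine (h3.congr_of_eventuallyEq (Eventually.of_forall fun t => ?_)).congr_deriv ?_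
    · simp [Knothe.map, hs, hadef]
    · have h4 := hsin z hz
      have h5 : a = π * s ^ 2 := by rw [hs2]; field_simp
      rw [← hadef, h5]
      field_simp
  · intro z hz
    have h1 := ((Knothe.hasDerivAt_colPrim (R := R) hc z.re z.im).div_const
      (Knothe.col ρ R z.re)).sub_const (1 / 2)
    have h2 : HasDerivAt (fun t : ℝ => z.im + t) 1 0 := by
      simpa using (hasDerivAt_id (0:ℝ)).const_add z.im
    have h3 := (HasDerivAt.comp (0:ℝ)
      (h₂ := fun y => Knothe.colPrim ρ R ⟨z.re, y⟩ / Knothe.col ρ R z.re - 1 / 2)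
      (h := fun t : ℝ => z.im + t) (by simpa using h1) h2).const_mul
        (2 * s * sin (Knothe.angle ρ R z.re))
    refine (h3.congr_of_eventuallyEq (Eventually.of_forall fun t => ?_)).congr_deriv ?_
    · have : z + (t : ℂ) * Complex.I = ⟨z.re, z.im + t⟩ := by apply Complex.ext <;> simp
      simp [Knothe.map, hs, hadef, this]
    · simp
  · intro z hz
    have hz' : 0 < ρ z := by rw [hz]; exact one_pos
    have h1 := hsin z hz'
    have h2 := Knothe.col_pos hc h0 hout hz'
    set q := 2 * s * sin (Knothe.angle ρ R z.re) with hq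
    have h3 : 0 < q := by positivity
    simp only [hz]
    set c := Knothe.col ρ R z.re
    have h4 : c / q + q * (1 / c) - 2 = (c - q) ^ 2 / (c * q) := by field_simp; ring
    have : 0 ≤ (c - q) ^ 2 / (c * q) := by positivity
    linarith
  · intro z hz
    have h1 := hsin z hz
    have h2 := Knothe.col_pos hc h0 hout hz
    positivity
  · intro z hz
    rw [hint]
    exact Knothe.norm_map_sq_le hc h0 hR hout hz
  · intro h hh
    rw [hint]
    exact Knothe.transport hc h0 hR hout ha hm h hh

namespace TransportMap

variable {ρ : ℂ → ℝ} {T : ℂ → ℂ} {T₁ T₂ : ℂ → ℝ}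

theorem integral_norm_sq (h : TransportMap ρ T T₁ T₂) (h0 : ∀ z, 0 ≤ ρ z) :
    ∫ z, ρ z * ‖T z‖ ^ 2 = (∫ z, ρ z) ^ 2 / (2 * π) := by
  have h1 := h.transport id continuous_id
  rw [discInt_id] at h1
  simp only [id] at h1
  have h2 : 0 ≤ ∫ z, ρ z := integral_nonneg h0
  rw [h1, show (4:ℕ) = 2 * 2 from rfl, pow_mul, Real.sq_sqrt (by positivity)]
  field_simp

theorem le_integral_norm_sq (h : TransportMap ρ T T₁ T₂) (hi : Integrable ρ) {w : ℂ → ℝ}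
    (hw : ∀ z, 0 ≤ w z) (hwρ : ∀ z, w z ≤ ρ z) (hm : AEStronglyMeasurable w volume) :
    (∫ z, w z) ^ 2 / (2 * π) ≤ ∫ z, w z * ‖T z‖ ^ 2 := by
  set R := (∫ z, w z) / π with hR
  have hR0 : 0 ≤ R := div_nonneg (integral_nonneg hw) pi_pos.le
  have h1 := (h.transport (fun r => max (R - r) 0) (by fun_prop)).trans_le
    (discInt_le (Real.sqrt_nonneg _) hR0)
  have hwi : Integrable w := hi.mono' hm (ae_of_all _ fun z => by
    rw [Real.norm_of_nonneg (hw z)]; exact hwρ z)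
  have hTm := h.measurable
  have hwT : Integrable fun z => w z * ‖T z‖ ^ 2 := by
    refine (hwi.mul_const ((∫ z, ρ z) / π)).mono' ?_ (ae_of_all _ fun z => ?_)
    · exact hm.mul (by fun_prop : Measurable fun z => ‖T z‖ ^ 2).aestronglyMeasurable
    · rw [Real.norm_of_nonneg (mul_nonneg (hw z) (by positivity))]
      rcases (hw z).eq_or_lt with h2 | h2
      · simp [← h2]
      · have := h.bound z (h2.trans_le (hwρ z))
        gcongr
  have h2 : ∫ z, (w z * R - w z * ‖T z‖ ^ 2) ≤ ∫ z, ρ z * max (R - ‖T z‖ ^ 2) 0 := by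
    refine integral_mono ((hwi.mul_const R).sub hwT) ?_ fun z => ?_
    · refine (hi.mul_const R).mono' (hi.1.mul
        (by fun_prop : Measurable fun z => max (R - ‖T z‖ ^ 2) 0).aestronglyMeasurable)
        (ae_of_all _ fun z => ?_)
      have h3 := (hw z).trans (hwρ z)
      rw [Real.norm_of_nonneg (by positivity)]
      gcongr
      exact max_le (by linarith [sq_nonneg ‖T z‖]) hR0
    · have h3 := le_max_left (R - ‖T z‖ ^ 2) 0
      have h4 := le_max_right (R - ‖T z‖ ^ 2) 0
      simp only []
      nlinarith [hw z, hwρ z]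
  rw [integral_sub (hwi.mul_const R) hwT, integral_mul_const] at h2
  have h3 : ∫ z, w z = π * R := by rw [hR]; field_simp
  rw [h3] at h2 ⊢
  have h4 : (π * R) ^ 2 / (2 * π) = π * R ^ 2 / 2 := by field_simp
  rw [h4]
  nlinarith

end TransportMap

end

section

/-- The ramp function with slope `k` starting at `t`. -/
def ramp (k t r : ℝ) : ℝ := max 0 (min 1 (k * (r - t)))

/-- The primitive of `ramp k t`, a smoothing of the positive part of `r - t`. -/
def softPos (k t r : ℝ) : ℝ := ∫ x in t..r, ramp k t x

section Ramp

variable {k t : ℝ}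

theorem continuous_ramp (k t : ℝ) : Continuous (ramp k t) := by
  unfold ramp; fun_prop

theorem ramp_nonneg (k t r : ℝ) : 0 ≤ ramp k t r := le_max_left _ _

theorem ramp_le_one (k t r : ℝ) : ramp k t r ≤ 1 := max_le zero_le_one (min_le_left _ _)

theorem ramp_of_le (hk : 0 < k) {r : ℝ} (h : r ≤ t) : ramp k t r = 0 :=
  max_eq_left ((min_le_right _ _).trans (mul_nonpos_of_nonneg_of_nonpos hk.le (by linarith)))

theorem ramp_of_ge (hk : 0 < k) {r : ℝ} (h : t + 1 / k ≤ r) : ramp k t r = 1 := by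
  have : 1 ≤ k * (r - t) := by
    have := mul_le_mul_of_nonneg_left h hk.le
    rw [mul_add, mul_one_div_cancel hk.ne'] at this
    linarith
  unfold ramp
  rw [min_eq_left this]
  exact max_eq_right zero_le_one

theorem ramp_anti (hk : 0 < k) {s : ℝ} (h : s ≤ t) (r : ℝ) : ramp k t r ≤ ramp k s r := by
  unfold ramp
  gcongr

theorem hasDerivAt_softPos (k t r : ℝ) : HasDerivAt (softPos k t) (ramp k t r) r :=
  ((continuous_ramp k t).integral_hasStrictDerivAt t r).hasDerivAt

theorem continuous_softPos (k t : ℝ) : Continuous (softPos k t) :=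
  continuous_iff_continuousAt.2 fun r => (hasDerivAt_softPos k t r).continuousAt

theorem softPos_of_le (hk : 0 < k) {r : ℝ} (h : r ≤ t) : softPos k t r = 0 := by
  rw [softPos, intervalIntegral.integral_symm,
    intervalIntegral.integral_congr (g := fun _ => (0 : ℝ))]
  · simp
  · intro x hx
    rw [Set.uIcc_of_le h] at hx
    exact ramp_of_le hk hx.2

theorem softPos_nonneg (hk : 0 < k) (r : ℝ) : 0 ≤ softPos k t r := by
  rcases le_or_gt r t with h | h
  · rw [softPos_of_le hk h]
  · exact intervalIntegral.integral_nonneg h.le fun _ _ => ramp_nonneg _ _ _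

theorem softPos_le (hk : 0 < k) (r : ℝ) : softPos k t r ≤ max (r - t) 0 := by
  rcases le_or_gt r t with h | h
  · rw [softPos_of_le hk h]; exact le_max_right _ _
  · refine le_trans ?_ (le_max_left _ _)
    have := intervalIntegral.integral_mono_on h.le
      ((continuous_ramp k t).intervalIntegrable t r)
      (continuous_const.intervalIntegrable (μ := volume) t r) fun x _ => ramp_le_one k t x
    simpa [softPos] using this

theorem le_softPos (hk : 0 < k) (r : ℝ) : r - t - 1 / k ≤ softPos k t r := by
  rcases le_or_gt r (t + 1 / k) with h | h
  · linarith [softPos_nonneg (t := t) hk r]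
  · have h1 := intervalIntegral.integral_add_adjacent_intervals
      ((continuous_ramp k t).intervalIntegrable (μ := volume) t (t + 1 / k))
      ((continuous_ramp k t).intervalIntegrable (t + 1 / k) r)
    have h2 : 0 ≤ ∫ x in t..(t + 1 / k), ramp k t x := intervalIntegral.integral_nonneg
      (by have := one_div_pos.2 hk; linarith) fun _ _ => ramp_nonneg _ _ _
    have h3 : ∫ x in (t + 1 / k)..r, ramp k t x = r - t - 1 / k := by
      rw [intervalIntegral.integral_congr (g := fun _ => (1 : ℝ))]
      · simp; ring
      · intro x hx
        rw [Set.uIcc_of_le h.le] at hx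
        exact ramp_of_ge hk hx.1
    unfold softPos
    linarith

end Ramp

/-- `A` is the positivity set in `Ω` of the function `u` with gradient `G`. -/
structure PosDomain (Ω A : Set ℂ) (u : ℂ → ℝ) (G : ℂ → ℂ) : Prop where
  isOpen : IsOpen A
  bdd : Bornology.IsBounded A
  closure_subset : closure A ⊆ Ω
  cont : ContinuousOn u Ω
  contG : ContinuousOn G Ω
  deriv : ∀ x ∈ Ω, ∀ e, HasLineDerivAt ℝ u ⟪G x, e⟫ x e
  pos : ∀ x ∈ A, 0 < u x
  nonpos : ∀ x ∈ Ω, x ∉ A → u x ≤ 0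

namespace PosDomain

variable {Ω A : Set ℂ} {u : ℂ → ℝ} {G : ℂ → ℂ}

theorem isCompact_closure (h : PosDomain Ω A u G) : IsCompact (closure A) :=
  h.bdd.isCompact_closure

theorem measurableSet (h : PosDomain Ω A u G) : MeasurableSet A := h.isOpen.measurableSet

theorem isCompact_superlevel (h : PosDomain Ω A u G) {t : ℝ} (ht : 0 < t) :
    IsCompact (A ∩ {x | t ≤ u x}) := by
  have h1 : A ∩ {x | t ≤ u x} = closure A ∩ u ⁻¹' Set.Ici t := by
    ext x
    refine ⟨fun hx => ⟨subset_closure hx.1, hx.2⟩, fun hx => ⟨?_, hx.2⟩⟩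
    by_contra hA
    exact absurd (h.nonpos x (h.closure_subset hx.1) hA) (not_le.2 (ht.trans_le hx.2))
  rw [h1]
  exact h.isCompact_closure.of_isClosed_subset
    ((h.cont.mono h.closure_subset).preimage_isClosed_of_isClosed isClosed_closure isClosed_Ici)
    Set.inter_subset_left

theorem nonpos_frontier (h : PosDomain Ω A u G) {x : ℂ} (hx : x ∈ frontier A) : u x ≤ 0 := by
  rw [frontier, h.isOpen.interior_eq] at hx
  exact h.nonpos x (h.closure_subset hx.1) hx.2

/-- The composition of `u` with a function vanishing on negative numbers is continuous after
extension by zero. -/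
theorem continuous_indicator {E : Type*} [TopologicalSpace E] [Zero E]
    (h : PosDomain Ω A u G) {F : ℂ → E}
    (hF : ContinuousOn F Ω) (h0 : ∀ x, u x ≤ 0 → F x = 0) : Continuous (A.indicator F) :=
  _root_.continuous_indicator (fun _ hx => h0 _ (h.nonpos_frontier hx))
    (hF.mono h.closure_subset)

theorem hasCompactSupport_indicator {E : Type*} [Zero E] (h : PosDomain Ω A u G) (F : ℂ → E) :
    HasCompactSupport (A.indicator F) :=
  HasCompactSupport.intro h.isCompact_closure fun _ hx =>
    Set.indicator_of_notMem (fun hA => hx (subset_closure hA)) _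

theorem support_indicator_subset {E : Type*} [Zero E] {F : ℂ → E} {t : ℝ}
    (h0 : ∀ x, u x ≤ t → F x = 0) :
    Function.support (A.indicator F) ⊆ A ∩ {x | t ≤ u x} := by
  intro x hx
  rw [Function.mem_support] at hx
  have hA : x ∈ A := Set.mem_of_indicator_ne_zero hx
  rw [Set.indicator_of_mem hA] at hx
  exact ⟨hA, (not_le.1 fun hn => hx (h0 x hn)).le⟩

theorem tsupport_indicator_subset (h : PosDomain Ω A u G) {E : Type*} [Zero E]
    {F : ℂ → E} {t : ℝ} (ht : 0 < t)
    (h0 : ∀ x, u x ≤ t → F x = 0) : tsupport (A.indicator F) ⊆ A ∩ {x | t ≤ u x} :=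
  closure_minimal (support_indicator_subset h0) (h.isCompact_superlevel ht).isClosed

theorem testFun (h : PosDomain Ω A u G) {k t : ℝ} (hk : 0 < k) (ht : 0 < t) :
    TestFun (A.indicator fun x => softPos k t (u x))
      (A.indicator fun x => ramp k t (u x) • G x) where
  cont := h.continuous_indicator ((continuous_softPos k t).comp_continuousOn h.cont)
    fun x hx => softPos_of_le hk (hx.trans ht.le)
  contG := h.continuous_indicator (((continuous_ramp k t).comp_continuousOn h.cont).smul h.contG)
    fun x hx => by rw [ramp_of_le hk (hx.trans ht.le), zero_smul]
  compact := h.hasCompactSupport_indicator _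
  compactG := h.hasCompactSupport_indicator _
  deriv x e := by
    have hl : Continuous fun s : ℝ => x + s • e := by fun_prop
    by_cases hx : x ∈ A
    · have h1 := h.deriv x (h.closure_subset (subset_closure hx)) e
      have h2 : HasDerivAt (fun s : ℝ => softPos k t (u (x + s • e)))
          (ramp k t (u x) * ⟪G x, e⟫) 0 := by
        have h3 := hasDerivAt_softPos k t (u (x + (0:ℝ) • e))
        rw [HasLineDerivAt] at h1
        have := HasDerivAt.comp (0:ℝ) (h := fun s : ℝ => u (x + s • e)) h3 h1
        simpa [Function.comp_def] using this
      rw [Set.indicator_of_mem hx, real_inner_smul_left]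
      refine h2.congr_of_eventuallyEq ?_
      have h4 : ∀ᶠ s in nhds (0:ℝ), x + s • e ∈ A :=
        hl.continuousAt.eventually_mem (by simpa using h.isOpen.mem_nhds hx)
      filter_upwards [h4] with s hs
      rw [Set.indicator_of_mem hs]
    · rw [Set.indicator_of_notMem hx, inner_zero_left]
      refine (hasDerivAt_const (0:ℝ) (0:ℝ)).congr_of_eventuallyEq ?_
      have hcl := (h.isCompact_superlevel ht).isClosed.isOpen_compl
      have h4 : ∀ᶠ s in nhds (0:ℝ), x + s • e ∈ (A ∩ {x | t ≤ u x})ᶜ :=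
        hl.continuousAt.eventually_mem
          (by simpa using hcl.mem_nhds (fun hc => hx hc.1))
      filter_upwards [h4] with s hs
      by_contra hn
      exact hs (support_indicator_subset (fun y hy => softPos_of_le hk hy) hn)

theorem cutoff_integrable (h : PosDomain Ω A u G) {F : ℂ → ℝ}
    (hF : ContinuousOn F Ω) (h0 : ∀ x, u x ≤ 0 → F x = 0) : Integrable (A.indicator F) :=
  (h.continuous_indicator hF h0).integrable_of_hasCompactSupport (h.hasCompactSupport_indicator F)

theorem integrableOn (h : PosDomain Ω A u G) : IntegrableOn u A :=
  ((h.cont.mono h.closure_subset).integrableOn_compact h.isCompact_closure).mono_set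
    subset_closure

/-- Mass above the level `t`. -/
theorem integrableOn_pos (h : PosDomain Ω A u G) (t : ℝ) :
    IntegrableOn (fun x => max (u x - t) 0) A := by
  have hc : ContinuousOn (fun x => max (u x - t) 0) (closure A) := by
    have := h.cont.mono h.closure_subset
    fun_prop
  exact (hc.integrableOn_compact h.isCompact_closure).mono_set subset_closure

theorem integral_softPos_le (h : PosDomain Ω A u G) {k t : ℝ} (hk : 0 < k) (ht : 0 < t) :
    ∫ x, A.indicator (fun x => softPos k t (u x)) x ≤ ∫ x in A, max (u x - t) 0 := by
  rw [← integral_indicator h.measurableSet]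
  refine integral_mono (h.testFun hk ht).integrable
    ((h.integrableOn_pos t).integrable_indicator h.measurableSet) fun x => ?_
  exact Set.indicator_le_indicator (softPos_le hk _)

theorem le_integral_softPos (h : PosDomain Ω A u G) {k t : ℝ} (hk : 0 < k) (ht : 0 < t) :
    (∫ x in A, u x) - volume.real A * (t + 1 / k) ≤
      ∫ x, A.indicator (fun x => softPos k t (u x)) x := by
  have hc : IntegrableOn (fun _ : ℂ => t + 1 / k) A := integrableOn_const h.bdd.measure_lt_top.ne
  have h1 : (∫ x in A, u x) - volume.real A * (t + 1 / k) = ∫ x in A, (u x - (t + 1 / k)) := by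
    rw [integral_sub h.integrableOn hc, setIntegral_const, smul_eq_mul]
  rw [h1, ← integral_indicator h.measurableSet]
  refine integral_mono ((h.integrableOn.sub hc).integrable_indicator h.measurableSet)
    (h.testFun hk ht).integrable fun x => ?_
  exact Set.indicator_le_indicator (by linarith [le_softPos (t := t) hk (u x)])

end PosDomain

end

section

theorem integral_lincomb {f g h : ℂ → ℝ} (hf : Integrable f) (hg : Integrable g)
    (hh : Integrable h) (a b c : ℝ) : ∫ x, (a * f x + b * g x + c * h x) =
      a * (∫ x, f x) + b * (∫ x, g x) + c * ∫ x, h x := by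
  have h1 := integral_add ((hf.const_mul a).add (hg.const_mul b)) (hh.const_mul c)
  have h2 := integral_add (hf.const_mul a) (hg.const_mul b)
  simp only [Pi.add_apply] at h1 h2
  rw [h1, h2, integral_const_mul, integral_const_mul, integral_const_mul]

/-- A positivity domain of area `π` whose potential has almost the gradient of the
logarithmic potential of the domain. -/
structure NearVortex (δ : ℝ) (Ω A : Set ℂ) (u : ℂ → ℝ) (G : ℂ → ℂ) : Prop
    extends PosDomain Ω A u G where
  pos_delta : 0 < δ
  delta_le : δ ≤ 1
  vol : volume.real A = π
  near : ∀ x ∈ Ω, ‖G x + (1 / (2 * π)) • logPotGrad A x‖ ≤ δ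
  ball_subset : ∀ x ∈ A, Metric.ball x 4 ⊆ Ω
  preconnected : IsPreconnected A
  energy : (1 - δ) * (π / 8) ≤ ∫ x in A, u x

namespace NearVortex

variable {δ : ℝ} {Ω A : Set ℂ} {u : ℂ → ℝ} {G : ℂ → ℂ}

theorem subset (h : NearVortex δ Ω A u G) : A ⊆ Ω := subset_closure.trans h.closure_subset

theorem norm_grad_le (h : NearVortex δ Ω A u G) {x : ℂ} (hx : x ∈ Ω) : ‖G x‖ ≤ 3 := by
  have h1 := h.near x hx
  have h2 : ‖(1 / (2 * π)) • logPotGrad A x‖ ≤ 2 := by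
    rw [norm_smul, Real.norm_of_nonneg (by positivity)]
    have h3 := norm_logPotGrad_le h.bdd h.measurableSet x
    rw [h.vol] at h3
    have h4 : √(2 * π * π) ≤ 2 * π := by
      rw [Real.sqrt_le_left (by positivity)]
      nlinarith [pi_pos]
    calc 1 / (2 * π) * ‖logPotGrad A x‖ ≤ 1 / (2 * π) * (2 * (2 * π)) := by gcongr; linarith
      _ = 2 := by field_simp
  have h5 : G x = (G x + (1 / (2 * π)) • logPotGrad A x) - (1 / (2 * π)) • logPotGrad A x := by
    abel
  rw [h5]
  refine (norm_sub_le _ _).trans ?_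
  linarith [h.delta_le]

/-- Continuous cutoffs of functions on `A`. -/
theorem integrable_ramp_mul (h : NearVortex δ Ω A u G) {k t : ℝ} (hk : 0 < k) (ht : 0 < t)
    {F : ℂ → ℝ} (hF : ContinuousOn F Ω) :
    Integrable (A.indicator fun x => ramp k t (u x) * F x) :=
  h.cutoff_integrable (((continuous_ramp k t).comp_continuousOn h.cont).mul hF)
    fun x hx => by rw [ramp_of_le hk (hx.trans ht.le), zero_mul]

theorem abs_dirichlet_sub_le (h : NearVortex δ Ω A u G) {k t : ℝ} (hk : 0 < k) (ht : 0 < t) :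
    |(∫ x, A.indicator (fun x => ramp k t (u x) * ‖G x‖ ^ 2) x) -
      ∫ x, A.indicator (fun x => softPos k t (u x)) x| ≤ 3 * π * δ := by
  have ht' := h.testFun hk ht
  have h1 := ht'.integral_logPotGrad h.bdd h.measurableSet
  have h2 : ∫ y in A, A.indicator (fun x => softPos k t (u x)) y =
      ∫ x, A.indicator (fun x => softPos k t (u x)) x := by
    rw [setIntegral_eq_integral_of_forall_compl_eq_zero]
    intro x hx
    exact Set.indicator_of_notMem hx _
  rw [h2] at h1
  have h3 : ∫ x, A.indicator (fun x => softPos k t (u x)) x =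
      -∫ x, A.indicator (fun x => ramp k t (u x) * ⟪G x, (1 / (2 * π)) • logPotGrad A x⟫) x := by
    have h4 : ∀ x, A.indicator (fun x => ramp k t (u x) * ⟪G x, (1 / (2 * π)) • logPotGrad A x⟫) x
        = (1 / (2 * π)) * ⟪A.indicator (fun x => ramp k t (u x) • G x) x, logPotGrad A x⟫ := by
      intro x
      by_cases hx : x ∈ A
      · simp only [Set.indicator_of_mem hx, real_inner_smul_left, real_inner_smul_right]
        ring
      · simp only [Set.indicator_of_notMem hx, inner_zero_left, mul_zero]
    rw [integral_congr_ae (ae_of_all _ h4), integral_const_mul, h1]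
    field_simp
  have hcl := continuous_logPotGrad h.bdd h.measurableSet
  have hi1 := h.integrable_ramp_mul hk ht (F := fun x => ‖G x‖ ^ 2) (h.contG.norm.pow 2)
  have hi2 := h.integrable_ramp_mul hk ht
    (F := fun x => ⟪G x, (1 / (2 * π)) • logPotGrad A x⟫)
    (h.contG.inner (𝕜 := ℝ) (hcl.const_smul (1 / (2 * π))).continuousOn)
  rw [h3, sub_neg_eq_add, ← integral_add hi1 hi2, ← Real.norm_eq_abs]
  have hc : Integrable (A.indicator fun _ : ℂ => 3 * δ) :=
    (integrableOn_const h.bdd.measure_lt_top.ne).integrable_indicator h.measurableSet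
  refine (norm_integral_le_of_norm_le hc (ae_of_all _ fun x => ?_)).trans ?_
  · by_cases hx : x ∈ A
    · simp only [Set.indicator_of_mem hx]
      rw [← mul_add, ← real_inner_self_eq_norm_sq, ← inner_add_right, norm_mul,
        Real.norm_of_nonneg (ramp_nonneg _ _ _)]
      have h5 : ‖⟪G x, G x + (1 / (2 * π)) • logPotGrad A x⟫‖ ≤ 3 * δ := by
        refine (norm_inner_le_norm _ _).trans ?_
        have := h.norm_grad_le (h.subset hx)
        have := h.near x (h.subset hx)
        gcongr
      calc _ ≤ 1 * ‖⟪G x, G x + (1 / (2 * π)) • logPotGrad A x⟫‖ := by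
            gcongr; exact ramp_le_one _ _ _
        _ ≤ 3 * δ := by linarith
    · simp [Set.indicator_of_notMem hx]
  · rw [integral_indicator h.measurableSet, setIntegral_const, h.vol, smul_eq_mul]
    linarith

/-- The continuous density used to build the transport map. -/
def density (A : Set ℂ) (u : ℂ → ℝ) (t₀ : ℝ) : ℂ → ℝ :=
  A.indicator fun x => min 1 (max (u x) 0 / t₀)

theorem density_nonneg {t₀ : ℝ} (ht : 0 < t₀) (x : ℂ) : 0 ≤ density A u t₀ x :=
  Set.indicator_nonneg (fun _ _ => le_min zero_le_one (div_nonneg (le_max_right _ _) ht.le)) x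

theorem density_le (t₀ : ℝ) (x : ℂ) : density A u t₀ x ≤ A.indicator 1 x :=
  Set.indicator_le_indicator (min_le_left _ _)

theorem continuous_density (h : NearVortex δ Ω A u G) (t₀ : ℝ) : Continuous (density A u t₀) :=
  h.continuous_indicator (by have := h.cont; fun_prop) fun x hx => by
    rw [max_eq_right hx, zero_div]; exact min_eq_right zero_le_one

theorem integrable_density (h : NearVortex δ Ω A u G) (t₀ : ℝ) : Integrable (density A u t₀) :=
  (h.continuous_density t₀).integrable_of_hasCompactSupport (h.hasCompactSupport_indicator _)

theorem integral_density_le (h : NearVortex δ Ω A u G) (t₀ : ℝ) :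
    ∫ x, density A u t₀ x ≤ π := by
  have h1 : Integrable (A.indicator (1 : ℂ → ℝ)) :=
    (integrableOn_const h.bdd.measure_lt_top.ne).integrable_indicator h.measurableSet
  refine (integral_mono (h.integrable_density t₀) h1 (density_le t₀)).trans ?_
  rw [integral_indicator_one h.measurableSet, h.vol]

theorem integral_density_pos (h : NearVortex δ Ω A u G) {t₀ : ℝ} (ht : 0 < t₀) :
    0 < ∫ x, density A u t₀ x := by
  rw [integral_pos_iff_support_of_nonneg (density_nonneg ht) (h.integrable_density t₀)]
  have h1 : A ⊆ Function.support (density A u t₀) := by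
    intro x hx
    have := h.pos x hx
    rw [Function.mem_support, density, Set.indicator_of_mem hx]
    exact (lt_min zero_lt_one (div_pos (lt_max_of_lt_left this) ht)).ne'
  refine lt_of_lt_of_le ?_ (measure_mono h1)
  by_contra hn
  have : volume A = 0 := by simpa using hn
  have h2 := h.vol
  rw [measureReal_def, this] at h2
  simp [pi_ne_zero.symm] at h2

theorem density_eq_one {t₀ : ℝ} (ht : 0 < t₀) {x : ℂ} (hx : x ∈ A) (hu : t₀ ≤ u x) :
    density A u t₀ x = 1 := by
  rw [density, Set.indicator_of_mem hx]
  exact min_eq_left ((one_le_div ht).2 (hu.trans (le_max_left _ _)))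

theorem ramp_le_density {k t₀ t : ℝ} (hk : 0 < k) (h0 : 0 < t₀) (ht : t₀ ≤ t) (x : ℂ) :
    A.indicator (fun x => ramp k t (u x)) x ≤ density A u t₀ x := by
  by_cases hx : x ∈ A
  · rw [Set.indicator_of_mem hx]
    rcases le_or_gt (u x) t with hu | hu
    · rw [ramp_of_le hk hu]; exact density_nonneg h0 x
    · rw [density_eq_one h0 hx (ht.trans hu.le)]; exact ramp_le_one _ _ _
  · rw [Set.indicator_of_notMem hx]; exact density_nonneg h0 x

variable {t₀ : ℝ} {T : ℂ → ℂ} {T₁ T₂ : ℂ → ℝ}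

/-- Properties of cutoffs paired with a transport map. -/
theorem integrable_mul_transport (h : NearVortex δ Ω A u G) (h0 : 0 < t₀) {φ : ℂ → ℝ} (hφ : Continuous φ) {t : ℝ} (ht : t₀ ≤ t)
    (hs : Function.support φ ⊆ A ∩ {x | t ≤ u x}) {F : ℂ → ℝ}
    (hF : ContinuousOn F {z | 0 < density A u t₀ z}) : Integrable fun x => φ x * F x := by
  have hS := h.isCompact_superlevel (h0.trans_le ht)
  rw [← integrableOn_iff_integrable_of_support_subset
    ((Function.support_mul_subset_left φ F).trans hs)]
  refine (hφ.continuousOn.mul (hF.mono fun x hx => ?_)).integrableOn_compact hS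
  rw [Set.mem_ofPred_eq, density_eq_one h0 hx.1 (ht.trans hx.2)]
  exact one_pos

theorem two_mul_le_transport (h : NearVortex δ Ω A u G)
    (hT : TransportMap (density A u t₀) T T₁ T₂)
    (h0 : 0 < t₀) {k t : ℝ} (hk : 0 < k) (ht : t₀ ≤ t) :
    2 * (∫ x, A.indicator (fun x => softPos k t (u x)) x) ≤
      -∫ x, ⟪A.indicator (fun x => ramp k t (u x) • G x) x, T x⟫ := by
  have ht0 : 0 < t := h0.trans_le ht
  have htf := h.testFun hk ht0
  set φ := A.indicator fun x => softPos k t (u x) with hφ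
  set V := A.indicator fun x => ramp k t (u x) • G x with hV
  have hS := h.isCompact_superlevel ht0
  have hφs : Function.support φ ⊆ A ∩ {x | t ≤ u x} :=
    PosDomain.support_indicator_subset fun y hy => softPos_of_le hk hy
  have hφt : tsupport φ ⊆ A ∩ {x | t ≤ u x} :=
    h.tsupport_indicator_subset ht0 fun y hy => softPos_of_le hk hy
  have hVs : Function.support V ⊆ A ∩ {x | t ≤ u x} :=
    PosDomain.support_indicator_subset fun y hy => by rw [ramp_of_le hk hy, zero_smul]
  have hpos : A ∩ {x | t ≤ u x} ⊆ {z | 0 < density A u t₀ z} := fun x hx => by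
    rw [Set.mem_ofPred_eq, density_eq_one h0 hx.1 (ht.trans hx.2)]
    exact one_pos
  have e1 := htf.integral_mul_deriv hS hφt hVs (hT.contRe.mono hpos) (hT.cont₁.mono hpos)
    fun x hx => hT.deriv₁ x (hpos hx)
  have e2 := htf.integral_mul_deriv hS hφt hVs (hT.contIm.mono hpos) (hT.cont₂.mono hpos)
    fun x hx => hT.deriv₂ x (hpos hx)
  have i1 := h.integrable_mul_transport h0 htf.cont ht hφs hT.cont₁
  have i2 := h.integrable_mul_transport h0 htf.cont ht hφs hT.cont₂
  have j1 := h.integrable_mul_transport h0 (φ := fun x => ⟪V x, (1:ℂ)⟫)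
    (htf.contG.inner continuous_const) ht
    (fun x hx => hVs fun h0 => hx (by simp [h0])) hT.contRe
  have j2 := h.integrable_mul_transport h0 (φ := fun x => ⟪V x, Complex.I⟫)
    (htf.contG.inner continuous_const) ht
    (fun x hx => hVs fun h0 => hx (by simp [h0])) hT.contIm
  have e3 : ∫ x, ⟪V x, T x⟫ = (∫ x, ⟪V x, (1:ℂ)⟫ * (T x).re) + ∫ x, ⟪V x, Complex.I⟫ * (T x).im := by
    rw [← integral_add j1 j2]
    refine integral_congr_ae (ae_of_all _ fun x => ?_)
    simp [Complex.inner]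
    ring
  rw [e3, neg_add, ← e1, ← e2, ← integral_add i1 i2, ← integral_const_mul]
  refine integral_mono (htf.integrable.const_mul 2) (i1.add i2) fun x => ?_
  by_cases hx : φ x = 0
  · simp [hx]
  · have hxS := hφs hx
    have h2 := hT.two_le x (density_eq_one h0 hxS.1 (ht.trans hxS.2))
    have h3 : 0 ≤ φ x := Set.indicator_nonneg (fun y _ => softPos_nonneg hk _) x
    show 2 * φ x ≤ φ x * T₁ x + φ x * T₂ x
    nlinarith

/-- The defect of the transport map as a multiple of the gradient. -/
def defect (A : Set ℂ) (u : ℂ → ℝ) (G T : ℂ → ℂ) (k t : ℝ) : ℝ :=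
  ∫ x, A.indicator (fun x => ramp k t (u x)) x * ‖G x + (1 / 2 : ℝ) • T x‖ ^ 2

theorem continuousOn_transport {ρ : ℂ → ℝ} (hT : TransportMap ρ T T₁ T₂) :
    ContinuousOn T {z | 0 < ρ z} := by
  have := Complex.equivRealProdCLM.symm.continuous.comp_continuousOn (hT.contRe.prodMk hT.contIm)
  exact this.congr fun z _ => Complex.ext rfl rfl

theorem density_pos_subset : {z | 0 < density A u t₀ z} ⊆ A := by
  intro x hx
  have hx' : 0 < density A u t₀ x := hx
  exact Set.mem_of_indicator_ne_zero hx'.ne'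

theorem integrable_ramp_mul_transport (h : NearVortex δ Ω A u G) (h0 : 0 < t₀) {k t : ℝ}
    (hk : 0 < k) (ht : t₀ ≤ t) {F : ℂ → ℝ}
    (hF : ContinuousOn F {z | 0 < density A u t₀ z}) :
    Integrable fun x => A.indicator (fun x => ramp k t (u x)) x * F x :=
  h.integrable_mul_transport h0
    (h.continuous_indicator ((continuous_ramp k t).comp_continuousOn h.cont)
      fun _ hx => ramp_of_le hk (hx.trans (h0.trans_le ht).le)) ht
    (PosDomain.support_indicator_subset fun _ hy => ramp_of_le hk hy) hF

theorem defect_eq (h : NearVortex δ Ω A u G) (hT : TransportMap (density A u t₀) T T₁ T₂)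
    (h0 : 0 < t₀) {k t : ℝ} (hk : 0 < k) (ht : t₀ ≤ t) :
    defect A u G T k t = (∫ x, A.indicator (fun x => ramp k t (u x) * ‖G x‖ ^ 2) x) +
      (∫ x, ⟪A.indicator (fun x => ramp k t (u x) • G x) x, T x⟫) +
      1 / 4 * ∫ x, A.indicator (fun x => ramp k t (u x)) x * ‖T x‖ ^ 2 := by
  have hTc := continuousOn_transport hT
  have hGc : ContinuousOn G {z | 0 < density A u t₀ z} :=
    h.contG.mono (density_pos_subset.trans h.subset)
  have i1 := h.integrable_ramp_mul_transport h0 hk ht (F := fun x => ‖G x‖ ^ 2) (hGc.norm.pow 2)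
  have i2 := h.integrable_ramp_mul_transport h0 hk ht (F := fun x => ⟪G x, T x⟫)
    (hGc.inner (𝕜 := ℝ) hTc)
  have i3 := h.integrable_ramp_mul_transport h0 hk ht (F := fun x => ‖T x‖ ^ 2) (hTc.norm.pow 2)
  have e1 : ∀ x, A.indicator (fun x => ramp k t (u x) * ‖G x‖ ^ 2) x =
      A.indicator (fun x => ramp k t (u x)) x * ‖G x‖ ^ 2 := fun x => by
    by_cases hx : x ∈ A <;> simp [hx]
  have e2 : ∀ x, ⟪A.indicator (fun x => ramp k t (u x) • G x) x, T x⟫ =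
      A.indicator (fun x => ramp k t (u x)) x * ⟪G x, T x⟫ := fun x => by
    by_cases hx : x ∈ A
    · simp only [Set.indicator_of_mem hx, real_inner_smul_left]
    · simp only [Set.indicator_of_notMem hx, inner_zero_left, zero_mul]
  simp_rw [e1, e2]
  rw [← one_mul (∫ x, _ * ‖G x‖ ^ 2), ← one_mul (∫ x, _ * ⟪G x, T x⟫),
    ← integral_lincomb i1 i2 i3]
  refine integral_congr_ae (ae_of_all _ fun x => ?_)
  have e3 : ‖G x + (1 / 2 : ℝ) • T x‖ ^ 2 = ‖G x‖ ^ 2 + ⟪G x, T x⟫ + 1 / 4 * ‖T x‖ ^ 2 := by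
    rw [norm_add_sq_real, real_inner_smul_right, norm_smul, mul_pow]
    norm_num
    ring
  simp only [e3]
  ring

theorem integral_ramp_norm_sq_le (h : NearVortex δ Ω A u G)
    (hT : TransportMap (density A u t₀) T T₁ T₂)
    (h0 : 0 < t₀) {k t : ℝ} (hk : 0 < k) (ht : t₀ ≤ t) :
    ∫ x, A.indicator (fun x => ramp k t (u x)) x * ‖T x‖ ^ 2 ≤ π / 2 := by
  have h1 := hT.integral_norm_sq (density_nonneg h0)
  have h2 := h.integral_density_le t₀
  have h3 := (h.integral_density_pos h0).le
  have h4 : (∫ x, density A u t₀ x) ^ 2 / (2 * π) ≤ π / 2 := by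
    rw [div_le_div_iff₀ (by positivity) (by positivity)]
    nlinarith [pi_pos]
  refine le_trans ?_ (h1.trans_le h4)
  have hTc := continuousOn_transport hT
  have hb : Integrable fun x => density A u t₀ x * ‖T x‖ ^ 2 := by
    refine ((h.integrable_density t₀).mul_const ((∫ z, density A u t₀ z) / π)).mono'
      (((h.continuous_density t₀).measurable.mul
        (hT.measurable.norm.pow_const 2)).aestronglyMeasurable) (ae_of_all _ fun x => ?_)
    rw [Real.norm_of_nonneg (mul_nonneg (density_nonneg h0 x) (sq_nonneg _))]
    rcases (density_nonneg (u := u) (A := A) h0 x).eq_or_lt with hx | hx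
    · simp [← hx]
    · exact mul_le_mul_of_nonneg_left (hT.bound x hx) hx.le
  refine integral_mono (h.integrable_ramp_mul_transport h0 hk ht (hTc.norm.pow 2)) hb fun x => ?_
  exact mul_le_mul_of_nonneg_right (ramp_le_density hk h0 ht x) (sq_nonneg _)

theorem defect_le (h : NearVortex δ Ω A u G) (hT : TransportMap (density A u t₀) T T₁ T₂)
    (h0 : 0 < t₀) {k t : ℝ} (hk : 0 < k) (ht : t₀ ≤ t) :
    defect A u G T k t ≤ π / 8 + 3 * π * δ -
      ∫ x, A.indicator (fun x => softPos k t (u x)) x := by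
  have h1 := h.abs_dirichlet_sub_le hk (h0.trans_le ht)
  have h2 := h.two_mul_le_transport hT h0 hk ht
  have h3 := h.integral_ramp_norm_sq_le hT h0 hk ht
  rw [h.defect_eq hT h0 hk ht]
  have := (abs_le.1 h1).2
  linarith

theorem defect_nonneg (k t : ℝ) : 0 ≤ defect A u G T k t :=
  integral_nonneg fun x => mul_nonneg (Set.indicator_nonneg (fun _ _ => ramp_nonneg _ _ _) x)
    (sq_nonneg _)

theorem continuousOn_defect (h : NearVortex δ Ω A u G)
    (hT : TransportMap (density A u t₀) T T₁ T₂) :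
    ContinuousOn (fun x => ‖G x + (1 / 2 : ℝ) • T x‖ ^ 2) {z | 0 < density A u t₀ z} := by
  have hTc := continuousOn_transport hT
  have hGc : ContinuousOn G {z | 0 < density A u t₀ z} :=
    h.contG.mono (density_pos_subset.trans h.subset)
  have h2 : ContinuousOn (fun x => G x + (1 / 2 : ℝ) • T x) {z | 0 < density A u t₀ z} :=
    hGc.add (hTc.const_smul (1 / 2 : ℝ))
  exact h2.norm.pow 2

theorem defect_anti (h : NearVortex δ Ω A u G) (hT : TransportMap (density A u t₀) T T₁ T₂)
    (h0 : 0 < t₀) {k t : ℝ} (hk : 0 < k) (ht : t₀ ≤ t) :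
    defect A u G T k t ≤ defect A u G T k t₀ := by
  have hc := h.continuousOn_defect hT
  refine integral_mono (h.integrable_ramp_mul_transport h0 hk ht hc)
    (h.integrable_ramp_mul_transport h0 hk le_rfl hc) fun x => ?_
  exact mul_le_mul_of_nonneg_right (Set.indicator_le_indicator (ramp_anti hk ht _)) (sq_nonneg _)

/-- The mass above a level is controlled by the energy above the level. -/
theorem sq_integral_ramp_le (h : NearVortex δ Ω A u G)
    (hT : TransportMap (density A u t₀) T T₁ T₂)
    (h0 : 0 < t₀) {k t s : ℝ} (hk : 0 < k) (ht : t₀ ≤ t) (hs : 0 < s)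
    (hd : defect A u G T k t ≤ s ^ 2) :
    (∫ x, A.indicator (fun x => ramp k t (u x)) x) ^ 2 / (8 * π) ≤
      (∫ x, A.indicator (fun x => softPos k t (u x)) x) + 3 * π * δ + 3 * (π + 1) * s + s ^ 2 := by
  set w := A.indicator (fun x => ramp k t (u x)) with hw
  have hw0 : ∀ x, 0 ≤ w x := Set.indicator_nonneg fun _ _ => ramp_nonneg _ _ _
  have hwi : Integrable w := by
    have := h.integrable_ramp_mul_transport h0 hk ht (F := fun _ => 1) continuousOn_const
    simpa using this
  have h1 := hT.le_integral_norm_sq (h.integrable_density t₀) hw0 (ramp_le_density hk h0 ht)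
    hwi.aestronglyMeasurable
  have hTc := continuousOn_transport hT
  have hGc : ContinuousOn G {z | 0 < density A u t₀ z} :=
    h.contG.mono (density_pos_subset.trans h.subset)
  have i1 := h.integrable_ramp_mul_transport h0 hk ht (F := fun x => ‖G x‖ ^ 2) (hGc.norm.pow 2)
  have i2 := h.integrable_ramp_mul_transport h0 hk ht (h.continuousOn_defect hT)
  have i3 := h.integrable_ramp_mul_transport h0 hk ht (F := fun x => ‖T x‖ ^ 2) (hTc.norm.pow 2)
  have h2 : ∫ x, w x * ‖T x‖ ^ 2 ≤ ∫ x, (4 * (w x * ‖G x‖ ^ 2) + (12 * s) * w x +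
      (12 / s + 4) * (w x * ‖G x + (1 / 2 : ℝ) • T x‖ ^ 2)) := by
    refine integral_mono i3 (((i1.const_mul 4).add (hwi.const_mul _)).add (i2.const_mul _))
      fun x => ?_
    show w x * ‖T x‖ ^ 2 ≤ 4 * (w x * ‖G x‖ ^ 2) + (12 * s) * w x +
      (12 / s + 4) * (w x * ‖G x + (1 / 2 : ℝ) • T x‖ ^ 2)
    by_cases hx : x ∈ A
    · have h3 := h.norm_grad_le (h.subset hx)
      set z := G x + (1 / 2 : ℝ) • T x with hz
      have h4 : T x = (2:ℝ) • (z - G x) := by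
        rw [hz, add_sub_cancel_left, smul_smul]; norm_num
      have h5 : ‖T x‖ ^ 2 ≤ 4 * (‖z‖ + ‖G x‖) ^ 2 := by
        rw [h4, norm_smul, mul_pow]
        have := norm_sub_le z (G x)
        norm_num
        gcongr
      have h6 : 24 * ‖z‖ ≤ 12 * s + 12 / s * ‖z‖ ^ 2 := by
        have : 12 * s + 12 / s * ‖z‖ ^ 2 - 24 * ‖z‖ = 12 / s * (s - ‖z‖) ^ 2 := by
          field_simp; ring
        have h7 : 0 ≤ 12 / s * (s - ‖z‖) ^ 2 := by positivity
        linarith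
      have h7 : ‖T x‖ ^ 2 ≤ 4 * ‖G x‖ ^ 2 + 12 * s + (12 / s + 4) * ‖z‖ ^ 2 := by
        nlinarith [norm_nonneg z, mul_le_mul_of_nonneg_left h3 (norm_nonneg z)]
      calc w x * ‖T x‖ ^ 2 ≤ w x * (4 * ‖G x‖ ^ 2 + 12 * s + (12 / s + 4) * ‖z‖ ^ 2) :=
            mul_le_mul_of_nonneg_left h7 (hw0 x)
        _ = _ := by ring
    · have : w x = 0 := Set.indicator_of_notMem hx _
      simp [this]
  have h3 : ∫ x, (4 * (w x * ‖G x‖ ^ 2) + (12 * s) * w x +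
      (12 / s + 4) * (w x * ‖G x + (1 / 2 : ℝ) • T x‖ ^ 2)) =
      4 * (∫ x, w x * ‖G x‖ ^ 2) + 12 * s * (∫ x, w x) +
        (12 / s + 4) * defect A u G T k t := by
    exact integral_lincomb i1 hwi i2 4 (12 * s) (12 / s + 4)
  have h4 : ∫ x, w x ≤ π :=
    (integral_mono hwi (h.integrable_density t₀) (ramp_le_density hk h0 ht)).trans
      (h.integral_density_le t₀)
  have h5 := (abs_le.1 (h.abs_dirichlet_sub_le hk (h0.trans_le ht))).2
  have e1 : ∀ x, A.indicator (fun x => ramp k t (u x) * ‖G x‖ ^ 2) x =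
      w x * ‖G x‖ ^ 2 := fun x => by
    by_cases hx : x ∈ A <;> simp [hw, hx]
  simp_rw [e1] at h5
  have h6 : (12 / s + 4) * defect A u G T k t ≤ 12 * s + 4 * s ^ 2 := by
    calc _ ≤ (12 / s + 4) * s ^ 2 := by gcongr
      _ = _ := by field_simp
  have h7 : 12 * s * (∫ x, w x) ≤ 12 * s * π := by gcongr
  have h8 : (∫ x, w x) ^ 2 / (8 * π) = 1 / 4 * ((∫ x, w x) ^ 2 / (2 * π)) := by
    field_simp; ring
  rw [h8]
  linarith

end NearVortex

end

section

/-- A differential inequality for the square root of a decreasing function. -/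
theorem sqrt_sub_le_of_sub_le {J : ℝ → ℝ} {a b c r : ℝ} (hab : a ≤ b) (hr : 0 < r) (hc : 0 < c)
    (hJ : ContinuousOn J (Set.Icc a b)) (h0 : ∀ t, 0 ≤ J t)
    (h : ∀ t ∈ Set.Icc a b, ∀ t' ∈ Set.Icc a b, t ≤ t' → J t - J t' ≤ (t' - t) * (c * √(J t + r))) :
    √(J a + r) - c / 2 * (b - a) ≤ √(J b + r) := by
  have hY : ContinuousOn (fun t => √(J t + r)) (Set.Icc a b) := (hJ.add_const r).sqrt
  have hpos : ∀ t, 0 < √(J t + r) := fun t => Real.sqrt_pos.2 (by linarith [h0 t])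
  have key : ∀ ⦃x⦄, x ∈ Set.Icc a b → -√(J x + r) ≤ -√(J a + r) + c / 2 * (x - a) := by
    refine image_le_of_liminf_slope_right_le_deriv_boundary hY.neg (by simp)
      (B' := fun _ => c / 2) (by fun_prop) (fun x _ => ?_) ?_
    · have : HasDerivAt (fun x => -√(J a + r) + c / 2 * (x - a)) (c / 2) x := by
        have h1 := (((hasDerivAt_id x).sub_const a).const_mul (c / 2)).const_add (-√(J a + r))
        simpa using h1
      exact this.hasDerivWithinAt
    · intro x hx q hq
      have hxI : x ∈ Set.Icc a b := Set.Ico_subset_Icc_self hx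
      have hlim : Tendsto (fun z => c * √(J x + r) / (√(J x + r) + √(J z + r)))
          (nhdsWithin x (Set.Ioi x)) (nhds (c / 2)) := by
        have h1 : Tendsto (fun z => √(J z + r)) (nhdsWithin x (Set.Ioi x))
            (nhds (√(J x + r))) := by
          have h2 := hY x hxI
          refine h2.tendsto.mono_left ?_
          rw [← nhdsWithin_Ioo_eq_nhdsGT hx.2]
          exact nhdsWithin_mono _ (fun y hy => ⟨hx.1.trans hy.1.le, hy.2.le⟩)
        have h2 := (tendsto_const_nhds (x := c * √(J x + r))).div (h1.const_add (√(J x + r)))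
          (by have := hpos x; positivity)
        have h3 : c * √(J x + r) / (√(J x + r) + √(J x + r)) = c / 2 := by
          have := (hpos x).ne'
          field_simp
          norm_num
        rwa [h3] at h2
      have hev := hlim.eventually_lt_const hq
      refine Eventually.frequently ?_
      filter_upwards [hev, Ioo_mem_nhdsGT hx.2] with z hz hzI
      refine lt_of_le_of_lt ?_ hz
      have hzI' : z ∈ Set.Icc a b := ⟨hx.1.trans hzI.1.le, hzI.2.le⟩
      have h4 := h x hxI z hzI' hzI.1.le
      have hzx : 0 < z - x := sub_pos.2 hzI.1
      rw [slope_def_field, le_div_iff₀ (by have := hpos x; have := hpos z; positivity),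
        div_mul_eq_mul_div, div_le_iff₀ hzx]
      show (-√(J z + r) - -√(J x + r)) * (√(J x + r) + √(J z + r)) ≤ _
      have h5 := Real.sq_sqrt (show 0 ≤ J x + r by linarith [h0 x])
      have h6 := Real.sq_sqrt (show 0 ≤ J z + r by linarith [h0 z])
      nlinarith
  have := key (Set.right_mem_Icc.2 hab)
  linarith

namespace NearVortex

variable {δ : ℝ} {Ω A : Set ℂ} {u : ℂ → ℝ} {G : ℂ → ℂ}

/-- The area of a superlevel set. -/
def levelArea (A : Set ℂ) (u : ℂ → ℝ) (t : ℝ) : ℝ := volume.real (A ∩ {x | t < u x})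

/-- The mass above a level. -/
def levelMass (A : Set ℂ) (u : ℂ → ℝ) (t : ℝ) : ℝ := ∫ x in A, max (u x - t) 0

theorem isOpen_level (h : NearVortex δ Ω A u G) (t : ℝ) : IsOpen (A ∩ {x | t < u x}) :=
  (h.cont.mono h.subset).isOpen_inter_preimage h.isOpen isOpen_Ioi

theorem levelArea_le (h : NearVortex δ Ω A u G) (t : ℝ) : levelArea A u t ≤ π := by
  rw [← h.vol]
  exact measureReal_mono Set.inter_subset_left h.bdd.measure_lt_top.ne

theorem levelMass_nonneg (t : ℝ) : 0 ≤ levelMass A u t :=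
  integral_nonneg fun _ => le_max_right _ _

theorem levelMass_sub_le (h : NearVortex δ Ω A u G) {t t' : ℝ} (ht : t ≤ t') :
    levelMass A u t - levelMass A u t' ≤ (t' - t) * levelArea A u t := by
  unfold levelMass levelArea
  rw [← integral_sub (h.integrableOn_pos t) (h.integrableOn_pos t')]
  have h1 : IntegrableOn (fun x => ({x | t < u x} : Set ℂ).indicator (fun _ => t' - t) x) A := by
    rw [← integrable_indicator_iff h.measurableSet, Set.indicator_indicator]
    refine (integrableOn_const (ne_top_of_le_ne_top h.bdd.measure_lt_top.ne
      (measure_mono Set.inter_subset_left))).integrable_indicator (h.isOpen_level t).measurableSet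
  have h2 : ∫ x in A, ({x | t < u x} : Set ℂ).indicator (fun _ => t' - t) x =
      (t' - t) * volume.real (A ∩ {x | t < u x}) := by
    rw [← integral_indicator h.measurableSet, Set.indicator_indicator,
      integral_indicator (h.isOpen_level t).measurableSet, setIntegral_const, smul_eq_mul, mul_comm]
  rw [← h2]
  refine integral_mono ((h.integrableOn_pos t).sub (h.integrableOn_pos t')) h1 fun x => ?_
  show max (u x - t) 0 - max (u x - t') 0 ≤ _
  by_cases hx : t < u x
  · rw [Set.indicator_of_mem (show x ∈ {x | t < u x} from hx), max_eq_left (by linarith)]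
    linarith [le_max_left (u x - t') 0]
  · rw [Set.indicator_of_notMem (show x ∉ {x | t < u x} from hx), max_eq_right (by linarith)]
    linarith [le_max_right (u x - t') 0]

theorem levelMass_anti (h : NearVortex δ Ω A u G) {t t' : ℝ} (ht : t ≤ t') :
    levelMass A u t' ≤ levelMass A u t :=
  integral_mono (h.integrableOn_pos t') (h.integrableOn_pos t) fun _ =>
    max_le_max (by linarith) le_rfl

theorem continuous_levelMass (h : NearVortex δ Ω A u G) : Continuous (levelMass A u) := by
  have key : ∀ t t', t ≤ t' → |levelMass A u t - levelMass A u t'| ≤ π * |t - t'| := by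
    intro t t' ht
    rw [abs_of_nonneg (sub_nonneg.2 (h.levelMass_anti ht)), abs_of_nonpos (by linarith)]
    have := h.levelMass_sub_le ht
    nlinarith [h.levelArea_le t]
  refine LipschitzWith.continuous (K := ⟨π, pi_pos.le⟩)
    (LipschitzWith.of_dist_le_mul fun t t' => ?_)
  rw [Real.dist_eq, Real.dist_eq]
  rcases le_total t t' with ht | ht
  · exact key t t' ht
  · rw [abs_sub_comm, abs_sub_comm t t']; exact key t' t ht

/-- The error in the level inequality. -/
def levelError (δ : ℝ) : ℝ := 9 * π * δ + 3 * (π + 1) * √(6 * π * δ)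

theorem integral_le (h : NearVortex δ Ω A u G) : ∫ x in A, u x ≤ π / 8 + 5 * π * δ := by
  obtain ⟨T, T₁, T₂, hT⟩ := exists_transportMap (h.continuous_density δ)
    (h.hasCompactSupport_indicator _) (density_nonneg h.pos_delta)
    (h.integral_density_pos h.pos_delta)
  have hk : 0 < 1 / δ := one_div_pos.2 h.pos_delta
  have h1 := h.defect_le hT h.pos_delta hk le_rfl
  have h2 := h.le_integral_softPos hk h.pos_delta
  have h3 := defect_nonneg (A := A) (u := u) (G := G) (T := T) (1 / δ) δ
  rw [h.vol, one_div_one_div] at h2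
  linarith

theorem sq_levelArea_le (h : NearVortex δ Ω A u G) {t : ℝ} (ht : δ < t) :
    levelArea A u t ^ 2 ≤ 8 * π * (levelMass A u t + levelError δ) := by
  have hδ := h.pos_delta
  obtain ⟨T, T₁, T₂, hT⟩ := exists_transportMap (h.continuous_density δ)
    (h.hasCompactSupport_indicator _) (density_nonneg hδ) (h.integral_density_pos hδ)
  refine le_of_forall_pos_le_add fun e he => ?_
  set r := min (min δ (t - δ)) (e / (8 * π * π)) with hr
  have hr0 : 0 < r := by
    have := sub_pos.2 ht
    positivity
  have hr1 : r ≤ δ := (min_le_left _ _).trans (min_le_left _ _)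
  have hr2 : r ≤ t - δ := (min_le_left _ _).trans (min_le_right _ _)
  have hr3 : 8 * π * π * r ≤ e := by
    have : r ≤ e / (8 * π * π) := min_le_right _ _
    rwa [le_div_iff₀ (by positivity), mul_comm] at this
  have hk : 0 < 1 / r := one_div_pos.2 hr0
  have htr : δ ≤ t - r := by linarith
  have hd : defect A u G T (1 / r) (t - r) ≤ √(6 * π * δ) ^ 2 := by
    rw [Real.sq_sqrt (by positivity)]
    have h1 := h.defect_anti hT hδ hk htr
    have h2 := h.defect_le hT hδ hk le_rfl
    have h3 := h.le_integral_softPos hk hδ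
    rw [h.vol, one_div_one_div] at h3
    have h4 := h.energy
    nlinarith [pi_pos]
  have h1 := h.sq_integral_ramp_le hT hδ hk htr (Real.sqrt_pos.2 (by positivity)) hd
  have h2 := h.integral_softPos_le hk (t := t - r) (by linarith)
  have h3 : levelMass A u (t - r) ≤ levelMass A u t + π * r := by
    have := h.levelMass_sub_le (t := t - r) (t' := t) (by linarith)
    nlinarith [h.levelArea_le (t - r)]
  have h4 : levelArea A u t ≤ ∫ x, A.indicator (fun x => ramp (1 / r) (t - r) (u x)) x := by
    unfold levelArea
    rw [← integral_indicator_one (h.isOpen_level t).measurableSet]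
    have hwi := h.integrable_ramp_mul_transport hδ hk htr (F := fun _ => 1) continuousOn_const
    simp only [mul_one] at hwi
    refine integral_mono ((integrableOn_const (ne_top_of_le_ne_top h.bdd.measure_lt_top.ne
      (measure_mono Set.inter_subset_left))).integrable_indicator
        (h.isOpen_level t).measurableSet) hwi fun x => ?_
    by_cases hx : x ∈ A ∩ {x | t < u x}
    · rw [Set.indicator_of_mem hx, Set.indicator_of_mem hx.1,
        ramp_of_ge hk (by rw [one_div_one_div]; linarith [show t < u x from hx.2])]
      rfl
    · rw [Set.indicator_of_notMem hx]
      exact Set.indicator_nonneg (fun _ _ => ramp_nonneg _ _ _) x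
  have h5 : levelArea A u t ^ 2 ≤
      (∫ x, A.indicator (fun x => ramp (1 / r) (t - r) (u x)) x) ^ 2 := by
    have : 0 ≤ levelArea A u t := measureReal_nonneg
    gcongr
  rw [Real.sq_sqrt (by positivity), div_le_iff₀ (by positivity)] at h1
  have h6 : (∫ x, A.indicator (fun x => softPos (1 / r) (t - r) (u x)) x) ≤
      levelMass A u (t - r) := h2
  unfold levelError
  have h7 : ((∫ x, A.indicator (fun x => softPos (1 / r) (t - r) (u x)) x) + 3 * π * δ +
      3 * (π + 1) * √(6 * π * δ) + 6 * π * δ) * (8 * π) ≤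
      (levelMass A u t + π * r + 3 * π * δ +
      3 * (π + 1) * √(6 * π * δ) + 6 * π * δ) * (8 * π) := by
    gcongr
    linarith
  calc _ ≤ _ := h5
    _ ≤ _ := h1
    _ ≤ _ := h7
    _ = 8 * π * (levelMass A u t + (9 * π * δ + 3 * (π + 1) * √(6 * π * δ))) + 8 * π * π * r := by
        ring
    _ ≤ _ := by linarith

/-- A point where `u` is almost as large as possible. -/
theorem exists_max (h : NearVortex δ Ω A u G) : ∃ q ∈ A, ∀ x ∈ A, u x ≤ u q := by
  have hne : A.Nonempty := by
    rw [Set.nonempty_iff_ne_empty]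
    rintro rfl
    have := h.vol
    simp [pi_ne_zero.symm] at this
  obtain ⟨q, hq, hmax⟩ := h.isCompact_closure.exists_isMaxOn (hne.mono subset_closure)
    (h.cont.mono h.closure_subset)
  obtain ⟨a, ha⟩ := hne
  have hpos : 0 < u q := (h.pos a ha).trans_le (hmax (subset_closure ha))
  refine ⟨q, ?_, fun x hx => hmax (subset_closure hx)⟩
  by_contra hn
  exact absurd (h.nonpos q (h.closure_subset hq) hn) (not_le.2 hpos)

theorem max_ge (h : NearVortex δ Ω A u G) {q : ℂ} (hmax : ∀ x ∈ A, u x ≤ u q) :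
    √(π / 8 * (1 - 17 * δ)) - √(levelError δ) ≤ √(2 * π) * u q := by
  have hδ := h.pos_delta
  have hle : 0 < levelError δ := by unfold levelError; positivity
  have hJ : π / 8 * (1 - 17 * δ) ≤ levelMass A u (2 * δ) := by
    have h1 : (∫ x in A, u x) - 2 * δ * π ≤ levelMass A u (2 * δ) := by
      have hc : IntegrableOn (fun _ : ℂ => 2 * δ) A :=
        integrableOn_const h.bdd.measure_lt_top.ne
      have h2 : (∫ x in A, u x) - 2 * δ * π = ∫ x in A, (u x - 2 * δ) := by
        rw [integral_sub h.integrableOn hc, setIntegral_const, smul_eq_mul, h.vol, mul_comm π]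
      rw [h2]
      exact integral_mono (h.integrableOn.sub hc) (h.integrableOn_pos _) fun x => le_max_left _ _
    have := h.energy
    nlinarith [pi_pos]
  rcases le_total (u q) (2 * δ) with hq | hq
  · have hz : levelMass A u (2 * δ) = 0 := by
      unfold levelMass
      rw [setIntegral_congr_fun (g := fun _ => (0:ℝ)) h.measurableSet]
      · simp
      · intro x hx
        exact max_eq_right (by linarith [hmax x hx])
    have h2 : √(π / 8 * (1 - 17 * δ)) = 0 := Real.sqrt_eq_zero_of_nonpos (by linarith)
    have h3 : 0 ≤ u q := by
      obtain ⟨a, ha, _⟩ := h.exists_max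
      exact (h.pos a ha).le.trans (hmax a ha)
    rw [h2]
    have : 0 ≤ √(2 * π) * u q := by positivity
    linarith [Real.sqrt_nonneg (levelError δ)]
  have hz : levelMass A u (u q) = 0 := by
    unfold levelMass
    rw [setIntegral_congr_fun (g := fun _ => (0:ℝ)) h.measurableSet]
    · simp
    · intro x hx
      exact max_eq_right (by linarith [hmax x hx])
  have key := sqrt_sub_le_of_sub_le hq hle (c := √(8 * π)) (by positivity)
    h.continuous_levelMass.continuousOn levelMass_nonneg (fun t ht t' _ htt => by
      refine (h.levelMass_sub_le htt).trans ?_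
      refine mul_le_mul_of_nonneg_left ?_ (by linarith)
      rw [← Real.sqrt_mul (by positivity)]
      exact Real.le_sqrt_of_sq_le (h.sq_levelArea_le (by linarith [ht.1])))
  rw [hz, zero_add] at key
  have h8 : √(8 * π) = 2 * √(2 * π) := by
    rw [show 8 * π = 2 ^ 2 * (2 * π) by ring, Real.sqrt_mul (by positivity),
      Real.sqrt_sq (by norm_num)]
  rw [h8] at key
  have h9 : √(π / 8 * (1 - 17 * δ)) ≤ √(levelMass A u (2 * δ) + levelError δ) :=
    Real.sqrt_le_sqrt (by linarith)
  nlinarith [Real.sqrt_nonneg (2 * π)]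

theorem quarter_sub_le_max (h : NearVortex δ Ω A u G) {q : ℂ} (hmax : ∀ x ∈ A, u x ≤ u q)
    {e : ℝ} (he : 0 < e) (he1 : e ≤ 1) (hδ : δ = e ^ 4) : 1 / 4 - 9 * e ≤ u q := by
  have h1 := h.max_ge hmax
  have hpi := pi_gt_three
  have hpi' := pi_lt_d2
  have h2pi : 0 < √(2 * π) := by positivity
  have hs := Real.sq_sqrt (show 0 ≤ 2 * π by positivity)
  have hs2 : 2 ≤ √(2 * π) := Real.le_sqrt_of_sq_le (by linarith)
  have he4 : e ^ 4 ≤ e := by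
    calc e ^ 4 = e * e ^ 3 := by ring
      _ ≤ e * 1 := by gcongr; exact pow_le_one₀ he.le he1
      _ = e := mul_one e
  have he42 : e ^ 4 ≤ e ^ 2 := pow_le_pow_of_le_one he.le he1 (by norm_num)
  have hle : √(levelError δ) ≤ 9.2 * e := by
    rw [Real.sqrt_le_left (by positivity)]
    unfold levelError
    have : √(6 * π * δ) ≤ 4.4 * e ^ 2 := by
      rw [Real.sqrt_le_left (by positivity), hδ]
      nlinarith [pow_pos he 4]
    have h3 : 3 * (π + 1) * √(6 * π * δ) ≤ 3 * (3.15 + 1) * (4.4 * e ^ 2) := by gcongr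
    have h4 : 9 * π * δ ≤ 9 * 3.15 * e ^ 2 := by
      rw [hδ]; gcongr
    nlinarith [sq_nonneg e]
  have h5 : √(2 * π) * (1 / 4 - 17 / 4 * e) ≤ √(π / 8 * (1 - 17 * δ)) := by
    rcases le_or_gt (1 - 17 * e) 0 with hn | hp
    · refine le_trans ?_ (Real.sqrt_nonneg _)
      nlinarith
    · apply Real.le_sqrt_of_sq_le
      rw [mul_pow, hs, hδ]
      have : (1 - 17 * e) ^ 2 ≤ 1 - 17 * e := by nlinarith
      nlinarith
  nlinarith

end NearVortex

end

section

/-- A function with small gradient on a convex set has small oscillation. -/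
theorem abs_sub_le_of_hasLineDerivAt {S : Set ℂ} (hS : Convex ℝ S) {g : ℂ → ℝ} {V : ℂ → ℂ}
    {δ : ℝ} (hd : ∀ x ∈ S, ∀ e, HasLineDerivAt ℝ g ⟪V x, e⟫ x e) (hb : ∀ x ∈ S, ‖V x‖ ≤ δ)
    {x y : ℂ} (hx : x ∈ S) (hy : y ∈ S) : |g y - g x| ≤ δ * ‖y - x‖ := by
  have hmem : ∀ s ∈ Set.Icc (0:ℝ) 1, x + s • (y - x) ∈ S := fun s hs =>
    hS.add_smul_sub_mem hx hy hs
  have hder : ∀ s ∈ Set.Icc (0:ℝ) 1, HasDerivWithinAt (fun s : ℝ => g (x + s • (y - x)))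
      ⟪V (x + s • (y - x)), y - x⟫ (Set.Icc 0 1) s := by
    intro s hs
    have h1 := hd _ (hmem s hs) (y - x)
    rw [HasLineDerivAt] at h1
    have h2 : HasDerivAt (fun r : ℝ => r - s) 1 s := (hasDerivAt_id s).sub_const s
    rw [← sub_self s] at h1
    have h3 := HasDerivAt.comp (h := fun r : ℝ => r - s) s h1 h2
    rw [mul_one] at h3
    refine (h3.congr_of_eventuallyEq (Eventually.of_forall fun r => ?_)).hasDerivWithinAt
    simp only [Function.comp_apply]
    congr 1
    rw [add_assoc, ← add_smul]
    congr 2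
    ring
  have h := Convex.norm_image_sub_le_of_norm_hasDerivWithin_le (C := δ * ‖y - x‖) hder
    (fun s hs => (norm_inner_le_norm _ _).trans
      (mul_le_mul_of_nonneg_right (hb _ (hmem s hs)) (norm_nonneg _))) (convex_Icc 0 1)
    (Set.left_mem_Icc.2 zero_le_one) (Set.right_mem_Icc.2 zero_le_one)
  simpa using h

theorem integrable_prod_log {A B : Set ℂ} (hA : Bornology.IsBounded A) (hAm : MeasurableSet A)
    (hB : Bornology.IsBounded B) (hBm : MeasurableSet B) :
    Integrable (fun p : ℂ × ℂ => log ‖p.1 - p.2‖)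
      ((volume.restrict A).prod (volume.restrict B)) := by
  have hfin : IsFiniteMeasure (volume.restrict A) := ⟨by simpa using hA.measure_lt_top⟩
  have hfin' : IsFiniteMeasure (volume.restrict B) := ⟨by simpa using hB.measure_lt_top⟩
  obtain ⟨R, hR⟩ := hA.exists_norm_le
  obtain ⟨R', hR'⟩ := hB.exists_norm_le
  have hi := (integrable_prod_inv_norm (μ := volume.restrict A) measurable_id hB hBm).add
    (integrable_const (R + R'))
  refine hi.mono' (Real.measurable_log.comp (by fun_prop)).aestronglyMeasurable ?_
  rw [Measure.prod_restrict]
  refine ae_restrict_of_forall_mem (hAm.prod hBm) fun p hp => ?_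
  refine (abs_log_le_inv_add (norm_nonneg _)).trans ?_
  refine add_le_add le_rfl ((norm_sub_le _ _).trans ?_)
  exact add_le_add (hR _ hp.1) (hR' _ hp.2)

theorem integrableOn_logPot {A B : Set ℂ} (hA : Bornology.IsBounded A) (hAm : MeasurableSet A)
    (hB : Bornology.IsBounded B) (hBm : MeasurableSet B) : IntegrableOn (logPot B) A :=
  (integrable_prod_log hA hAm hB hBm).integral_prod_left

theorem integral_logPot_comm {A B : Set ℂ} (hA : Bornology.IsBounded A) (hAm : MeasurableSet A)
    (hB : Bornology.IsBounded B) (hBm : MeasurableSet B) :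
    ∫ x in A, logPot B x = ∫ x in B, logPot A x := by
  have := integral_integral_swap (f := fun x y : ℂ => log ‖x - y‖)
    (integrable_prod_log hA hAm hB hBm)
  simp_rw [logPot]
  rw [this]
  simp_rw [norm_sub_rev]

theorem integral_logPot_ball (q : ℂ) :
    ∫ x in Metric.ball q 1, logPot (Metric.ball q 1) x = -(π ^ 2 / 4) := by
  have h1 : ∀ x, (Metric.ball q 1).indicator (logPot (Metric.ball q 1)) x =
      -(π / 2) * max (1 - ‖x - q‖ ^ 2) 0 := by
    intro x
    by_cases hx : x ∈ Metric.ball q 1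
    · have hx' : ‖x - q‖ < 1 := by simpa [dist_eq_norm] using hx
      rw [Set.indicator_of_mem hx, logPot_ball, if_pos hx'.le, max_eq_left]
      nlinarith [norm_nonneg (x - q)]
    · have hx' : 1 ≤ ‖x - q‖ := by simpa [dist_eq_norm] using hx
      rw [Set.indicator_of_notMem hx, max_eq_right (by nlinarith), mul_zero]
  rw [← integral_indicator Metric.isOpen_ball.measurableSet, integral_congr_ae (ae_of_all _ h1),
    integral_const_mul, integral_sub_right_eq_self (fun x : ℂ => max (1 - ‖x‖ ^ 2) 0),
    (integral_max_sub_sq zero_le_one).2]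
  ring

theorem volume_real_ball (q : ℂ) {r : ℝ} (hr : 0 ≤ r) :
    volume.real (Metric.ball q r) = π * r ^ 2 := by
  rw [measureReal_def, Complex.volume_ball, ENNReal.toReal_mul, ENNReal.toReal_pow,
    ENNReal.toReal_ofReal hr, mul_comm]
  rfl

/-- Lower bound for the loss of potential at the centre when removing a part of a disc. -/
theorem integral_deficit_le {A : Set ℂ} (hA : Bornology.IsBounded A) (hm : MeasurableSet A)
    (q : ℂ) : (π / 2) * ∫ y in Metric.ball q 1 \ A, (1 - ‖y - q‖) ^ 2 ≤
      π ^ 2 / 4 - (∫ x in Metric.ball q 1, logPot A x) + π * logPot A q := by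
  set B := Metric.ball q 1 with hB
  have hBb : Bornology.IsBounded B := Metric.isBounded_ball
  have hBm : MeasurableSet B := Metric.isOpen_ball.measurableSet
  set D : ℂ → ℝ := fun y => logPot B y - π * log ‖q - y‖ with hD
  have hDi : ∀ {E : Set ℂ}, Bornology.IsBounded E → MeasurableSet E → IntegrableOn D E :=
    fun hE hEm => (integrableOn_logPot hE hEm hBb hBm).sub ((integrableOn_log_norm q hE).const_mul π)
  have hDint : ∀ {E : Set ℂ}, Bornology.IsBounded E → MeasurableSet E →
      ∫ y in E, D y = (∫ x in E, logPot B x) - π * logPot E q := by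
    intro E hE hEm
    rw [hD, integral_sub (integrableOn_logPot hE hEm hBb hBm)
      ((integrableOn_log_norm q hE).const_mul π), integral_const_mul]
    rfl
  have e1 := hDint hA hm
  have e2 := hDint hBb hBm
  rw [integral_logPot_comm hA hm hBb hBm] at e1
  rw [integral_logPot_ball] at e2
  have hq : logPot B q = -(π / 2) := by
    rw [hB, logPot_ball, sub_self, norm_zero, if_pos zero_le_one]; ring
  rw [hq] at e2
  have e3 := integral_inter_add_sdiff hBm (hDi hA hm)
  have e4 := integral_inter_add_sdiff hm (hDi hBb hBm)
  have e5 : ∫ y in A \ B, D y = 0 := by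
    rw [setIntegral_congr_fun (g := fun _ => (0:ℝ)) (hm.diff hBm)]
    · simp
    · intro y hy
      have hy' : 1 ≤ ‖y - q‖ := by simpa [hB, dist_eq_norm] using hy.2
      simp only [hD, hB, logPot_ball]
      rw [norm_sub_rev q y]
      rcases hy'.eq_or_lt with h1 | h1
      · simp [← h1]
      · rw [if_neg (not_le.2 h1), sub_self]
  rw [Set.inter_comm] at e4
  have e6 : (π / 2) * ∫ y in B \ A, (1 - ‖y - q‖) ^ 2 ≤ ∫ y in B \ A, D y := by
    rw [← integral_const_mul]
    have hcont : Continuous fun y : ℂ => π / 2 * (1 - ‖y - q‖) ^ 2 := by fun_prop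
    have hbd := hBb.subset (Set.sdiff_subset (s := B) (t := A))
    refine setIntegral_mono_on_ae ?_ (hDi hbd (hBm.diff hm)) (hBm.diff hm) ?_
    · exact (hcont.continuousOn.integrableOn_compact (isCompact_closedBall q 1)).mono_set
        (Set.sdiff_subset.trans Metric.ball_subset_closedBall)
    · filter_upwards [Measure.ae_ne volume q] with y hyq hy
      have hy' : ‖y - q‖ < 1 := by simpa [hB, dist_eq_norm] using hy.1
      have hy0 : 0 < ‖y - q‖ := norm_pos_iff.2 (sub_ne_zero.2 hyq)
      have hl := Real.log_le_sub_one_of_pos hy0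
      simp only [hD, hB, logPot_ball]
      rw [norm_sub_rev q y, if_pos hy'.le]
      nlinarith [pi_pos]
  linarith

end

section

theorem logPot_eq_inter_add_sdiff {A : Set ℂ} (hA : Bornology.IsBounded A) {B : Set ℂ}
    (hB : MeasurableSet B) (x : ℂ) : logPot A x = logPot (A ∩ B) x + logPot (A \ B) x :=
  (integral_inter_add_sdiff hB (integrableOn_log_norm x hA)).symm

theorem abs_logPot_le {E : Set ℂ} (hm : MeasurableSet E) {q : ℂ}
    (hE : E ⊆ Metric.ball q 2) :
    |logPot E q| ≤ 2 * √(2 * π * volume.real E) + 2 * volume.real E := by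
  have hb : Bornology.IsBounded E := Metric.isBounded_ball.subset hE
  have hi : IntegrableOn (fun y => ‖q - y‖⁻¹ + 2) E :=
    (integrableOn_inv_norm q hb).add (integrableOn_const hb.measure_lt_top.ne)
  have h1 : |logPot E q| ≤ ∫ y in E, (‖q - y‖⁻¹ + 2) := by
    rw [← Real.norm_eq_abs]
    refine norm_integral_le_of_norm_le hi (ae_restrict_of_forall_mem hm fun y hy => ?_)
    rw [Real.norm_eq_abs]
    have : ‖q - y‖ < 2 := by
      have := hE hy
      rwa [Metric.mem_ball, dist_comm, dist_eq_norm] at this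
    refine (abs_log_le_inv_add (norm_nonneg _)).trans (by linarith)
  rw [integral_add (integrableOn_inv_norm q hb) (integrableOn_const hb.measure_lt_top.ne),
    setIntegral_const, smul_eq_mul] at h1
  linarith [setIntegral_inv_norm_le q hb hm]

namespace NearVortex

variable {δ : ℝ} {Ω A : Set ℂ} {u : ℂ → ℝ} {G : ℂ → ℂ}

theorem abs_osc_le (h : NearVortex δ Ω A u G) {q : ℂ} (hq : q ∈ A) {x : ℂ}
    (hx : x ∈ Metric.ball q 4) :
    |(u x - u q) + 1 / (2 * π) * (logPot A x - logPot A q)| ≤ δ * ‖x - q‖ := by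
  have h1 := abs_sub_le_of_hasLineDerivAt (convex_ball q 4)
    (g := fun x => u x + 1 / (2 * π) * logPot A x)
    (V := fun x => G x + (1 / (2 * π)) • logPotGrad A x) (δ := δ) (fun y hy e => ?_)
    (fun y hy => h.near y (h.ball_subset q hq hy)) (Metric.mem_ball_self (by norm_num)) hx
  · refine le_trans (le_of_eq ?_) h1
    congr 1
    ring
  · have e1 := h.deriv y (h.ball_subset q hq hy) e
    have e2 := hasLineDerivAt_logPot h.bdd h.measurableSet y e
    rw [inner_add_left, real_inner_smul_left]
    exact HasDerivAt.add e1 (HasDerivAt.const_mul (1 / (2 * π)) e2)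

theorem integral_ball_le (h : NearVortex δ Ω A u G) {q : ℂ} (hq : q ∈ A) :
    IntegrableOn u (Metric.ball q 1) ∧ ∫ x in Metric.ball q 1, u x ≤ ∫ x in A, u x := by
  have hsub : Metric.closedBall q 1 ⊆ Ω :=
    (Metric.closedBall_subset_ball (by norm_num)).trans (h.ball_subset q hq)
  have hi : IntegrableOn u (Metric.ball q 1) :=
    ((h.cont.mono hsub).integrableOn_compact (isCompact_closedBall q 1)).mono_set
      Metric.ball_subset_closedBall
  refine ⟨hi, ?_⟩
  rw [← integral_inter_add_sdiff h.measurableSet hi]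
  have h1 : ∫ x in Metric.ball q 1 \ A, u x ≤ 0 :=
    setIntegral_nonpos (Metric.isOpen_ball.measurableSet.diff h.measurableSet) fun x hx =>
      h.nonpos x (hsub (Metric.ball_subset_closedBall hx.1)) hx.2
  have h2 : ∫ x in Metric.ball q 1 ∩ A, u x ≤ ∫ x in A, u x :=
    setIntegral_mono_set h.integrableOn
      (ae_restrict_of_forall_mem h.measurableSet fun x hx => (h.pos x hx).le)
      Set.inter_subset_right.eventuallyLE
  linarith

theorem deficit_le (h : NearVortex δ Ω A u G) {q : ℂ} (hq : q ∈ A) :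
    ∫ y in Metric.ball q 1 \ A, (1 - ‖y - q‖) ^ 2 ≤
      4 * (π / 8 - π * u q + (∫ x in A, u x) + π * δ) := by
  have h1 := integral_deficit_le h.bdd h.measurableSet q
  obtain ⟨hi, h2⟩ := h.integral_ball_le hq
  have hBb : Bornology.IsBounded (Metric.ball q 1) := Metric.isBounded_ball
  have hBm : MeasurableSet (Metric.ball q 1) := Metric.isOpen_ball.measurableSet
  have hc : IntegrableOn (fun _ : ℂ => logPot A q + 2 * π * u q - 2 * π * δ) (Metric.ball q 1) :=
    integrableOn_const measure_ball_lt_top.ne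
  have h3 : ∫ x in Metric.ball q 1, ((logPot A q + 2 * π * u q - 2 * π * δ) - 2 * π * u x) ≤
      ∫ x in Metric.ball q 1, logPot A x := by
    refine setIntegral_mono_on (hc.sub (hi.const_mul _))
      (integrableOn_logPot hBb hBm h.bdd h.measurableSet) hBm fun x hx => ?_
    have hx1 : ‖x - q‖ < 1 := by simpa [dist_eq_norm] using hx
    have h4 := (abs_le.1 (h.abs_osc_le hq (Metric.ball_subset_ball (by norm_num) hx))).1
    have h5 : δ * ‖x - q‖ ≤ δ * 1 := mul_le_mul_of_nonneg_left hx1.le h.pos_delta.le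
    have h6 : 2 * π * (u x - u q) + (logPot A x - logPot A q) =
        2 * π * ((u x - u q) + 1 / (2 * π) * (logPot A x - logPot A q)) := by
      field_simp
    have h7 : 2 * π * (-δ) ≤ 2 * π * ((u x - u q) + 1 / (2 * π) * (logPot A x - logPot A q)) := by
      gcongr; linarith
    linarith
  rw [integral_sub hc (hi.const_mul _), setIntegral_const, integral_const_mul,
    volume_real_ball q zero_le_one, smul_eq_mul] at h3
  have h8 : π / 2 * ∫ y in Metric.ball q 1 \ A, (1 - ‖y - q‖) ^ 2 ≤
      π / 2 * (4 * (π / 8 - π * u q + (∫ x in A, u x) + π * δ)) := by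
    nlinarith [pi_pos]
  exact le_of_mul_le_mul_left h8 (by positivity)

theorem max_le (h : NearVortex δ Ω A u G) {q : ℂ} (hq : q ∈ A) : u q ≤ 1 / 4 + 6 * δ := by
  have h1 := h.deficit_le hq
  have h2 : 0 ≤ ∫ y in Metric.ball q 1 \ A, (1 - ‖y - q‖) ^ 2 :=
    integral_nonneg fun y => sq_nonneg _
  have h3 := h.integral_le
  nlinarith [pi_pos]

theorem area_sdiff_le (h : NearVortex δ Ω A u G) {q : ℂ} (hq : q ∈ A)
    (hmax : ∀ x ∈ A, u x ≤ u q) {τ : ℝ} (hτ : 0 < τ) (hτ1 : τ ≤ 1) (hδ : δ = τ ^ 12) :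
    volume.real (Metric.ball q 1 \ A) ≤ 62 * π * τ := by
  have hBm : MeasurableSet (Metric.ball q 1) := Metric.isOpen_ball.measurableSet
  have h1 := h.deficit_le hq
  have h2 := h.integral_le
  have h3 := h.quarter_sub_le_max hmax (e := τ ^ 3) (by positivity) (pow_le_one₀ hτ.le hτ1)
    (by rw [hδ]; ring)
  have h4 : δ ≤ τ ^ 3 := by rw [hδ]; exact pow_le_pow_of_le_one hτ.le hτ1 (by norm_num)
  have h5 : ∫ y in Metric.ball q 1 \ A, (1 - ‖y - q‖) ^ 2 ≤ 60 * π * τ ^ 3 := by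
    nlinarith [pi_pos]
  have hi : IntegrableOn (fun y => (1 - ‖y - q‖) ^ 2) (Metric.ball q 1 \ A) := by
    have hcont : Continuous fun y : ℂ => (1 - ‖y - q‖) ^ 2 := by fun_prop
    exact (hcont.continuousOn.integrableOn_compact (isCompact_closedBall q 1)).mono_set
        (Set.sdiff_subset.trans Metric.ball_subset_closedBall)
  have hfin : volume (Metric.ball q 1 \ A) ≠ ⊤ :=
    ne_top_of_le_ne_top measure_ball_lt_top.ne (measure_mono Set.sdiff_subset)
  have hsm : MeasurableSet (Metric.ball q 1 \ A ∩ Metric.ball q (1 - τ)) :=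
    (hBm.diff h.measurableSet).inter Metric.isOpen_ball.measurableSet
  have h6 : τ ^ 2 * volume.real (Metric.ball q 1 \ A ∩ Metric.ball q (1 - τ)) ≤
      ∫ y in Metric.ball q 1 \ A, (1 - ‖y - q‖) ^ 2 := by
    refine le_trans ?_ (setIntegral_mono_set hi (ae_of_all _ fun _ => sq_nonneg _)
      (Set.inter_subset_left (t := Metric.ball q (1 - τ))).eventuallyLE)
    have h7 := setIntegral_mono_on (f := fun _ => τ ^ 2)
      (integrableOn_const (ne_top_of_le_ne_top hfin (measure_mono Set.inter_subset_left)))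
      (hi.mono_set (Set.inter_subset_left (t := Metric.ball q (1 - τ)))) hsm fun y hy => by
        have : ‖y - q‖ < 1 - τ := by simpa [dist_eq_norm] using hy.2
        nlinarith
    rwa [setIntegral_const, smul_eq_mul, mul_comm] at h7
  have h7 : volume.real (Metric.ball q 1 \ A ∩ Metric.ball q (1 - τ)) ≤ 60 * π * τ := by
    have : τ ^ 2 * volume.real (Metric.ball q 1 \ A ∩ Metric.ball q (1 - τ)) ≤
        τ ^ 2 * (60 * π * τ) := by nlinarith
    exact le_of_mul_le_mul_left this (by positivity)
  have h8 : volume.real ((Metric.ball q 1 \ A) \ Metric.ball q (1 - τ)) ≤ 2 * π * τ := by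
    have h9 : volume.real (Metric.ball q 1 \ Metric.ball q (1 - τ)) = π * 1 ^ 2 - π * (1 - τ) ^ 2 := by
      rw [measureReal_sdiff (Metric.ball_subset_ball (by linarith)) Metric.isOpen_ball.measurableSet,
        volume_real_ball q zero_le_one, volume_real_ball q (by linarith)]
    refine (measureReal_mono (Set.sdiff_subset_sdiff_left Set.sdiff_subset)
      (ne_top_of_le_ne_top measure_ball_lt_top.ne (measure_mono Set.sdiff_subset))).trans ?_
    rw [h9]
    nlinarith [pi_pos, mul_pos pi_pos (sq_pos_of_pos hτ)]
  have h9 := measureReal_inter_add_sdiff (μ := volume) (s := Metric.ball q 1 \ A)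
    (Metric.isOpen_ball (x := q) (ε := 1 - τ)).measurableSet hfin
  linarith

theorem area_sdiff_eq (h : NearVortex δ Ω A u G) (q : ℂ) :
    volume.real (A \ Metric.ball q 1) = volume.real (Metric.ball q 1 \ A) := by
  have h1 := measureReal_inter_add_sdiff (μ := volume) (s := A)
    (Metric.isOpen_ball (x := q) (ε := 1)).measurableSet h.bdd.measure_lt_top.ne
  have h2 := measureReal_inter_add_sdiff (μ := volume) (s := Metric.ball q 1)
    h.measurableSet measure_ball_lt_top.ne
  rw [h.vol] at h1
  rw [volume_real_ball q zero_le_one, Set.inter_comm] at h2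
  linarith

end NearVortex

end

section

namespace NearVortex

variable {σ : ℝ} {Ω A : Set ℂ} {u : ℂ → ℝ} {G : ℂ → ℂ}

theorem sqrt_area_le {a σ : ℝ} (hσ : 0 < σ) (ha : a ≤ 62 * π * σ ^ 2) :
    √(2 * π * a) ≤ 11.15 * π * σ := by
  rw [Real.sqrt_le_left (by positivity)]
  nlinarith [mul_le_mul_of_nonneg_left ha (by positivity : 0 ≤ 2 * π),
    mul_pos (sq_pos_of_pos pi_pos) (sq_pos_of_pos hσ)]

theorem area_sdiff_ball_le (h : NearVortex (σ ^ 24) Ω A u G) (hσ : 0 < σ) (hσ1 : σ ≤ 1 / 2000)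
    {q : ℂ} (hq : q ∈ A) (hmax : ∀ x ∈ A, u x ≤ u q) :
    volume.real (Metric.ball q 1 \ A) ≤ 62 * π * σ ^ 2 ∧
      volume.real (A \ Metric.ball q 1) ≤ 62 * π * σ ^ 2 := by
  have h1 := h.area_sdiff_le hq hmax (τ := σ ^ 2) (by positivity)
    (pow_le_one₀ hσ.le (by linarith)) (by ring)
  exact ⟨h1, (h.area_sdiff_eq q).trans_le h1⟩

theorem abs_max_sub_le (h : NearVortex (σ ^ 24) Ω A u G) (hσ : 0 < σ) (hσ1 : σ ≤ 1 / 2000)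
    {q : ℂ} (hq : q ∈ A) (hmax : ∀ x ∈ A, u x ≤ u q) : |u q - 1 / 4| ≤ 9 * σ := by
  have h1 := h.max_le hq
  have h2 := h.quarter_sub_le_max hmax (e := σ ^ 6) (by positivity)
    (pow_le_one₀ hσ.le (by linarith)) (by ring)
  have h3 : σ ^ 24 ≤ σ := pow_le_of_le_one hσ.le (by linarith) (by norm_num)
  have h4 : σ ^ 6 ≤ σ := pow_le_of_le_one hσ.le (by linarith) (by norm_num)
  rw [abs_le]
  constructor <;> linarith

theorem logPot_sub_logPot_ball (h : NearVortex (σ ^ 24) Ω A u G) (q x : ℂ) :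
    logPot A x - logPot (Metric.ball q 1) x =
      logPot (A \ Metric.ball q 1) x - logPot (Metric.ball q 1 \ A) x := by
  rw [logPot_eq_inter_add_sdiff h.bdd (Metric.isOpen_ball (x := q) (ε := 1)).measurableSet x,
    logPot_eq_inter_add_sdiff (Metric.isBounded_ball (x := q) (r := 1)) h.measurableSet x,
    Set.inter_comm]
  ring

theorem abs_add_logPot_ball_le (h : NearVortex (σ ^ 24) Ω A u G) (hσ : 0 < σ)
    (hσ1 : σ ≤ 1 / 2000) {q : ℂ} (hq : q ∈ A) (hmax : ∀ x ∈ A, u x ≤ u q) {x : ℂ}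
    (hx : x ∈ Metric.ball q 4) :
    |u x + 1 / (2 * π) * logPot (Metric.ball q 1) x| ≤ 192 * σ := by
  have hBm : MeasurableSet (Metric.ball q 1) := Metric.isOpen_ball.measurableSet
  have hBb : Bornology.IsBounded (Metric.ball q 1) := Metric.isBounded_ball
  obtain ⟨ha1, ha2⟩ := h.area_sdiff_ball_le hσ hσ1 hq hmax
  have hx4 : ‖x - q‖ ≤ 4 := by
    rw [Metric.mem_ball, dist_eq_norm] at hx; exact hx.le
  have h1 := abs_logPot_sub_le (h.bdd.subset Set.sdiff_subset) (h.measurableSet.diff hBm) x q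
  have h2 := abs_logPot_sub_le (hBb.subset (Set.sdiff_subset (t := A)))
    (hBm.diff h.measurableSet) x q
  have h3 := sqrt_area_le hσ ha1
  have h4 := sqrt_area_le hσ ha2
  have h5 : 4 * √(2 * π * volume.real (A \ Metric.ball q 1)) * ‖x - q‖ ≤
      4 * (11.15 * π * σ) * 4 := by gcongr
  have h6 : 4 * √(2 * π * volume.real (Metric.ball q 1 \ A)) * ‖x - q‖ ≤
      4 * (11.15 * π * σ) * 4 := by gcongr
  have h7 := h.abs_osc_le hq hx
  have h8 : σ ^ 24 * ‖x - q‖ ≤ σ * 4 :=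
    mul_le_mul (pow_le_of_le_one hσ.le (by linarith) (by norm_num)) hx4 (norm_nonneg _) hσ.le
  have h9 := h.abs_max_sub_le hσ hσ1 hq hmax
  have hLq : logPot (Metric.ball q 1) q = -(π / 2) := by
    rw [logPot_ball]; simp
  have e1 := h.logPot_sub_logPot_ball q x
  have e2 := h.logPot_sub_logPot_ball q q
  have h10 : |1 / (2 * π) * ((logPot (A \ Metric.ball q 1) x - logPot (A \ Metric.ball q 1) q)
      - (logPot (Metric.ball q 1 \ A) x - logPot (Metric.ball q 1 \ A) q))| ≤ 179 * σ := by
    rw [abs_mul, abs_of_pos (by positivity : 0 < 1 / (2 * π)), div_mul_eq_mul_div,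
      div_le_iff₀ (by positivity), one_mul]
    refine (abs_sub _ _).trans ?_
    nlinarith [mul_pos pi_pos hσ]
  have e3 : u x + 1 / (2 * π) * logPot (Metric.ball q 1) x =
      ((u x - u q) + 1 / (2 * π) * (logPot A x - logPot A q)) -
      1 / (2 * π) * ((logPot (A \ Metric.ball q 1) x - logPot (A \ Metric.ball q 1) q)
      - (logPot (Metric.ball q 1 \ A) x - logPot (Metric.ball q 1 \ A) q)) + (u q - 1 / 4) := by
    have e4 : logPot (Metric.ball q 1) x = logPot A x - logPot A q - (π / 2) -
        ((logPot (A \ Metric.ball q 1) x - logPot (A \ Metric.ball q 1) q)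
      - (logPot (Metric.ball q 1 \ A) x - logPot (Metric.ball q 1 \ A) q)) := by
      rw [hLq] at e2; linarith
    rw [e4]
    field_simp
    ring
  rw [e3, abs_le]
  rw [abs_le] at h7 h9 h10
  constructor <;> linarith

theorem subset_ball (h : NearVortex (σ ^ 24) Ω A u G) (hσ : 0 < σ) (hσ1 : σ ≤ 1 / 2000)
    {q : ℂ} (hq : q ∈ A) (hmax : ∀ x ∈ A, u x ≤ u q) :
    A ⊆ Metric.ball q (1 + 1000 * σ) := by
  have hne : ∀ x ∈ A, ‖x - q‖ ≠ 1 + 1000 * σ := by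
    intro x hx he
    have h1 := h.abs_add_logPot_ball_le hσ hσ1 hq hmax (x := x)
      (by rw [Metric.mem_ball, dist_eq_norm, he]; linarith)
    rw [logPot_ball, if_neg (by rw [he]; linarith), he] at h1
    have h2 : 1 - (1 + 1000 * σ)⁻¹ ≤ log (1 + 1000 * σ) :=
      Real.one_sub_inv_le_log_of_pos (by linarith)
    have h3 : 666 * σ ≤ 1 - (1 + 1000 * σ)⁻¹ := by
      rw [le_sub_iff_add_le, ← le_sub_iff_add_le', inv_le_iff_one_le_mul₀ (by positivity)]
      nlinarith
    have h4 := h.pos x hx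
    have h5 : 1 / (2 * π) * (π * log (1 + 1000 * σ)) = log (1 + 1000 * σ) / 2 := by
      field_simp
    rw [h5] at h1
    linarith [(abs_le.1 h1).2]
  intro x hx
  by_contra hc
  rw [Metric.mem_ball, dist_eq_norm, not_lt] at hc
  have h1 := (h.preconnected.image (fun x => ‖x - q‖) (by fun_prop)).Icc_subset
    (Set.mem_image_of_mem _ hq) (Set.mem_image_of_mem _ hx)
  obtain ⟨y, hy, hy2⟩ := h1 ⟨by simp; linarith, hc⟩
  exact hne y hy hy2

theorem ball_sub_subset (h : NearVortex (σ ^ 24) Ω A u G) (hσ : 0 < σ) (hσ1 : σ ≤ 1 / 2000)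
    {q : ℂ} (hq : q ∈ A) (hmax : ∀ x ∈ A, u x ≤ u q) :
    Metric.ball q (1 - 1000 * σ) ⊆ A := by
  intro x hx
  have hx4 : x ∈ Metric.ball q 4 := Metric.ball_subset_ball (by linarith) hx
  have h1 := h.abs_add_logPot_ball_le hσ hσ1 hq hmax hx4
  rw [Metric.mem_ball, dist_eq_norm] at hx
  rw [logPot_ball, if_pos (by linarith)] at h1
  by_contra hc
  have h2 := h.nonpos x (h.ball_subset q hq hx4) hc
  have h5 : 1 / (2 * π) * (-(π / 2) * (1 - ‖x - q‖ ^ 2)) = -((1 - ‖x - q‖ ^ 2) / 4) := by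
    field_simp
    ring
  rw [h5] at h1
  have h6 : ‖x - q‖ ^ 2 ≤ 1 - 1000 * σ := by
    nlinarith [norm_nonneg (x - q)]
  linarith [(abs_le.1 h1).1]

theorem abs_logPot_max_le (h : NearVortex (σ ^ 24) Ω A u G) (hσ : 0 < σ) (hσ1 : σ ≤ 1 / 2000)
    {q : ℂ} (hq : q ∈ A) (hmax : ∀ x ∈ A, u x ≤ u q) :
    |logPot A q + π / 2| ≤ 160 * σ := by
  have hBm : MeasurableSet (Metric.ball q 1) := Metric.isOpen_ball.measurableSet
  obtain ⟨ha1, ha2⟩ := h.area_sdiff_ball_le hσ hσ1 hq hmax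
  have h1 := abs_logPot_le (h.measurableSet.diff hBm) (q := q) (Set.sdiff_subset.trans
    ((h.subset_ball hσ hσ1 hq hmax).trans (Metric.ball_subset_ball (by linarith))))
  have h2 := abs_logPot_le (hBm.diff h.measurableSet) (q := q) (Set.sdiff_subset.trans
    (Metric.ball_subset_ball (by linarith)))
  have h3 := sqrt_area_le hσ ha1
  have h4 := sqrt_area_le hσ ha2
  have hLq : logPot (Metric.ball q 1) q = -(π / 2) := by
    rw [logPot_ball]; simp
  have e2 := h.logPot_sub_logPot_ball q q
  rw [hLq] at e2
  have hpi : π < 3.15 := pi_lt_d2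
  have h5 : π * σ ^ 2 ≤ 0.002 * σ := by nlinarith [mul_pos hσ hσ]
  have h6 : π * σ ≤ 3.15 * σ := by gcongr
  rw [show logPot A q + π / 2 = logPot (A \ Metric.ball q 1) q - logPot (Metric.ball q 1 \ A) q
    by linarith]
  refine (abs_sub _ _).trans ?_
  linarith

theorem abs_integral_logPot_le (h : NearVortex (σ ^ 24) Ω A u G) (hσ : 0 < σ)
    (hσ1 : σ ≤ 1 / 2000) : |(∫ x in A, logPot A x) + π ^ 2 / 4| ≤ 4000 * σ := by
  obtain ⟨q, hq, hmax⟩ := h.exists_max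
  have hsub := h.subset_ball hσ hσ1 hq hmax
  have hiu := h.integrableOn
  have hiL := integrableOn_logPot h.bdd h.measurableSet h.bdd h.measurableSet
  have hic : IntegrableOn (fun _ : ℂ => u q + 1 / (2 * π) * logPot A q) A :=
    integrableOn_const h.bdd.measure_lt_top.ne
  have hδ : σ ^ 24 ≤ σ := pow_le_of_le_one hσ.le (by linarith) (by norm_num)
  have h1 : |∫ x in A, (u x + 1 / (2 * π) * logPot A x - (u q + 1 / (2 * π) * logPot A q))| ≤
      2 * σ * volume.real A := by
    rw [← Real.norm_eq_abs]
    refine norm_setIntegral_le_of_norm_le_const h.bdd.measure_lt_top fun x hx => ?_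
    have h2 := h.abs_osc_le hq (Metric.ball_subset_ball (by linarith) (hsub hx))
    have h3 := hsub hx
    rw [Metric.mem_ball, dist_eq_norm] at h3
    rw [Real.norm_eq_abs]
    refine le_trans (le_of_eq ?_) (h2.trans ?_)
    · congr 1; ring
    · rw [mul_comm 2 σ]
      exact mul_le_mul hδ (by linarith) (norm_nonneg _) hσ.le
  have hiL2 : IntegrableOn (fun x => 1 / (2 * π) * logPot A x) A := hiL.const_mul _
  have hi2 : IntegrableOn (fun x => u x + 1 / (2 * π) * logPot A x) A := hiu.add hiL2
  rw [integral_sub hi2 hic, integral_add hiu hiL2, integral_const_mul, setIntegral_const, h.vol, smul_eq_mul] at h1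
  have h2 := h.abs_max_sub_le hσ hσ1 hq hmax
  have h3 := h.abs_logPot_max_le hσ hσ1 hq hmax
  have h4 := h.integral_le
  have h5 := h.energy
  have e : (∫ x in A, logPot A x) + π ^ 2 / 4 =
      2 * π * (((∫ x in A, u x) + 1 / (2 * π) * ∫ x in A, logPot A x) -
        π * (u q + 1 / (2 * π) * logPot A q)) - 2 * π * ((∫ x in A, u x) - π / 8)
      + 2 * π ^ 2 * (u q - 1 / 4) + π * (logPot A q + π / 2) := by
    field_simp
    ring
  have hpi : π < 3.15 := pi_lt_d2
  have hpi2 : π ^ 2 < 10 := by nlinarith [pi_pos]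
  have b1 : |2 * π * (((∫ x in A, u x) + 1 / (2 * π) * ∫ x in A, logPot A x) -
        π * (u q + 1 / (2 * π) * logPot A q))| ≤ 40 * σ := by
    rw [abs_mul, abs_of_pos (by positivity : 0 < 2 * π)]
    calc 2 * π * _ ≤ 2 * π * (2 * σ * π) := by gcongr
      _ = π ^ 2 * (4 * σ) := by ring
      _ ≤ 10 * (4 * σ) := by gcongr
      _ = 40 * σ := by ring
  have b2 : |2 * π * ((∫ x in A, u x) - π / 8)| ≤ 100 * σ := by
    have : |(∫ x in A, u x) - π / 8| ≤ 5 * π * σ := by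
      rw [abs_le]
      constructor <;> nlinarith [pi_pos]
    rw [abs_mul, abs_of_pos (by positivity : 0 < 2 * π)]
    calc 2 * π * _ ≤ 2 * π * (5 * π * σ) := by gcongr
      _ = π ^ 2 * (10 * σ) := by ring
      _ ≤ 10 * (10 * σ) := by gcongr
      _ = 100 * σ := by ring
  have b3 : |2 * π ^ 2 * (u q - 1 / 4)| ≤ 180 * σ := by
    rw [abs_mul, abs_of_pos (by positivity : 0 < 2 * π ^ 2)]
    calc 2 * π ^ 2 * _ ≤ 2 * 10 * (9 * σ) := by gcongr
      _ = 180 * σ := by ring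
  have b4 : |π * (logPot A q + π / 2)| ≤ 504 * σ := by
    rw [abs_mul, abs_of_pos pi_pos]
    calc π * _ ≤ 3.15 * (160 * σ) := by gcongr
      _ = 504 * σ := by ring
  rw [e, abs_le]
  rw [abs_le] at b1 b2 b3 b4
  constructor <;> linarith

theorem abs_diam_le (h : NearVortex (σ ^ 24) Ω A u G) (hσ : 0 < σ) (hσ1 : σ ≤ 1 / 2000) :
    |Metric.diam A / 2 - 1| ≤ 1000 * σ := by
  obtain ⟨q, hq, hmax⟩ := h.exists_max
  have h1 := Metric.diam_mono (h.subset_ball hσ hσ1 hq hmax) Metric.isBounded_ball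
  rw [Metric.diam_ball_eq _ (by linarith)] at h1
  have h3 := Metric.diam_mono (h.ball_sub_subset hσ hσ1 hq hmax) h.bdd
  rw [Metric.diam_ball_eq _ (by linarith)] at h3
  rw [abs_le]
  constructor <;> linarith

end NearVortex

end

section

/-- The profile of the Green function: `G_*(x,x') = x₁'√(x₁x₁') F(|x-x'|²/(x₁x₁'))`. -/
def ringF (ξ : ℝ) : ℝ :=
  1 / π * ∫ φ in (0)..(π / 2), (1 - 2 * sin φ ^ 2) / √(ξ + 4 * sin φ ^ 2)

/-- The logarithmic derivative `-ξF'(ξ)` of the profile. -/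
def ringK (ξ : ℝ) : ℝ :=
  1 / (2 * π) * ∫ φ in (0)..(π / 2), ξ * ((1 - 2 * sin φ ^ 2) / √(ξ + 4 * sin φ ^ 2) ^ 3)

section

variable {ξ : ℝ}

theorem ring_arg_pos (hξ : 0 < ξ) (φ : ℝ) : 0 < ξ + 4 * sin φ ^ 2 := by positivity

theorem continuous_ringF_integrand (hξ : 0 < ξ) :
    Continuous fun φ : ℝ => (1 - 2 * sin φ ^ 2) / √(ξ + 4 * sin φ ^ 2) :=
  Continuous.div (by fun_prop) (by fun_prop) fun φ => (Real.sqrt_pos.2 (ring_arg_pos hξ φ)).ne'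

theorem continuous_ringK_integrand (hξ : 0 < ξ) :
    Continuous fun φ : ℝ => ξ * ((1 - 2 * sin φ ^ 2) / √(ξ + 4 * sin φ ^ 2) ^ 3) :=
  continuous_const.mul (Continuous.div (by fun_prop) (by fun_prop)
    fun φ => pow_ne_zero _ (Real.sqrt_pos.2 (ring_arg_pos hξ φ)).ne')

theorem continuousOn_ringK : ContinuousOn ringK (Set.Ioi 0) := by
  rw [continuousOn_iff_continuous_domRestrict]
  have h := intervalIntegral.continuous_parametric_intervalIntegral_of_continuous' (μ := volume)
    (f := fun (ξ : Set.Ioi (0 : ℝ)) (φ : ℝ) =>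
      (ξ : ℝ) * ((1 - 2 * sin φ ^ 2) / √((ξ : ℝ) + 4 * sin φ ^ 2) ^ 3)) (by
      refine Continuous.mul (by fun_prop) (Continuous.div (by fun_prop) (by fun_prop) ?_)
      rintro ⟨⟨ξ, hξ⟩, φ⟩
      exact pow_ne_zero _ (Real.sqrt_pos.2 (ring_arg_pos hξ φ)).ne') 0 (π / 2)
  exact continuous_const.mul h

theorem measurable_ringK : Measurable ringK := by
  unfold ringK
  refine Measurable.const_mul ?_ _
  simp_rw [intervalIntegral.integral_of_le (by positivity : (0:ℝ) ≤ π / 2)]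
  refine (StronglyMeasurable.integral_prod_right' (ν := volume.restrict (Set.Ioc 0 (π / 2)))
    (f := fun p : ℝ × ℝ => p.1 * ((1 - 2 * sin p.2 ^ 2) / √(p.1 + 4 * sin p.2 ^ 2) ^ 3))
    (Measurable.stronglyMeasurable (by fun_prop))).measurable

theorem measurable_ringF : Measurable ringF := by
  unfold ringF
  refine Measurable.const_mul ?_ _
  simp_rw [intervalIntegral.integral_of_le (by positivity : (0:ℝ) ≤ π / 2)]
  refine (StronglyMeasurable.integral_prod_right' (ν := volume.restrict (Set.Ioc 0 (π / 2)))
    (f := fun p : ℝ × ℝ => (1 - 2 * sin p.2 ^ 2) / √(p.1 + 4 * sin p.2 ^ 2))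
    (Measurable.stronglyMeasurable (by fun_prop))).measurable

theorem hasDerivAt_ringF_integrand (hξ : 0 < ξ) (φ : ℝ) :
    HasDerivAt (fun ξ => (1 - 2 * sin φ ^ 2) / √(ξ + 4 * sin φ ^ 2))
      (-(1 / 2) * ((1 - 2 * sin φ ^ 2) / √(ξ + 4 * sin φ ^ 2) ^ 3)) ξ := by
  have hp := ring_arg_pos hξ φ
  have h1 : HasDerivAt (fun ξ => ξ + 4 * sin φ ^ 2) 1 ξ := (hasDerivAt_id ξ).add_const _
  have h2 := ((h1.sqrt hp.ne').inv (Real.sqrt_pos.2 hp).ne').const_mul (1 - 2 * sin φ ^ 2)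
  refine (h2.congr_deriv ?_)
  have := (Real.sqrt_pos.2 hp).ne'
  field_simp

theorem hasDerivAt_ringF (hξ : 0 < ξ) : HasDerivAt ringF (-ringK ξ / ξ) ξ := by
  have h := (intervalIntegral.hasDerivAt_integral_of_dominated_loc_of_deriv_le (μ := volume)
    (a := 0) (b := π / 2) (x₀ := ξ) (s := Set.Ioi (ξ / 2))
    (F := fun ξ φ => (1 - 2 * sin φ ^ 2) / √(ξ + 4 * sin φ ^ 2))
    (F' := fun ξ φ => -(1 / 2) * ((1 - 2 * sin φ ^ 2) / √(ξ + 4 * sin φ ^ 2) ^ 3))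
    (bound := fun _ => 1 / 2 * (1 / √(ξ / 2) ^ 3))
    (Ioi_mem_nhds (by linarith)) ?_ ?_ ?_ ?_ ?_ ?_).2
  · refine (h.const_mul (1 / π)).congr_deriv ?_
    rw [ringK, intervalIntegral.integral_const_mul, intervalIntegral.integral_const_mul]
    generalize (∫ φ in (0)..(π / 2), (1 - 2 * sin φ ^ 2) / √(ξ + 4 * sin φ ^ 2) ^ 3) = I
    field_simp
  · exact Eventually.of_forall fun x =>
      (Measurable.aestronglyMeasurable (by fun_prop))
  · exact (continuous_ringF_integrand hξ).intervalIntegrable _ _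
  · exact (Measurable.aestronglyMeasurable (by fun_prop))
  · refine ae_of_all _ fun φ _ x hx => ?_
    have hx : ξ / 2 < x := hx
    have h0 : 0 < √(ξ / 2) := Real.sqrt_pos.2 (by linarith)
    have h1 : √(ξ / 2) ≤ √(x + 4 * sin φ ^ 2) :=
      Real.sqrt_le_sqrt (by nlinarith [sq_nonneg (sin φ)])
    rw [norm_mul, norm_div, norm_pow]
    have h2 : ‖1 - 2 * sin φ ^ 2‖ ≤ 1 := by
      rw [Real.norm_eq_abs, abs_le]
      constructor <;> nlinarith [sq_nonneg (sin φ), sin_sq_le_one φ]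
    have h3 : ‖-(1 / 2 : ℝ)‖ = 1 / 2 := by norm_num
    rw [h3, Real.norm_of_nonneg (Real.sqrt_nonneg _)]
    gcongr
  · exact intervalIntegrable_const
  · exact ae_of_all _ fun φ _ x hx =>
      hasDerivAt_ringF_integrand (lt_trans (by linarith) (Set.mem_Ioi.1 hx)) φ

theorem integral_cos_div_sqrt (hξ : 0 < ξ) :
    ∫ φ in (0)..(π / 2), cos φ / √(ξ + 4 * sin φ ^ 2) = arsinh (2 / √ξ) / 2 := by
  have hs : 0 < √ξ := Real.sqrt_pos.2 hξ
  have hd : ∀ φ ∈ Set.uIcc 0 (π / 2), HasDerivAt (fun φ => arsinh (2 * sin φ / √ξ) / 2)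
      (cos φ / √(ξ + 4 * sin φ ^ 2)) φ := by
    intro φ _
    have h1 := ((((hasDerivAt_sin φ).const_mul 2).div_const √ξ).arsinh).div_const 2
    refine h1.congr_deriv ?_
    have h2 : √(1 + (2 * sin φ / √ξ) ^ 2) = √(ξ + 4 * sin φ ^ 2) / √ξ := by
      rw [← Real.sqrt_div (ring_arg_pos hξ φ).le]
      congr 1
      rw [div_pow, Real.sq_sqrt hξ.le]
      field_simp
      ring
    have h3 := Real.sqrt_pos.2 (ring_arg_pos hξ φ)
    rw [h2, smul_eq_mul]
    field_simp
  rw [intervalIntegral.integral_eq_sub_of_hasDerivAt hd]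
  · simp
  · exact (Continuous.div (by fun_prop) (by fun_prop)
      fun φ => (Real.sqrt_pos.2 (ring_arg_pos hξ φ)).ne').intervalIntegrable _ _

theorem integral_mul_cos_div_sqrt_pow (hξ : 0 < ξ) :
    ∫ φ in (0)..(π / 2), ξ * (cos φ / √(ξ + 4 * sin φ ^ 2) ^ 3) = 1 / √(ξ + 4) := by
  have hd : ∀ φ ∈ Set.uIcc 0 (π / 2), HasDerivAt (fun φ => sin φ / √(ξ + 4 * sin φ ^ 2))
      (ξ * (cos φ / √(ξ + 4 * sin φ ^ 2) ^ 3)) φ := by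
    intro φ _
    have hp := ring_arg_pos hξ φ
    have hs := Real.sqrt_pos.2 hp
    have h1 := (((hasDerivAt_sin φ).pow 2).const_mul 4).const_add ξ
    have h2 := (hasDerivAt_sin φ).div (h1.sqrt hp.ne') hs.ne'
    refine h2.congr_deriv ?_
    have h3 : √(ξ + 4 * sin φ ^ 2) ^ 2 = ξ + 4 * sin φ ^ 2 := Real.sq_sqrt hp.le
    simp only [Pi.pow_apply] at *
    generalize √(ξ + 4 * sin φ ^ 2) = R at *
    field_simp
    rw [h3]
    push_cast
    ring
  rw [intervalIntegral.integral_eq_sub_of_hasDerivAt hd]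
  · simp
  · exact (continuous_const.mul (Continuous.div (by fun_prop) (by fun_prop)
      fun φ => pow_ne_zero _ (Real.sqrt_pos.2 (ring_arg_pos hξ φ)).ne')).intervalIntegrable _ _

theorem cos_half_pos {φ : ℝ} (h : φ ∈ Set.Icc 0 (π / 2)) : 0 < cos (φ / 2) :=
  cos_pos_of_mem_Ioo ⟨by linarith [h.1, pi_pos], by linarith [h.2, pi_pos]⟩

theorem continuousOn_tan_half : ContinuousOn (fun φ : ℝ => tan (φ / 2) / 2 - sin φ)
    (Set.uIcc 0 (π / 2)) := by
  rw [Set.uIcc_of_le (by positivity)]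
  have h : ContinuousOn (fun φ : ℝ => Real.tan (φ / 2)) (Set.Icc 0 (π / 2)) := by
    refine ContinuousOn.comp (g := Real.tan) (f := fun φ : ℝ => φ / 2) (t := {x : ℝ | cos x ≠ 0}) Real.continuousOn_tan (by fun_prop) ?_
    exact fun φ hφ => (cos_half_pos hφ).ne'
  fun_prop

theorem integral_tan_half : ∫ φ in (0)..(π / 2), (tan (φ / 2) / 2 - sin φ) = log 2 / 2 - 1 := by
  have hd : ∀ φ ∈ Set.uIcc 0 (π / 2), HasDerivAt (fun φ => -log (cos (φ / 2)) + cos φ)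
      (tan (φ / 2) / 2 - sin φ) φ := by
    intro φ hφ
    rw [Set.uIcc_of_le (by positivity)] at hφ
    have hc := cos_half_pos hφ
    have h1 := ((((hasDerivAt_id φ).div_const 2).cos.log hc.ne').neg).add (hasDerivAt_cos φ)
    refine h1.congr_deriv ?_
    simp only [id, tan_eq_sin_div_cos]
    field_simp
    ring
  rw [intervalIntegral.integral_eq_sub_of_hasDerivAt hd continuousOn_tan_half.intervalIntegrable]
  rw [show π / 2 / 2 = π / 4 by ring, cos_pi_div_four, Real.log_div (by positivity) (by norm_num),
    Real.log_sqrt (by norm_num)]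
  simp
  ring

theorem one_sub_cos_sub_eq {φ : ℝ} (h : φ ∈ Set.Icc 0 (π / 2)) :
    1 - cos φ - 2 * sin φ ^ 2 = 2 * sin φ * (tan (φ / 2) / 2 - sin φ) := by
  have hc := cos_half_pos h
  rw [tan_eq_sin_div_cos]
  have h1 : sin φ = 2 * sin (φ / 2) * cos (φ / 2) := by rw [← sin_two_mul]; ring_nf
  have h2 : cos φ = 1 - 2 * sin (φ / 2) ^ 2 := by
    have h3 := cos_two_mul (φ / 2)
    rw [cos_sq'] at h3
    rw [show φ = 2 * (φ / 2) by ring, h3]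
    ring_nf
  rw [h1, h2]
  field_simp
  ring

theorem abs_one_sub_cos_sub_le {φ : ℝ} (h : φ ∈ Set.Icc 0 (π / 2)) :
    |1 - cos φ - 2 * sin φ ^ 2| ≤ 2 * sin φ ^ 2 := by
  have hc : 0 ≤ cos φ := cos_nonneg_of_mem_Icc ⟨by linarith [h.1, pi_pos], h.2⟩
  have h1 := sin_sq_add_cos_sq φ
  have h2 := cos_le_one φ
  rw [abs_le]
  constructor <;> nlinarith

theorem abs_ringF_sub_le (hξ : 0 < ξ) (hξ1 : ξ ≤ 1) :
    |ringF ξ - 1 / (4 * π) * (2 * log 8 - 4 - log ξ)| ≤ √ξ := by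
  have hs : 0 < √ξ := Real.sqrt_pos.2 hξ
  have hsq : √ξ ^ 2 = ξ := Real.sq_sqrt hξ.le
  have hi1 : IntervalIntegrable (fun φ => cos φ / √(ξ + 4 * sin φ ^ 2)) volume 0 (π / 2) :=
    (Continuous.div (by fun_prop) (by fun_prop)
      fun φ => (Real.sqrt_pos.2 (ring_arg_pos hξ φ)).ne').intervalIntegrable _ _
  have hi2 : IntervalIntegrable (fun φ : ℝ => tan (φ / 2) / 2 - sin φ) volume 0 (π / 2) :=
    continuousOn_tan_half.intervalIntegrable
  have hi3 := (continuous_ringF_integrand hξ).intervalIntegrable 0 (π / 2) (μ := volume)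
  have h1 : |(∫ φ in (0)..(π / 2), ((1 - 2 * sin φ ^ 2) / √(ξ + 4 * sin φ ^ 2) -
      cos φ / √(ξ + 4 * sin φ ^ 2) - (tan (φ / 2) / 2 - sin φ)))| ≤
      √ξ / 2 * |π / 2 - 0| := by
    rw [← Real.norm_eq_abs]
    refine intervalIntegral.norm_integral_le_of_norm_le_const fun φ hφ => ?_
    rw [Set.uIoc_of_le (by positivity)] at hφ
    have hφ' : φ ∈ Set.Icc 0 (π / 2) := ⟨hφ.1.le, hφ.2⟩
    have hsin : 0 < sin φ := sin_pos_of_pos_of_lt_pi hφ.1 (by linarith [hφ.2, pi_pos])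
    have hp := ring_arg_pos hξ φ
    have hR := Real.sqrt_pos.2 hp
    have h3 : √(ξ + 4 * sin φ ^ 2) ^ 2 = ξ + 4 * sin φ ^ 2 := Real.sq_sqrt hp.le
    have e := one_sub_cos_sub_eq hφ'
    have e2 := abs_one_sub_cos_sub_le hφ'
    rw [e, abs_mul, abs_of_pos (by positivity : 0 < 2 * sin φ)] at e2
    have e3 : |tan (φ / 2) / 2 - sin φ| ≤ sin φ := by
      have : 2 * sin φ * |tan (φ / 2) / 2 - sin φ| ≤ 2 * sin φ * sin φ := by linarith
      exact le_of_mul_le_mul_left this (by positivity)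
    set g := tan (φ / 2) / 2 - sin φ
    generalize √(ξ + 4 * sin φ ^ 2) = R at *
    have h4 : R ≤ √ξ + 2 * sin φ := by
      refine le_of_sq_le_sq ?_ (by positivity)
      nlinarith [mul_pos hs hsin]
    have h5 : 2 * sin φ ≤ R := le_of_sq_le_sq (by nlinarith) hR.le
    have h6 : (1 - 2 * sin φ ^ 2) / R - cos φ / R - g = -(g * ((R - 2 * sin φ) / R)) := by
      field_simp
      linarith
    rw [h6, norm_neg, norm_mul, Real.norm_eq_abs, Real.norm_of_nonneg
      (div_nonneg (by linarith) hR.le)]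
    calc |g| * ((R - 2 * sin φ) / R) ≤ sin φ * (√ξ / R) := by gcongr; linarith
      _ = √ξ * sin φ / R := by ring
      _ ≤ √ξ / 2 := by rw [div_le_div_iff₀ hR (by norm_num)]; nlinarith
  rw [intervalIntegral.integral_sub (hi3.sub hi1) hi2, intervalIntegral.integral_sub hi3 hi1,
    integral_tan_half, integral_cos_div_sqrt hξ, sub_zero, abs_of_pos (by positivity : 0 < π / 2)] at h1
  have h2 : arsinh (2 / √ξ) = log (2 + √(ξ + 4)) - log ξ / 2 := by
    rw [arsinh, ← Real.log_sqrt hξ.le, ← Real.log_div (by positivity) hs.ne']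
    congr 1
    rw [add_div, ← Real.sqrt_div (by positivity)]
    congr 2
    rw [div_pow, hsq]
    field_simp
    ring
  have h3 : √(ξ + 4) ≤ 2 + ξ / 4 := by
    rw [Real.sqrt_le_left (by positivity)]; nlinarith [sq_nonneg ξ]
  have h4 : 2 ≤ √(ξ + 4) := Real.le_sqrt_of_sq_le (by linarith)
  have h5 : log (2 + √(ξ + 4)) - log 4 ≤ ξ / 16 := by
    rw [← Real.log_div (by positivity) (by norm_num)]
    refine (Real.log_le_sub_one_of_pos (by positivity)).trans ?_
    linarith
  have h6 : log 4 ≤ log (2 + √(ξ + 4)) := Real.log_le_log (by norm_num) (by linarith)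
  have l4 : log 4 = 2 * log 2 := by
    rw [show (4 : ℝ) = 2 ^ 2 by norm_num, Real.log_pow]; push_cast; ring
  have l8 : log 8 = 3 * log 2 := by
    rw [show (8 : ℝ) = 2 ^ 3 by norm_num, Real.log_pow]; push_cast; ring
  have h7 : ξ ≤ √ξ := by nlinarith [Real.sqrt_le_one.2 hξ1]
  have hF : ringF ξ - 1 / (4 * π) * (2 * log 8 - 4 - log ξ) = 1 / π *
      ((∫ φ in (0)..(π / 2), (1 - 2 * sin φ ^ 2) / √(ξ + 4 * sin φ ^ 2)) -
        1 / 4 * (2 * log 8 - 4 - log ξ)) := by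
    rw [ringF]
    generalize (∫ φ in (0)..(π / 2), (1 - 2 * sin φ ^ 2) / √(ξ + 4 * sin φ ^ 2)) = I
    field_simp
  rw [hF, abs_mul, abs_of_pos (by positivity : 0 < 1 / π), div_mul_eq_mul_div, div_le_iff₀ pi_pos, one_mul]
  rw [abs_le] at h1 ⊢
  have hpi := pi_gt_three
  have : √ξ / 2 * (π / 2) = √ξ * π / 4 := by ring
  have : √ξ * 3 ≤ √ξ * π := by gcongr
  constructor <;> linarith

theorem abs_ringK_sub_le (hξ : 0 < ξ) (hξ1 : ξ ≤ 1) : |ringK ξ - 1 / (4 * π)| ≤ √ξ := by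
  have hs : 0 < √ξ := Real.sqrt_pos.2 hξ
  have hsq : √ξ ^ 2 = ξ := Real.sq_sqrt hξ.le
  have hi1 : IntervalIntegrable (fun φ => ξ * (cos φ / √(ξ + 4 * sin φ ^ 2) ^ 3)) volume
      0 (π / 2) := (continuous_const.mul (Continuous.div (by fun_prop) (by fun_prop)
      fun φ => pow_ne_zero _ (Real.sqrt_pos.2 (ring_arg_pos hξ φ)).ne')).intervalIntegrable _ _
  have hi3 := (continuous_ringK_integrand hξ).intervalIntegrable 0 (π / 2) (μ := volume)
  have h1 : |(∫ φ in (0)..(π / 2), (ξ * ((1 - 2 * sin φ ^ 2) / √(ξ + 4 * sin φ ^ 2) ^ 3) -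
      ξ * (cos φ / √(ξ + 4 * sin φ ^ 2) ^ 3)))| ≤ √ξ / 2 * |π / 2 - 0| := by
    rw [← Real.norm_eq_abs]
    refine intervalIntegral.norm_integral_le_of_norm_le_const fun φ hφ => ?_
    rw [Set.uIoc_of_le (by positivity)] at hφ
    have e2 := abs_one_sub_cos_sub_le (φ := φ) ⟨hφ.1.le, hφ.2⟩
    have hp := ring_arg_pos hξ φ
    have hR := Real.sqrt_pos.2 hp
    have h3 : √(ξ + 4 * sin φ ^ 2) ^ 2 = ξ + 4 * sin φ ^ 2 := Real.sq_sqrt hp.le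
    have h4 : √ξ ≤ √(ξ + 4 * sin φ ^ 2) := Real.sqrt_le_sqrt (by nlinarith [sq_nonneg (sin φ)])
    generalize √(ξ + 4 * sin φ ^ 2) = R at *
    have h6 : ξ * ((1 - 2 * sin φ ^ 2) / R ^ 3) - ξ * (cos φ / R ^ 3) =
        ξ * (1 - cos φ - 2 * sin φ ^ 2) / R ^ 3 := by
      field_simp
      ring
    rw [h6, Real.norm_eq_abs, abs_div, abs_mul, abs_of_pos hξ, abs_of_pos (by positivity : 0 < R ^ 3),
      div_le_div_iff₀ (by positivity) (by norm_num)]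
    calc ξ * |1 - cos φ - 2 * sin φ ^ 2| * 2 ≤ ξ * (2 * sin φ ^ 2) * 2 := by gcongr
      _ ≤ ξ * R ^ 2 := by nlinarith
      _ = √ξ * √ξ * R ^ 2 := by rw [← pow_two, hsq]
      _ ≤ √ξ * R * R ^ 2 := by gcongr
      _ = √ξ * R ^ 3 := by ring
  rw [intervalIntegral.integral_sub hi3 hi1, integral_mul_cos_div_sqrt_pow hξ, sub_zero,
    abs_of_pos (by positivity : 0 < π / 2)] at h1
  have h4 : 2 ≤ √(ξ + 4) := Real.le_sqrt_of_sq_le (by linarith)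
  have h5 : √(ξ + 4) ^ 2 = ξ + 4 := Real.sq_sqrt (by linarith)
  have h7 : ξ ≤ √ξ := by nlinarith [Real.sqrt_le_one.2 hξ1]
  have h8 : 1 / √(ξ + 4) ≤ 1 / 2 := by gcongr
  have h9 : 1 / 2 - ξ / 16 ≤ 1 / √(ξ + 4) := by
    rw [le_div_iff₀ (by positivity)]
    generalize √(ξ + 4) = R at *
    have : ξ = R ^ 2 - 4 := by linarith
    rw [this]
    nlinarith [mul_nonneg (sub_nonneg.2 h4) (sub_nonneg.2 h4)]
  rw [ringK, show 1 / (4 * π) = 1 / (2 * π) * (1 / 2) by ring, ← mul_sub, abs_mul,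
    abs_of_pos (by positivity : 0 < 1 / (2 * π)), div_mul_eq_mul_div, div_le_iff₀ (by positivity), one_mul]
  have hpi := pi_gt_three
  have : √ξ / 2 * (π / 2) = √ξ * π / 4 := by ring
  have : √ξ * 3 ≤ √ξ * π := by gcongr
  rw [abs_le] at h1 ⊢
  constructor <;> linarith

end

end

section

/-- The dimensionless squared distance of two points of the half plane. -/
def ringArg (x y : ℂ) : ℝ := ‖x - y‖ ^ 2 / (x.re * y.re)

def ringAmp (x y : ℂ) : ℝ := y.re * √(x.re * y.re)

/-- The Green function of the axisymmetric Stokes operator. -/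
def ringKer (x y : ℂ) : ℝ := ringAmp x y * ringF (ringArg x y)

/-- The part of the gradient of `ringKer` that comes from the profile. -/
def ringSing (x y : ℂ) : ℂ :=
  (ringK (ringArg x y) * ringAmp x y) • ((2 : ℝ) • logGrad x y - (1 / x.re : ℝ) • (1 : ℂ))

/-- The gradient of `ringKer` in the first variable. -/
def ringGrad (x y : ℂ) : ℂ := (ringKer x y / (2 * x.re)) • (1 : ℂ) - ringSing x y

theorem measurable_ringArg : Measurable (Function.uncurry ringArg) := by
  unfold ringArg Function.uncurry
  fun_prop

theorem measurable_ringAmp : Measurable (Function.uncurry ringAmp) := by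
  unfold ringAmp Function.uncurry
  fun_prop

theorem measurable_ringKer : Measurable (Function.uncurry ringKer) :=
  measurable_ringAmp.mul (measurable_ringF.comp measurable_ringArg)

theorem measurable_ringSing : Measurable (Function.uncurry ringSing) := by
  have h1 : Measurable fun p : ℂ × ℂ => (2 : ℝ) • logGrad p.1 p.2 :=
    measurable_logGrad.const_smul (2 : ℝ)
  have h2 : Measurable fun p : ℂ × ℂ => (1 / p.1.re : ℝ) • (1 : ℂ) := by fun_prop
  exact ((measurable_ringK.comp measurable_ringArg).mul measurable_ringAmp).smul (h1.sub h2)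

theorem measurable_ringGrad : Measurable (Function.uncurry ringGrad) := by
  have h1 : Measurable fun p : ℂ × ℂ => (ringKer p.1 p.2 / (2 * p.1.re)) • (1 : ℂ) := by
    have : Measurable fun p : ℂ × ℂ => ringKer p.1 p.2 := measurable_ringKer
    fun_prop
  exact h1.sub measurable_ringSing

section

variable {x y : ℂ}

theorem ringArg_pos (hx : 0 < x.re) (hy : 0 < y.re) (hne : x ≠ y) : 0 < ringArg x y := by
  have : 0 < ‖x - y‖ := norm_pos_iff.2 (sub_ne_zero.2 hne)
  unfold ringArg
  positivity

theorem continuousAt_ringGrad (hx : 0 < x.re) (hy : 0 < y.re) (hne : x ≠ y) :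
    ContinuousAt (fun x => ringGrad x y) x := by
  have hr : ‖x - y‖ ^ 2 ≠ 0 := pow_ne_zero _ (norm_ne_zero_iff.2 (sub_ne_zero.2 hne))
  have h1 : ContinuousAt (fun x => ringArg x y) x := by
    unfold ringArg
    have : x.re * y.re ≠ 0 := by positivity
    fun_prop (disch := assumption)
  have hpos := ringArg_pos hx hy hne
  have h2 : ContinuousAt (fun x => ringAmp x y) x := by
    unfold ringAmp
    fun_prop
  have h3 : ContinuousAt (fun x => ringF (ringArg x y)) x :=
    ContinuousAt.comp (f := fun x => ringArg x y) (hasDerivAt_ringF hpos).continuousAt h1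
  have h4 : ContinuousAt (fun x => ringK (ringArg x y)) x :=
    ContinuousAt.comp (f := fun x => ringArg x y)
      (continuousOn_ringK.continuousAt (Ioi_mem_nhds hpos)) h1
  have h5 : ContinuousAt (fun x => logGrad x y) x := by
    unfold logGrad
    fun_prop (disch := assumption)
  have hx0 : x.re ≠ 0 := hx.ne'
  have hx2 : 2 * x.re ≠ 0 := by positivity
  unfold ringGrad ringKer ringSing
  fun_prop (disch := assumption)

theorem hasLineDerivAt_ringKer (hx : 0 < x.re) (hy : 0 < y.re) (hne : x ≠ y) (e : ℂ) :
    HasLineDerivAt ℝ (fun x => ringKer x y) ⟪ringGrad x y, e⟫ x e := by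
  have hr : 0 < ‖x - y‖ ^ 2 := pow_pos (norm_pos_iff.2 (sub_ne_zero.2 hne)) 2
  have hpos := ringArg_pos hx hy hne
  have ha : HasDerivAt (fun s : ℝ => (x + s • e).re) e.re 0 := by
    simpa using ((hasDerivAt_id (0 : ℝ)).mul_const e.re).const_add x.re
  have hb : HasDerivAt (fun s : ℝ => (x + s • e).im) e.im 0 := by
    simpa using ((hasDerivAt_id (0 : ℝ)).mul_const e.im).const_add x.im
  have hN : HasDerivAt (fun s : ℝ => ‖x + s • e - y‖ ^ 2) (2 * ⟪x - y, e⟫) 0 := by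
    have h1 := ((ha.sub_const y.re).pow 2).add ((hb.sub_const y.im).pow 2)
    have h2 : (fun s : ℝ => ‖x + s • e - y‖ ^ 2) =
        (fun s : ℝ => (x + s • e).re - y.re) ^ 2 + (fun s : ℝ => (x + s • e).im - y.im) ^ 2 := by
      funext s
      rw [Complex.sq_norm, Complex.normSq_apply]
      simp only [Complex.sub_re, Complex.sub_im, Pi.add_apply, Pi.pow_apply]
      ring
    rw [h2]
    refine h1.congr_deriv ?_
    rw [Complex.inner]
    simp
    ring
  have hab : (x + (0 : ℝ) • e).re * y.re ≠ 0 := by simp [hx.ne', hy.ne']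
  have harg := hN.div (ha.mul_const y.re) hab
  have hamp := ((ha.mul_const y.re).sqrt hab).const_mul y.re
  have hF : HasDerivAt ringF (-ringK (ringArg x y) / ringArg x y)
      (‖x + (0 : ℝ) • e - y‖ ^ 2 / ((x + (0 : ℝ) • e).re * y.re)) := by
    have := hasDerivAt_ringF hpos
    simpa [ringArg] using this
  have hcomp := HasDerivAt.comp (0 : ℝ) (h := fun s : ℝ =>
    ‖x + s • e - y‖ ^ 2 / ((x + s • e).re * y.re)) hF harg
  refine (hamp.mul hcomp).congr_deriv ?_
  have hi : ⟪ringGrad x y, e⟫ = ringKer x y / (2 * x.re) * e.re -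
      ringK (ringArg x y) * ringAmp x y * (2 * ((‖x - y‖ ^ 2)⁻¹ * ⟪x - y, e⟫) - 1 / x.re * e.re) := by
    have h1 : ⟪(1 : ℂ), e⟫ = e.re := by rw [Complex.inner]; simp
    rw [ringGrad, ringSing, logGrad, inner_sub_left, real_inner_smul_left, real_inner_smul_left,
      inner_sub_left, real_inner_smul_left, real_inner_smul_left, real_inner_smul_left, h1]
  rw [hi]
  simp only [zero_smul, add_zero, Function.comp_apply]
  have hs : √(x.re * y.re) ^ 2 = x.re * y.re := Real.sq_sqrt (by positivity)
  have hs0 : 0 < √(x.re * y.re) := Real.sqrt_pos.2 (by positivity)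
  have hdef : ‖x - y‖ ^ 2 / (x.re * y.re) = ringArg x y := rfl
  have hinv : (‖x - y‖ ^ 2)⁻¹ = (ringArg x y * (x.re * y.re))⁻¹ := by
    rw [← hdef]; field_simp
  have hN2 : ‖x - y‖ ^ 2 = ringArg x y * (x.re * y.re) := by
    rw [← hdef]; field_simp
  unfold ringKer ringAmp
  rw [hinv, hdef, hN2]
  generalize ⟪x - y, e⟫ = I
  generalize ringF (ringArg x y) = F
  generalize ringK (ringArg x y) = K
  generalize ringArg x y = ξ at *
  generalize √(x.re * y.re) = S at *
  have hsx : y.re = S ^ 2 / x.re := by rw [hs]; field_simp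
  rw [hsx]
  field_simp
  ring

end

end

section

/-- Two distinct points that are close to `p` compared with the distance of `p` from the axis. -/
structure RingPair (d : ℝ) (p x y : ℂ) : Prop where
  d_pos : 0 < d
  d_le : d ≤ 1 / 100
  large : 5 ≤ d * p.re
  left : ‖x - p‖ ≤ 2 * d * p.re
  right : ‖y - p‖ ≤ d * p.re
  ne : x ≠ y

namespace RingPair

variable {d : ℝ} {p x y : ℂ}

theorem le_re (h : RingPair d p x y) : 500 ≤ p.re := by
  have h1 := h.large
  have h2 := h.d_le
  have h3 := h.d_pos
  have h4 : 0 < p.re := by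
    by_contra hc
    nlinarith
  nlinarith

theorem left_re (h : RingPair d p x y) :
    (1 - 2 * d) * p.re ≤ x.re ∧ x.re ≤ (1 + 2 * d) * p.re := by
  have h1 := (Complex.abs_re_le_norm (x - p)).trans h.left
  rw [Complex.sub_re, abs_le] at h1
  constructor <;> linarith

theorem right_re (h : RingPair d p x y) :
    (1 - d) * p.re ≤ y.re ∧ y.re ≤ (1 + d) * p.re := by
  have h1 := (Complex.abs_re_le_norm (y - p)).trans h.right
  rw [Complex.sub_re, abs_le] at h1
  constructor <;> linarith

theorem left_pos (h : RingPair d p x y) : 0 < x.re := by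
  have := h.left_re.1
  have := h.le_re
  have := h.d_le
  nlinarith

theorem right_pos (h : RingPair d p x y) : 0 < y.re := by
  have := h.right_re.1
  have := h.le_re
  have := h.d_le
  nlinarith

theorem norm_pos (h : RingPair d p x y) : 0 < ‖x - y‖ := norm_pos_iff.2 (sub_ne_zero.2 h.ne)

theorem norm_le (h : RingPair d p x y) : ‖x - y‖ ≤ 3 * d * p.re := by
  have h1 : ‖x - y‖ ≤ ‖x - p‖ + ‖y - p‖ := by
    rw [norm_sub_rev y p]
    simpa using norm_add_le (x - p) (p - y)
  linarith [h.left, h.right]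

theorem mul_bounds (h : RingPair d p x y) : (1 - 2 * d) ^ 2 * p.re ^ 2 ≤ x.re * y.re ∧
    x.re * y.re ≤ (1 + 2 * d) ^ 2 * p.re ^ 2 := by
  have h1 := h.left_re
  have h2 := h.right_re
  have h3 := h.le_re
  have h4 := h.d_le
  have h5 := h.d_pos
  have h6 : (1 - 2 * d) * p.re ≤ y.re := by nlinarith
  have h7 : y.re ≤ (1 + 2 * d) * p.re := by nlinarith
  have h8 : 0 ≤ (1 - 2 * d) * p.re := by nlinarith
  constructor
  · calc _ = ((1 - 2 * d) * p.re) * ((1 - 2 * d) * p.re) := by ring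
      _ ≤ _ := mul_le_mul h1.1 h6 h8 h.left_pos.le
  · calc _ ≤ ((1 + 2 * d) * p.re) * ((1 + 2 * d) * p.re) :=
        mul_le_mul h1.2 h7 h.right_pos.le (by nlinarith)
      _ = _ := by ring

theorem sqrt_bounds (h : RingPair d p x y) : (1 - 2 * d) * p.re ≤ √(x.re * y.re) ∧
    √(x.re * y.re) ≤ (1 + 2 * d) * p.re := by
  have h3 := h.le_re
  have h4 := h.d_le
  have h5 := h.d_pos
  constructor
  · have h6 : ((1 - 2 * d) * p.re) ^ 2 ≤ x.re * y.re := by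
      rw [mul_pow]; exact h.mul_bounds.1
    exact Real.le_sqrt_of_sq_le h6
  · rw [Real.sqrt_le_left (by nlinarith), mul_pow]
    exact h.mul_bounds.2

theorem arg_pos (h : RingPair d p x y) : 0 < ringArg x y :=
  ringArg_pos h.left_pos h.right_pos h.ne

theorem arg_le (h : RingPair d p x y) : ringArg x y ≤ (4 * d) ^ 2 := by
  have h1 := h.left_pos
  have h2 := h.right_pos
  rw [ringArg, div_le_iff₀ (by positivity)]
  have h3 : ‖x - y‖ ^ 2 ≤ (3 * d * p.re) ^ 2 := by gcongr; exact h.norm_le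
  have h4 : (16 * d ^ 2) * ((1 - 2 * d) ^ 2 * p.re ^ 2) ≤ (16 * d ^ 2) * (x.re * y.re) :=
    mul_le_mul_of_nonneg_left h.mul_bounds.1 (by positivity)
  have h5 : 9 ≤ 16 * (1 - 2 * d) ^ 2 := by nlinarith [h.d_le, h.d_pos]
  have h6 : 0 ≤ (d * p.re) ^ 2 := sq_nonneg _
  nlinarith

theorem sqrt_arg_le (h : RingPair d p x y) : √(ringArg x y) ≤ 4 * d := by
  rw [Real.sqrt_le_left (by linarith [h.d_pos])]
  exact h.arg_le

theorem arg_le_one (h : RingPair d p x y) : ringArg x y ≤ 1 :=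
  h.arg_le.trans (by nlinarith [h.d_le, h.d_pos])

theorem abs_ringK_le (h : RingPair d p x y) : |ringK (ringArg x y) - 1 / (4 * π)| ≤ 4 * d :=
  (abs_ringK_sub_le h.arg_pos h.arg_le_one).trans h.sqrt_arg_le

theorem amp_bounds (h : RingPair d p x y) : (1 - 5 * d) * p.re ^ 2 ≤ ringAmp x y ∧
    ringAmp x y ≤ (1 + 5 * d) * p.re ^ 2 := by
  have h1 := h.sqrt_bounds
  have h2 := h.right_re
  have h3 := h.le_re
  have h4 := h.d_le
  have h5 := h.d_pos
  have h6 : 0 ≤ (1 - 2 * d) * p.re := by nlinarith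
  have h7 := h.right_pos
  rw [ringAmp]
  constructor
  · calc _ ≤ ((1 - d) * p.re) * ((1 - 2 * d) * p.re) := by nlinarith [sq_nonneg p.re, sq_nonneg (d * p.re)]
      _ ≤ _ := mul_le_mul h2.1 h1.1 h6 h7.le
  · calc _ ≤ ((1 + d) * p.re) * ((1 + 2 * d) * p.re) :=
        mul_le_mul h2.2 h1.2 (Real.sqrt_nonneg _) (by nlinarith)
      _ ≤ _ := by nlinarith [mul_nonneg (mul_nonneg h5.le (sub_nonneg.2 h4)) (sq_nonneg p.re)]

theorem log_arg (h : RingPair d p x y) :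
    log (ringArg x y) = 2 * log ‖x - y‖ - log (x.re * y.re) := by
  rw [ringArg, Real.log_div (pow_pos h.norm_pos 2).ne' (mul_pos h.left_pos h.right_pos).ne',
    Real.log_pow]
  push_cast; ring

theorem abs_log_mul_le (h : RingPair d p x y) :
    |log (x.re * y.re) - 2 * log p.re| ≤ 5 * d := by
  have h3 := h.le_re
  have h4 := h.d_le
  have h5 := h.d_pos
  have h6 : 2 * log p.re = log (p.re ^ 2) := by rw [Real.log_pow]; push_cast; ring
  have hp : 0 < x.re * y.re := mul_pos h.left_pos h.right_pos
  have hP : 0 < p.re := by linarith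
  rw [h6, ← Real.log_div hp.ne' (by positivity), abs_le]
  have h7 : x.re * y.re / p.re ^ 2 ≤ (1 + 2 * d) ^ 2 := by
    rw [div_le_iff₀ (by positivity)]; exact h.mul_bounds.2
  have h8 : (1 - 2 * d) ^ 2 ≤ x.re * y.re / p.re ^ 2 := by
    rw [le_div_iff₀ (by positivity)]; exact h.mul_bounds.1
  constructor
  · have h9 := Real.one_sub_inv_le_log_of_pos (div_pos hp (pow_pos hP 2))
    have h10 : (x.re * y.re / p.re ^ 2)⁻¹ ≤ 1 + 5 * d := by
      rw [inv_le_iff_one_le_mul₀ (by positivity)]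
      calc 1 ≤ (1 + 5 * d) * (1 - 2 * d) ^ 2 := by nlinarith [mul_pos h5 h5]
        _ ≤ _ := by gcongr
    linarith
  · have h9 := Real.log_le_sub_one_of_pos (div_pos hp (pow_pos hP 2))
    nlinarith

theorem log_eight_bounds : 2 < log 8 ∧ log 8 < 2.1 := by
  have l8 : log 8 = 3 * log 2 := by
    rw [show (8 : ℝ) = 2 ^ 3 by norm_num, Real.log_pow]; push_cast; ring
  have := Real.log_two_gt_d9
  have := Real.log_two_lt_d9
  constructor <;> linarith

theorem log_re_nonneg (h : RingPair d p x y) : 0 ≤ log p.re :=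
  Real.log_nonneg (by linarith [h.le_re])

theorem abs_log_norm_le (h : RingPair d p x y) : |log ‖x - y‖| ≤ ‖x - y‖⁻¹ + log p.re := by
  have hr := h.norm_pos
  have h3 := h.le_re
  have h1 := Real.one_sub_inv_le_log_of_pos hr
  have h2 : log ‖x - y‖ ≤ log p.re :=
    Real.log_le_log hr (h.norm_le.trans (by nlinarith [h.d_le, h.d_pos]))
  have h4 := h.log_re_nonneg
  have h5 := inv_pos.2 hr
  rw [abs_le]
  constructor <;> linarith

theorem abs_ringF_le (h : RingPair d p x y) :
    |ringF (ringArg x y)| ≤ (1 + log p.re) / 2 + ‖x - y‖⁻¹ := by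
  have h1 := (abs_ringF_sub_le h.arg_pos h.arg_le_one).trans h.sqrt_arg_le
  have h2 := h.abs_log_norm_le
  have h3 := h.abs_log_mul_le
  have h4 := log_eight_bounds
  have h5 := h.log_re_nonneg
  have h6 := h.d_le
  have hpi : 1 / (4 * π) ≤ 1 / 12 := by
    have := pi_gt_three
    gcongr; linarith
  have h8 := inv_pos.2 h.norm_pos
  have h7 : |1 / (4 * π) * (2 * log 8 - 4 - log (ringArg x y))| ≤
      1 / 12 * (0.25 + 4 * log p.re + 2 * ‖x - y‖⁻¹) := by
    rw [abs_mul, abs_of_pos (by positivity : 0 < 1 / (4 * π)), h.log_arg]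
    gcongr
    rw [abs_le] at *
    constructor <;> linarith
  rw [abs_le] at *
  constructor <;> linarith

theorem abs_ringKer_le (h : RingPair d p x y) :
    |ringKer x y| ≤ p.re ^ 2 * ((1 + log p.re) + 2 * ‖x - y‖⁻¹) := by
  have h1 := h.abs_ringF_le
  have h2 := h.amp_bounds
  have h3 := h.le_re
  have h4 := h.d_le
  have h5 := inv_pos.2 h.norm_pos
  have h6 := h.log_re_nonneg
  have h7 : 0 ≤ ringAmp x y := mul_nonneg h.right_pos.le (Real.sqrt_nonneg _)
  rw [ringKer, abs_mul, abs_of_nonneg h7]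
  calc ringAmp x y * |ringF (ringArg x y)| ≤ (2 * p.re ^ 2) * ((1 + log p.re) / 2 + ‖x - y‖⁻¹) := by
        gcongr; nlinarith [sq_nonneg p.re]
    _ = _ := by ring

theorem abs_ringK_mul_amp_le (h : RingPair d p x y) :
    |ringK (ringArg x y) * ringAmp x y - 1 / (4 * π) * p.re ^ 2| ≤ 5 * d * p.re ^ 2 := by
  have h1 := h.abs_ringK_le
  have h2 := h.amp_bounds
  have h4 := h.d_le
  have h5 := h.d_pos
  have hpi : 1 / (4 * π) ≤ 1 / 12 := by
    have := pi_gt_three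
    gcongr; linarith
  have hpi0 : 0 < 1 / (4 * π) := by positivity
  have h7 : |ringAmp x y - p.re ^ 2| ≤ 5 * d * p.re ^ 2 := by
    rw [abs_le]; constructor <;> linarith
  have h8 : 0 ≤ ringAmp x y := mul_nonneg h.right_pos.le (Real.sqrt_nonneg _)
  rw [show ringK (ringArg x y) * ringAmp x y - 1 / (4 * π) * p.re ^ 2 =
    (ringK (ringArg x y) - 1 / (4 * π)) * ringAmp x y + 1 / (4 * π) * (ringAmp x y - p.re ^ 2)
    by ring]
  refine (abs_add_le _ _).trans ?_
  rw [abs_mul, abs_mul, abs_of_nonneg h8, abs_of_pos hpi0]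
  calc _ ≤ 4 * d * ((1 + 5 * d) * p.re ^ 2) + 1 / 12 * (5 * d * p.re ^ 2) := by
        gcongr; exact h2.2
    _ ≤ _ := by nlinarith [mul_nonneg (mul_nonneg h5.le (sub_nonneg.2 h4)) (sq_nonneg p.re),
                  mul_nonneg h5.le (sq_nonneg p.re)]

theorem norm_ringSing_sub_le (h : RingPair d p x y) :
    ‖ringSing x y - (p.re ^ 2 / (2 * π)) • logGrad x y‖ ≤
      p.re ^ 2 * (10 * d * ‖x - y‖⁻¹) + p.re := by
  have h1 := h.abs_ringK_mul_amp_le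
  have h3 := h.le_re
  have h4 := h.d_le
  have h5 := h.d_pos
  have h6 := h.left_re.1
  have h7 := h.left_pos
  have hpi : 1 / (4 * π) ≤ 1 / 12 := by
    have := pi_gt_three
    gcongr; linarith
  rw [ringSing]
  set c := ringK (ringArg x y) * ringAmp x y
  have h8 : c • ((2 : ℝ) • logGrad x y - (1 / x.re) • (1 : ℂ)) -
      (p.re ^ 2 / (2 * π)) • logGrad x y =
      (2 * (c - 1 / (4 * π) * p.re ^ 2)) • logGrad x y - (c / x.re) • (1 : ℂ) := by
    rw [smul_sub, smul_smul, smul_smul, sub_right_comm, ← sub_smul]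
    congr 2 <;> field_simp
    ring
  rw [h8]
  refine (norm_sub_le _ _).trans ?_
  rw [norm_smul, norm_smul, norm_one, mul_one, norm_logGrad, Real.norm_eq_abs, Real.norm_eq_abs,
    abs_mul, abs_div, abs_of_pos h7, abs_two]
  have h9 : |c| ≤ 0.2 * p.re ^ 2 := by
    rw [abs_le] at h1 ⊢
    constructor <;> nlinarith [sq_nonneg p.re, mul_nonneg (sub_nonneg.2 h4) (sq_nonneg p.re),
      mul_nonneg (sub_nonneg.2 hpi) (sq_nonneg p.re), (by positivity : 0 < 1 / (4 * π) * p.re ^ 2)]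
  refine add_le_add ?_ ?_
  · calc _ ≤ 2 * (5 * d * p.re ^ 2) * ‖x - y‖⁻¹ := by gcongr
      _ = _ := by ring
  · rw [div_le_iff₀ h7]
    nlinarith

end RingPair

end

section

theorem tendsto_softPos {r : ℝ} (hr : 0 < r) :
    Tendsto (fun n : ℕ => softPos (n + 1 : ℝ) (1 / (n + 1 : ℝ)) r) atTop (nhds r) := by
  have h0 : Tendsto (fun n : ℕ => 1 / ((n : ℝ) + 1)) atTop (nhds 0) :=
    tendsto_one_div_add_atTop_nhds_zero_nat
  have h1 : Tendsto (fun n : ℕ => r - 1 / ((n : ℝ) + 1) - 1 / ((n : ℝ) + 1)) atTop (nhds r) := by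
    simpa using (h0.const_sub r).sub h0
  refine tendsto_of_tendsto_of_tendsto_of_le_of_le h1 tendsto_const_nhds
    (fun n => le_softPos (by positivity) r) fun n => ?_
  refine (softPos_le (by positivity) r).trans (max_le ?_ hr.le)
  have : 0 < 1 / ((n : ℝ) + 1) := by positivity
  linarith

theorem tendsto_ramp {r : ℝ} (hr : 0 < r) :
    Tendsto (fun n : ℕ => ramp (n + 1 : ℝ) (1 / (n + 1 : ℝ)) r) atTop (nhds 1) := by
  have h0 : Tendsto (fun n : ℕ => 1 / ((n : ℝ) + 1)) atTop (nhds 0) :=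
    tendsto_one_div_add_atTop_nhds_zero_nat
  have h1 : Tendsto (fun n : ℕ => 1 / ((n : ℝ) + 1) + 1 / ((n : ℝ) + 1)) atTop (nhds 0) := by
    simpa using h0.add h0
  refine tendsto_const_nhds.congr' ?_
  filter_upwards [h1.eventually_lt_const hr] with n hn
  exact (ramp_of_ge (by positivity) hn.le).symm

namespace PosDomain

variable {Ω A : Set ℂ} {u : ℂ → ℝ} {G : ℂ → ℂ}

theorem integrableOn_of_continuousOn {E : Type*} [NormedAddCommGroup E] (h : PosDomain Ω A u G)
    {F : ℂ → E} (hF : ContinuousOn F Ω) : IntegrableOn F A :=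
  ((hF.mono h.closure_subset).integrableOn_compact h.isCompact_closure).mono_set subset_closure

/-- Integration by parts on a positivity domain. -/
theorem integral_mul_deriv (h : PosDomain Ω A u G) {T T' : ℂ → ℝ} {e : ℂ}
    (hT : ContinuousOn T Ω) (hT' : ContinuousOn T' Ω)
    (hd : ∀ x ∈ A, HasLineDerivAt ℝ T (T' x) x e) :
    ∫ x in A, u x * T' x = -∫ x in A, ⟪G x, e⟫ * T x := by
  have hA : A ⊆ Ω := subset_closure.trans h.closure_subset
  have hGe : ContinuousOn (fun x => ⟪G x, e⟫) Ω := h.contG.inner continuousOn_const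
  have happ : ∀ n : ℕ, ∫ x in A, softPos (n + 1 : ℝ) (1 / (n + 1 : ℝ)) (u x) * T' x =
      -∫ x in A, ramp (n + 1 : ℝ) (1 / (n + 1 : ℝ)) (u x) * (⟪G x, e⟫ * T x) := by
    intro n
    have hk : (0 : ℝ) < n + 1 := by positivity
    have ht : (0 : ℝ) < 1 / (n + 1) := by positivity
    have hsub : A ∩ {x | 1 / ((n : ℝ) + 1) ≤ u x} ⊆ A := Set.inter_subset_left
    have h1 := (h.testFun hk ht).integral_mul_deriv (h.isCompact_superlevel ht)
      (h.tsupport_indicator_subset ht fun x hx => softPos_of_le hk hx)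
      (support_indicator_subset fun x hx => by rw [ramp_of_le hk hx, zero_smul])
      (hT.mono (hsub.trans hA)) (hT'.mono (hsub.trans hA)) (fun x hx => hd x (hsub hx))
    rw [← integral_indicator h.measurableSet, ← integral_indicator h.measurableSet]
    refine Eq.trans ?_ (h1.trans (congrArg Neg.neg ?_))
    · refine integral_congr_ae (ae_of_all _ fun x => ?_)
      by_cases hx : x ∈ A <;> simp [hx]
    · refine integral_congr_ae (ae_of_all _ fun x => ?_)
      by_cases hx : x ∈ A
      · simp only [Set.indicator_of_mem hx]
        rw [real_inner_smul_left, mul_assoc]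
      · simp [hx]
  have hl : Tendsto (fun n : ℕ => ∫ x in A, softPos (n + 1 : ℝ) (1 / (n + 1 : ℝ)) (u x) * T' x)
      atTop (nhds (∫ x in A, u x * T' x)) := by
    refine tendsto_integral_of_dominated_convergence (fun x => ‖u x * T' x‖) (fun n => ?_)
      (h.integrableOn_of_continuousOn (h.cont.mul hT')).norm (fun n => ?_) ?_
    · exact (h.integrableOn_of_continuousOn
        (((continuous_softPos _ _).comp_continuousOn h.cont).mul hT')).aestronglyMeasurable
    · filter_upwards [ae_restrict_mem h.measurableSet] with x hx
      have hu := h.pos x hx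
      rw [norm_mul, norm_mul]
      gcongr
      rw [Real.norm_of_nonneg (softPos_nonneg (by positivity) _), Real.norm_of_nonneg hu.le]
      refine (softPos_le (by positivity) _).trans (max_le ?_ hu.le)
      have : 0 < 1 / ((n : ℝ) + 1) := by positivity
      linarith
    · filter_upwards [ae_restrict_mem h.measurableSet] with x hx
      exact (tendsto_softPos (h.pos x hx)).mul_const _
  have hr : Tendsto (fun n : ℕ => -∫ x in A, ramp (n + 1 : ℝ) (1 / (n + 1 : ℝ)) (u x) *
      (⟪G x, e⟫ * T x)) atTop (nhds (-∫ x in A, ⟪G x, e⟫ * T x)) := by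
    refine Tendsto.neg ?_
    refine tendsto_integral_of_dominated_convergence (fun x => ‖⟪G x, e⟫ * T x‖) (fun n => ?_)
      (h.integrableOn_of_continuousOn (hGe.mul hT)).norm (fun n => ?_) ?_
    · exact (h.integrableOn_of_continuousOn
        (((continuous_ramp _ _).comp_continuousOn h.cont).mul (hGe.mul hT))).aestronglyMeasurable
    · refine ae_of_all _ fun x => ?_
      rw [norm_mul]
      refine mul_le_of_le_one_left (norm_nonneg _) ?_
      rw [Real.norm_of_nonneg (ramp_nonneg _ _ _)]
      exact ramp_le_one _ _ _
    · filter_upwards [ae_restrict_mem h.measurableSet] with x hx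
      simpa using (tendsto_ramp (h.pos x hx)).mul_const (⟪G x, e⟫ * T x)
  simp_rw [happ] at hl
  exact tendsto_nhds_unique hl hr

end PosDomain

end

section

theorem RingPair.norm_ringGrad_add_le {d : ℝ} {p x y : ℂ} (h : RingPair d p x y) :
    ‖ringGrad x y + (p.re ^ 2 / (2 * π)) • logGrad x y‖ ≤
      11.5 * d * p.re ^ 2 * ‖x - y‖⁻¹ + 2 * p.re * (1 + log p.re) := by
  have h1 := h.norm_ringSing_sub_le
  have h2 := h.abs_ringKer_le
  have h3 := h.le_re
  have h4 := h.d_le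
  have h5 := h.large
  have h6 := h.left_re.1
  have h7 := h.left_pos
  have h8 := h.log_re_nonneg
  have h9 := inv_pos.2 h.norm_pos
  have h10 : ringGrad x y + (p.re ^ 2 / (2 * π)) • logGrad x y =
      (ringKer x y / (2 * x.re)) • (1 : ℂ) -
        (ringSing x y - (p.re ^ 2 / (2 * π)) • logGrad x y) := by
    rw [ringGrad]; abel
  rw [h10]
  refine (norm_sub_le _ _).trans ?_
  rw [norm_smul, norm_one, mul_one, Real.norm_eq_abs, abs_div, abs_of_pos (by linarith : 0 < 2 * x.re)]
  have h11 : |ringKer x y| / (2 * x.re) ≤ 0.6 * p.re * ((1 + log p.re) + 2 * ‖x - y‖⁻¹) := by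
    rw [div_le_iff₀ (by linarith)]
    refine h2.trans ?_
    have h12 : p.re ≤ 1.2 * x.re := by nlinarith
    calc p.re ^ 2 * (1 + log p.re + 2 * ‖x - y‖⁻¹)
        = p.re * p.re * (1 + log p.re + 2 * ‖x - y‖⁻¹) := by ring
      _ ≤ (1.2 * x.re) * p.re * (1 + log p.re + 2 * ‖x - y‖⁻¹) := by gcongr
      _ = _ := by ring
  have h13 : 1.2 * p.re * ‖x - y‖⁻¹ ≤ 1.5 * d * p.re ^ 2 * ‖x - y‖⁻¹ :=
    mul_le_mul_of_nonneg_right (by nlinarith) h9.le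
  nlinarith [mul_nonneg (by linarith : 0 ≤ p.re) h8]

/-- The potential of a vortex ring with cross-section `A`. -/
def ringPot (A : Set ℂ) (x : ℂ) : ℝ := ∫ y in A, ringKer x y

/-- The rescaled free boundary problem for a vortex ring of area `π` far from the axis. -/
structure RingProblem (d w μ : ℝ) (p : ℂ) (A : Set ℂ) : Prop where
  d_pos : 0 < d
  d_le : d ≤ 1 / 100
  large : 5 ≤ d * p.re
  isOpen : IsOpen A
  preconnected : IsPreconnected A
  vol : volume.real A = π
  mem : p ∈ A
  close : ∀ x ∈ A, ‖x - p‖ ≤ d * p.re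
  w_nonneg : 0 ≤ w
  mu_nonneg : 0 ≤ μ
  cont : ContinuousOn (ringPot A) {x | 0 < x.re}
  pos : ∀ x ∈ A, 0 < ringPot A x - μ - w / 2 * x.re ^ 2
  nonpos : ∀ x, 0 < x.re → x ∉ A → ringPot A x - μ - w / 2 * x.re ^ 2 ≤ 0

namespace RingProblem

variable {d w μ : ℝ} {p : ℂ} {A : Set ℂ}

theorem re_pos (h : RingProblem d w μ p A) : 0 < p.re := by
  have h1 := h.large
  have h2 := h.d_pos
  by_contra hc
  nlinarith

theorem le_re (h : RingProblem d w μ p A) : 500 ≤ p.re := by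
  have h1 := h.large
  have h2 := h.d_le
  have h3 := h.re_pos
  nlinarith

theorem log_nonneg (h : RingProblem d w μ p A) : 0 ≤ log p.re :=
  Real.log_nonneg (by linarith [h.le_re])

theorem bdd (h : RingProblem d w μ p A) : Bornology.IsBounded A :=
  (Metric.isBounded_closedBall (x := p) (r := d * p.re)).subset fun x hx => by
    rw [Metric.mem_closedBall, dist_eq_norm]; exact h.close x hx

theorem measurableSet (h : RingProblem d w μ p A) : MeasurableSet A := h.isOpen.measurableSet

theorem volume_lt_top (h : RingProblem d w μ p A) : volume A < ⊤ := h.bdd.measure_lt_top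

theorem pair (h : RingProblem d w μ p A) {x y : ℂ} (hx : x ∈ Metric.ball p (2 * d * p.re))
    (hy : y ∈ A) (hne : x ≠ y) : RingPair d p x y where
  d_pos := h.d_pos
  d_le := h.d_le
  large := h.large
  left := by rw [Metric.mem_ball, dist_eq_norm] at hx; exact hx.le
  right := h.close y hy
  ne := hne

theorem subset_ball (h : RingProblem d w μ p A) : A ⊆ Metric.ball p (2 * d * p.re) := by
  intro x hx
  rw [Metric.mem_ball, dist_eq_norm]
  linarith [h.close x hx, h.large]

theorem re_of_mem_ball (h : RingProblem d w μ p A) {x : ℂ}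
    (hx : x ∈ Metric.ball p (2 * d * p.re)) : |x.re - p.re| ≤ 2 * d * p.re ∧ 0 < x.re := by
  rw [Metric.mem_ball, dist_eq_norm] at hx
  have h1 := (Complex.abs_re_le_norm (x - p)).trans hx.le
  rw [Complex.sub_re] at h1
  refine ⟨h1, ?_⟩
  rw [abs_le] at h1
  nlinarith [h.re_pos, h.d_le]

theorem integral_inv_norm_le (h : RingProblem d w μ p A) (x : ℂ) :
    ∫ y in A, ‖x - y‖⁻¹ ≤ 9 := by
  refine (setIntegral_inv_norm_le x h.bdd h.measurableSet).trans ?_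
  rw [h.vol]
  have : √(2 * π * π) ≤ 4.5 := by
    rw [Real.sqrt_le_left (by norm_num)]
    nlinarith [pi_lt_d4, pi_gt_three]
  linarith

theorem integral_bound (h : RingProblem d w μ p A) (x : ℂ) {a b : ℝ} (ha : 0 ≤ a) :
    ∫ y in A, (a * ‖x - y‖⁻¹ + b) ≤ a * 9 + b * π := by
  rw [integral_add ((integrableOn_inv_norm x h.bdd).const_mul a)
    (integrableOn_const h.volume_lt_top.ne), integral_const_mul, setIntegral_const, h.vol,
    smul_eq_mul, mul_comm π]
  gcongr
  exact h.integral_inv_norm_le x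

theorem integrable_bound (h : RingProblem d w μ p A) (x : ℂ) (a b : ℝ) :
    IntegrableOn (fun y => a * ‖x - y‖⁻¹ + b) A :=
  ((integrableOn_inv_norm x h.bdd).const_mul a).add (integrableOn_const h.volume_lt_top.ne)

theorem ae_ne (h : RingProblem d w μ p A) (x : ℂ) :
    ∀ᵐ y ∂(volume.restrict A), y ∈ A ∧ x ≠ y := by
  filter_upwards [ae_restrict_mem h.measurableSet, Measure.ae_ne _ x] with y hy hne
  exact ⟨hy, hne.symm⟩

theorem integrableOn_ringKer (h : RingProblem d w μ p A) {x : ℂ}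
    (hx : x ∈ Metric.ball p (2 * d * p.re)) : IntegrableOn (ringKer x) A := by
  refine Integrable.mono' (h.integrable_bound x (2 * p.re ^ 2) (p.re ^ 2 * (1 + log p.re)))
    (measurable_ringKer.comp measurable_prodMk_left).aestronglyMeasurable ?_
  filter_upwards [h.ae_ne x] with y hy
  rw [Real.norm_eq_abs]
  exact (h.pair hx hy.1 hy.2).abs_ringKer_le.trans_eq (by ring)

theorem abs_ringPot_le (h : RingProblem d w μ p A) {x : ℂ}
    (hx : x ∈ Metric.ball p (2 * d * p.re)) : |ringPot A x| ≤ 22 * p.re ^ 2 * (1 + log p.re) := by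
  have h1 : |ringPot A x| ≤ ∫ y in A, ((2 * p.re ^ 2) * ‖x - y‖⁻¹ + p.re ^ 2 * (1 + log p.re)) := by
    rw [← Real.norm_eq_abs]
    refine norm_integral_le_of_norm_le (h.integrable_bound x _ _) ?_
    filter_upwards [h.ae_ne x] with y hy
    rw [Real.norm_eq_abs]
    exact (h.pair hx hy.1 hy.2).abs_ringKer_le.trans_eq (by ring)
  refine (h1.trans (h.integral_bound x (by positivity))).trans ?_
  have h2 := h.log_nonneg
  have h3 : 0 ≤ p.re ^ 2 * (1 + log p.re) := by positivity
  nlinarith [pi_lt_four, mul_nonneg (sq_nonneg p.re) h2]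

theorem w_le (h : RingProblem d w μ p A) : w ≤ 44 * (1 + log p.re) := by
  have h1 := h.pos p h.mem
  have h2 := (abs_le.1 (h.abs_ringPot_le (h.subset_ball h.mem))).2
  have h3 := h.mu_nonneg
  have h4 : w * p.re ^ 2 ≤ 44 * (1 + log p.re) * p.re ^ 2 := by linarith
  exact le_of_mul_le_mul_right h4 (pow_pos h.re_pos 2)

theorem singularKernel (h : RingProblem d w μ p A) :
    SingularKernel (Metric.ball p (2 * d * p.re)) A (p.re ^ 2 * (1 + log p.re)) ringKer
      ringGrad where
  isOpen := Metric.isOpen_ball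
  bdd := h.bdd
  meas := h.measurableSet
  measurable := measurable_ringGrad
  integrable _ hx := h.integrableOn_ringKer hx
  bound x hx y hy hne := by
    have hp := h.pair hx hy hne
    have h1 := hp.norm_ringGrad_add_le
    have h2 : ‖(p.re ^ 2 / (2 * π)) • logGrad x y‖ ≤ 0.2 * p.re ^ 2 * ‖x - y‖⁻¹ := by
      rw [norm_smul, norm_logGrad, Real.norm_of_nonneg (by positivity)]
      have : p.re ^ 2 / (2 * π) ≤ 0.2 * p.re ^ 2 := by
        rw [div_le_iff₀ (by positivity)]
        nlinarith [mul_nonneg (sq_nonneg p.re) (sub_nonneg.2 pi_gt_three.le)]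
      gcongr
    have h3 := norm_sub_le (ringGrad x y + (p.re ^ 2 / (2 * π)) • logGrad x y)
      ((p.re ^ 2 / (2 * π)) • logGrad x y)
    rw [add_sub_cancel_right] at h3
    have h4 := hp.norm_pos
    have h5 : 1 ≤ 0.03 * p.re * ‖x - y‖⁻¹ := by
      rw [← div_eq_mul_inv, le_div_iff₀ h4]
      nlinarith [hp.norm_le, hp.d_le, hp.le_re]
    have h6 := h.log_nonneg
    have h7 := h.re_pos
    have h8 : 2 * p.re * (1 + log p.re) ≤ 0.06 * (p.re ^ 2 * (1 + log p.re)) * ‖x - y‖⁻¹ := by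
      calc 2 * p.re * (1 + log p.re) = 2 * p.re * (1 + log p.re) * 1 := by ring
        _ ≤ 2 * p.re * (1 + log p.re) * (0.03 * p.re * ‖x - y‖⁻¹) := by gcongr
        _ = _ := by ring
    have h9 : 11.5 * d * p.re ^ 2 * ‖x - y‖⁻¹ ≤ 0.115 * p.re ^ 2 * ‖x - y‖⁻¹ := by
      have := hp.d_le
      gcongr
      linarith
    have h10 : 0 ≤ log p.re * (p.re ^ 2 * ‖x - y‖⁻¹) := by positivity
    have h11 : 0 ≤ p.re ^ 2 * ‖x - y‖⁻¹ := by positivity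
    linarith
  cont y hy x hx hne := continuousAt_ringGrad (h.re_of_mem_ball hx).2
    (h.pair hx hy hne).right_pos hne
  deriv y hy x hx hne e := hasLineDerivAt_ringKer (h.re_of_mem_ball hx).2
    (h.pair hx hy hne).right_pos hne e

/-- The normalized velocity potential. -/
def stream (w μ : ℝ) (p : ℂ) (A : Set ℂ) (x : ℂ) : ℝ :=
  (p.re ^ 2)⁻¹ * (ringPot A x - μ - w / 2 * x.re ^ 2)

def streamGrad (w : ℝ) (p : ℂ) (A : Set ℂ) (x : ℂ) : ℂ :=
  (p.re ^ 2)⁻¹ • ((∫ y in A, ringGrad x y) - (w * x.re) • (1 : ℂ))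

theorem posDomain (h : RingProblem d w μ p A) :
    PosDomain (Metric.ball p (2 * d * p.re)) A (stream w μ p A) (streamGrad w p A) where
  isOpen := h.isOpen
  bdd := h.bdd
  closure_subset := by
    refine (closure_minimal (t := Metric.closedBall p (d * p.re)) ?_
      Metric.isClosed_closedBall).trans (Metric.closedBall_subset_ball (by linarith [h.large]))
    intro x hx
    rw [Metric.mem_closedBall, dist_eq_norm]
    exact h.close x hx
  cont := by
    have h1 : ContinuousOn (ringPot A) (Metric.ball p (2 * d * p.re)) :=
      h.cont.mono fun x hx => (h.re_of_mem_ball hx).2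
    unfold stream
    fun_prop
  contG := by
    have h1 := h.singularKernel.continuousOn_grad
      (mul_nonneg (sq_nonneg _) (by linarith [h.log_nonneg]))
    unfold streamGrad
    fun_prop
  deriv x hx e := by
    have h1 := h.singularKernel.hasLineDerivAt
      (mul_nonneg (sq_nonneg _) (by linarith [h.log_nonneg])) hx e
    have ha : HasDerivAt (fun s : ℝ => (x + s • e).re) e.re 0 := by
      simpa using ((hasDerivAt_id (0 : ℝ)).mul_const e.re).const_add x.re
    have h2 := ((HasDerivAt.sub_const μ h1).sub ((ha.pow 2).const_mul (w / 2))).const_mul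
      (p.re ^ 2)⁻¹
    refine h2.congr_deriv ?_
    have h3 : ⟪(1 : ℂ), e⟫ = e.re := by rw [Complex.inner]; simp
    rw [streamGrad, real_inner_smul_left, inner_sub_left, real_inner_smul_left, h3]
    simp
    ring_nf
    simp
  pos x hx := mul_pos (inv_pos.2 (pow_pos h.re_pos 2)) (h.pos x hx)
  nonpos x hx hA := mul_nonpos_of_nonneg_of_nonpos (by positivity)
    (h.nonpos x (h.re_of_mem_ball hx).2 hA)

theorem near (h : RingProblem d w μ p A) {x : ℂ} (hx : x ∈ Metric.ball p (2 * d * p.re)) :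
    ‖streamGrad w p A x + (1 / (2 * π)) • logPotGrad A x‖ ≤ 110 * (d + (1 + log p.re) / p.re) := by
  have hP := h.re_pos
  have hl := h.log_nonneg
  have hi1 : IntegrableOn (ringGrad x) A := h.singularKernel.integrable_grad hx
  have hi2 : IntegrableOn (logGrad x) A :=
    (singularKernel_log isOpen_univ h.bdd h.measurableSet).integrable_grad (Set.mem_univ x)
  have h1 : streamGrad w p A x + (1 / (2 * π)) • logPotGrad A x = (p.re ^ 2)⁻¹ •
      ((∫ y in A, (ringGrad x y + (p.re ^ 2 / (2 * π)) • logGrad x y)) -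
        (w * x.re) • (1 : ℂ)) := by
    have hi3 : IntegrableOn (fun y => (p.re ^ 2 / (2 * π)) • logGrad x y) A :=
      Integrable.fun_smul (p.re ^ 2 / (2 * π)) hi2
    rw [integral_add hi1 hi3, integral_smul, streamGrad, add_sub_right_comm, smul_add,
      smul_smul, logPotGrad]
    congr 2
    field_simp
  rw [h1, norm_smul, norm_inv, norm_pow, Real.norm_of_nonneg hP.le, inv_mul_le_iff₀ (by positivity)]
  refine (norm_sub_le _ _).trans ?_
  have h2 : ‖∫ y in A, (ringGrad x y + (p.re ^ 2 / (2 * π)) • logGrad x y)‖ ≤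
      ∫ y in A, (11.5 * d * p.re ^ 2 * ‖x - y‖⁻¹ + 2 * p.re * (1 + log p.re)) := by
    refine norm_integral_le_of_norm_le (h.integrable_bound x _ _) ?_
    filter_upwards [h.ae_ne x] with y hy
    exact (h.pair hx hy.1 hy.2).norm_ringGrad_add_le
  have h3 := h2.trans (h.integral_bound x (by have := h.d_pos; positivity))
  have h4 : ‖(w * x.re) • (1 : ℂ)‖ ≤ 44 * (1 + log p.re) * (1.02 * p.re) := by
    have hre := h.re_of_mem_ball hx
    rw [norm_smul, norm_one, mul_one, norm_mul, Real.norm_of_nonneg h.w_nonneg,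
      Real.norm_of_nonneg hre.2.le]
    have := (abs_le.1 hre.1).2
    exact mul_le_mul h.w_le (by nlinarith [h.d_le]) hre.2.le (by linarith)
  have h5 : p.re ^ 2 * (110 * (d + (1 + log p.re) / p.re)) =
      110 * d * p.re ^ 2 + 110 * p.re * (1 + log p.re) := by field_simp
  rw [h5]
  have h6 := pi_lt_four
  nlinarith [mul_nonneg hP.le hl, mul_pos h.d_pos (pow_pos hP 2)]

end RingProblem

end

section

theorem ae_prod_restrict_ne {A : Set ℂ} (hm : MeasurableSet A) :
    ∀ᵐ z ∂((volume.restrict A).prod (volume.restrict A)), z.1 ∈ A ∧ z.2 ∈ A ∧ z.1 ≠ z.2 := by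
  have h1 : MeasurableSet {z : ℂ × ℂ | z.1 ∈ A ∧ z.2 ∈ A ∧ z.1 ≠ z.2} :=
    (hm.preimage measurable_fst).inter ((hm.preimage measurable_snd).inter
      (measurableSet_eq_fun measurable_fst measurable_snd).compl)
  rw [Measure.ae_prod_iff_ae_ae h1]
  filter_upwards [ae_restrict_mem hm] with x hx
  filter_upwards [ae_restrict_mem hm, Measure.ae_ne _ x] with y hy hne
  exact ⟨hx, hy, hne.symm⟩

section

variable {H : ℂ → ℂ → ℝ} {A : Set ℂ} {C c : ℝ}

theorem integrable_prod_of_le_inv_norm (hH : Measurable (Function.uncurry H))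
    (hA : Bornology.IsBounded A) (hm : MeasurableSet A)
    (hb : ∀ x ∈ A, ∀ y ∈ A, x ≠ y → |H x y| ≤ C * ‖x - y‖⁻¹) :
    Integrable (Function.uncurry H) ((volume.restrict A).prod (volume.restrict A)) := by
  have : IsFiniteMeasure (volume.restrict A) :=
    ⟨by rw [Measure.restrict_apply_univ]; exact hA.measure_lt_top⟩
  refine Integrable.mono' ((integrable_prod_inv_norm (μ := volume.restrict A) measurable_id hA
    hm).const_mul C) hH.aestronglyMeasurable ?_
  filter_upwards [ae_prod_restrict_ne hm] with z hz
  exact hb _ hz.1 _ hz.2.1 hz.2.2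

/-- A double integral is estimated by symmetrizing its kernel. -/
theorem le_integral_integral_of_symm (hH : Measurable (Function.uncurry H))
    (hA : Bornology.IsBounded A) (hm : MeasurableSet A)
    (hb : ∀ x ∈ A, ∀ y ∈ A, x ≠ y → |H x y| ≤ C * ‖x - y‖⁻¹)
    (hs : ∀ x ∈ A, ∀ y ∈ A, x ≠ y → 2 * c ≤ H x y + H y x) :
    c * volume.real A ^ 2 ≤ ∫ x in A, ∫ y in A, H x y := by
  have : IsFiniteMeasure (volume.restrict A) :=
    ⟨by rw [Measure.restrict_apply_univ]; exact hA.measure_lt_top⟩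
  have h1 := integrable_prod_of_le_inv_norm hH hA hm hb
  have h2 : ∫ x in A, ∫ y in A, H x y =
      ∫ z, Function.uncurry H z ∂((volume.restrict A).prod (volume.restrict A)) :=
    (integral_prod _ h1).symm
  have h3 : ∫ z, Function.uncurry H z.swap ∂((volume.restrict A).prod (volume.restrict A)) =
      ∫ z, Function.uncurry H z ∂((volume.restrict A).prod (volume.restrict A)) :=
    integral_prod_swap _
  have h4 : ∫ _ : ℂ × ℂ, 2 * c ∂((volume.restrict A).prod (volume.restrict A)) ≤
      ∫ z, (Function.uncurry H z + Function.uncurry H z.swap)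
        ∂((volume.restrict A).prod (volume.restrict A)) := by
    refine integral_mono_ae (integrable_const _) (h1.add h1.swap) ?_
    filter_upwards [ae_prod_restrict_ne hm] with z hz
    exact hs _ hz.1 _ hz.2.1 hz.2.2
  have h6 : Integrable (fun z : ℂ × ℂ => Function.uncurry H z.swap)
      ((volume.restrict A).prod (volume.restrict A)) := h1.swap
  rw [integral_add h1 h6, h3, ← h2, integral_const, smul_eq_mul] at h4
  have h5 : ((volume.restrict A).prod (volume.restrict A)).real Set.univ = volume.real A ^ 2 := by
    rw [← Set.univ_prod_univ, measureReal_prod_prod, measureReal_restrict_apply_univ, sq]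
  rw [h5] at h4
  linarith

theorem integral_integral_le_of_symm (hH : Measurable (Function.uncurry H))
    (hA : Bornology.IsBounded A) (hm : MeasurableSet A)
    (hb : ∀ x ∈ A, ∀ y ∈ A, x ≠ y → |H x y| ≤ C * ‖x - y‖⁻¹)
    (hs : ∀ x ∈ A, ∀ y ∈ A, x ≠ y → H x y + H y x ≤ 2 * c) :
    ∫ x in A, ∫ y in A, H x y ≤ c * volume.real A ^ 2 := by
  have h1 := le_integral_integral_of_symm (H := fun x y => -H x y) (c := -c) (C := C) hH.neg hA hm
    (fun x hx y hy hne => by rw [abs_neg]; exact hb x hx y hy hne)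
    (fun x hx y hy hne => by linarith [hs x hx y hy hne])
  simp_rw [integral_neg] at h1
  linarith

end

end

section

theorem inner_ringSing_one (x y : ℂ) : ⟪ringSing x y, (1 : ℂ)⟫ =
    ringK (ringArg x y) * √(x.re * y.re) * (y.re * (2 * (x.re - y.re) / ‖x - y‖ ^ 2 - 1 / x.re)) := by
  have h1 : ⟪x - y, (1 : ℂ)⟫ = x.re - y.re := by rw [Complex.inner]; simp
  have h2 : ⟪(1 : ℂ), (1 : ℂ)⟫ = 1 := by rw [Complex.inner]; simp
  rw [ringSing, logGrad, real_inner_smul_left, inner_sub_left, real_inner_smul_left,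
    real_inner_smul_left, real_inner_smul_left, h1, h2, ringAmp]
  ring

theorem inner_ringSing_I (x y : ℂ) : ⟪ringSing x y, Complex.I⟫ =
    ringK (ringArg x y) * √(x.re * y.re) * (y.re * (2 * (x.im - y.im) / ‖x - y‖ ^ 2)) := by
  have h1 : ⟪x - y, Complex.I⟫ = x.im - y.im := by rw [Complex.inner]; simp; ring
  have h2 : ⟪(1 : ℂ), Complex.I⟫ = 0 := by rw [Complex.inner]; simp
  rw [ringSing, logGrad, real_inner_smul_left, inner_sub_left, real_inner_smul_left,
    real_inner_smul_left, real_inner_smul_left, h1, h2, ringAmp]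
  ring

theorem ringArg_comm (x y : ℂ) : ringArg x y = ringArg y x := by
  rw [ringArg, ringArg, norm_sub_rev, mul_comm]

namespace RingPair

variable {d : ℝ} {p x y : ℂ}

theorem norm_ringSing_le (h : RingPair d p x y) :
    ‖ringSing x y‖ ≤ p.re ^ 2 * ‖x - y‖⁻¹ := by
  have h1 := h.norm_ringSing_sub_le
  have h2 : ‖(p.re ^ 2 / (2 * π)) • logGrad x y‖ ≤ 0.2 * p.re ^ 2 * ‖x - y‖⁻¹ := by
    rw [norm_smul, norm_logGrad, Real.norm_of_nonneg (by positivity)]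
    have : p.re ^ 2 / (2 * π) ≤ 0.2 * p.re ^ 2 := by
      rw [div_le_iff₀ (by positivity)]
      nlinarith [mul_nonneg (sq_nonneg p.re) (sub_nonneg.2 pi_gt_three.le)]
    gcongr
  have h3 := norm_add_le (ringSing x y - (p.re ^ 2 / (2 * π)) • logGrad x y)
    ((p.re ^ 2 / (2 * π)) • logGrad x y)
  rw [sub_add_cancel] at h3
  have h4 := h.norm_pos
  have h5 : 1 ≤ 0.03 * p.re * ‖x - y‖⁻¹ := by
    rw [← div_eq_mul_inv, le_div_iff₀ h4]
    nlinarith [h.norm_le, h.d_le, h.le_re]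
  have h6 := h.le_re
  have h7 : 0 ≤ p.re ^ 2 * ‖x - y‖⁻¹ := by positivity
  nlinarith [mul_nonneg (sub_nonneg.2 h.d_le) h7]

/-- The virial density of the ring kernel, symmetrized. -/
theorem virial_add (h : RingPair d p x y) (q : ℝ) :
    (⟪ringSing x y, (1 : ℂ)⟫ * (x.re * (x.re - q)) + ⟪ringSing x y, Complex.I⟫ * (x.re * x.im)) +
      (⟪ringSing y x, (1 : ℂ)⟫ * (y.re * (y.re - q)) +
        ⟪ringSing y x, Complex.I⟫ * (y.re * y.im)) =
    ringK (ringArg x y) * √(x.re * y.re) * (q * (x.re + y.re)) := by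
  have h1 := h.left_pos
  have h2 := h.right_pos
  have h3 : ‖x - y‖ ^ 2 = (x.re - y.re) ^ 2 + (x.im - y.im) ^ 2 := by
    rw [Complex.sq_norm, Complex.normSq_apply]
    simp only [Complex.sub_re, Complex.sub_im]
    ring
  have h4 : 0 < ‖x - y‖ ^ 2 := pow_pos h.norm_pos 2
  simp only [inner_ringSing_one, inner_ringSing_I]
  rw [ringArg_comm y x, mul_comm y.re x.re, norm_sub_rev y x]
  generalize ringK (ringArg x y) * √(x.re * y.re) = N
  have h5 : N * (y.re * (2 * (x.re - y.re) / ‖x - y‖ ^ 2 - 1 / x.re)) * (x.re * (x.re - q)) +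
        N * (y.re * (2 * (x.im - y.im) / ‖x - y‖ ^ 2)) * (x.re * x.im) +
      (N * (x.re * (2 * (y.re - x.re) / ‖x - y‖ ^ 2 - 1 / y.re)) * (y.re * (y.re - q)) +
        N * (x.re * (2 * (y.im - x.im) / ‖x - y‖ ^ 2)) * (y.re * y.im)) =
      N * (2 * x.re * y.re * (((x.re - y.re) ^ 2 + (x.im - y.im) ^ 2) / ‖x - y‖ ^ 2) -
        y.re * (x.re - q) - x.re * (y.re - q)) := by
    field_simp
    ring
  rw [h5, ← h3, div_self h4.ne']
  ring

/-- The force density of the ring kernel, symmetrized. -/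
theorem force_add (h : RingPair d p x y) :
    ⟪ringSing x y, (1 : ℂ)⟫ * x.re + ⟪ringSing y x, (1 : ℂ)⟫ * y.re =
      -(ringK (ringArg x y) * √(x.re * y.re) * (x.re + y.re)) := by
  have h1 := h.left_pos
  have h2 := h.right_pos
  have h4 := h.norm_pos
  simp only [inner_ringSing_one]
  rw [ringArg_comm y x, mul_comm y.re x.re, norm_sub_rev y x]
  generalize ringK (ringArg x y) * √(x.re * y.re) = N
  field_simp
  ring

end RingPair

namespace RingProblem

variable {d w μ : ℝ} {p : ℂ} {A : Set ℂ}

theorem pair_of_mem (h : RingProblem d w μ p A) {x y : ℂ} (hx : x ∈ A) (hy : y ∈ A)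
    (hne : x ≠ y) : RingPair d p x y := h.pair (h.subset_ball hx) hy hne

theorem integrableOn_ringSing (h : RingProblem d w μ p A) {x : ℂ}
    (hx : x ∈ Metric.ball p (2 * d * p.re)) : IntegrableOn (ringSing x) A := by
  refine Integrable.mono' ((integrableOn_inv_norm x h.bdd).const_mul (p.re ^ 2))
    (measurable_ringSing.comp measurable_prodMk_left).aestronglyMeasurable ?_
  filter_upwards [h.ae_ne x] with y hy
  exact (h.pair hx hy.1 hy.2).norm_ringSing_le

theorem inner_streamGrad (h : RingProblem d w μ p A) {x : ℂ}
    (hx : x ∈ Metric.ball p (2 * d * p.re)) (e : ℂ) :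
    p.re ^ 2 * ⟪streamGrad w p A x, e⟫ =
      (ringPot A x / (2 * x.re) - w * x.re) * e.re - ∫ y in A, ⟪ringSing x y, e⟫ := by
  have hP := h.re_pos
  have h1 : ⟪(1 : ℂ), e⟫ = e.re := by rw [Complex.inner]; simp
  have h2 : ∫ y in A, ⟪ringSing x y, e⟫ = ⟪∫ y in A, ringSing x y, e⟫ := by
    rw [real_inner_comm, ← integral_inner (h.integrableOn_ringSing hx)]
    exact integral_congr_ae (ae_of_all _ fun y => real_inner_comm _ _)
  have hi : IntegrableOn (fun y => (ringKer x y / (2 * x.re)) • (1 : ℂ)) A :=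
    ((h.integrableOn_ringKer hx).div_const _).smul_const _
  have h3 : ∫ y in A, ringGrad x y =
      (ringPot A x / (2 * x.re)) • (1 : ℂ) - ∫ y in A, ringSing x y := by
    simp_rw [ringGrad]
    rw [integral_sub hi (h.integrableOn_ringSing hx), integral_smul_const, integral_div, ringPot]
  rw [streamGrad, real_inner_smul_left, h3, h2, inner_sub_left, inner_sub_left,
    real_inner_smul_left, real_inner_smul_left, h1, mul_inv_cancel_left₀ (by positivity)]
  ring

theorem continuousOn_inner_ringSing (h : RingProblem d w μ p A) (e : ℂ) :
    ContinuousOn (fun x => ∫ y in A, ⟪ringSing x y, e⟫) (Metric.ball p (2 * d * p.re)) := by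
  have h1 : ContinuousOn (fun x => (ringPot A x / (2 * x.re) - w * x.re) * e.re -
      p.re ^ 2 * ⟪streamGrad w p A x, e⟫) (Metric.ball p (2 * d * p.re)) := by
    have h2 : ContinuousOn (ringPot A) (Metric.ball p (2 * d * p.re)) :=
      h.cont.mono fun x hx => (h.re_of_mem_ball hx).2
    have h3 := h.posDomain.contG
    have h4 : ∀ x ∈ Metric.ball p (2 * d * p.re), 2 * x.re ≠ 0 := fun x hx => by
      have := (h.re_of_mem_ball hx).2
      positivity
    fun_prop (disch := assumption)
  refine h1.congr fun x hx => ?_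
  simp only [h.inner_streamGrad hx e]
  ring

theorem continuousOn_ringPot (h : RingProblem d w μ p A) :
    ContinuousOn (ringPot A) (Metric.ball p (2 * d * p.re)) :=
  h.cont.mono fun x hx => (h.re_of_mem_ball hx).2

theorem integrableOn_inner_ringSing (h : RingProblem d w μ p A) {x : ℂ}
    (hx : x ∈ Metric.ball p (2 * d * p.re)) (e : ℂ) :
    IntegrableOn (fun y => ⟪ringSing x y, e⟫) A := by
  exact ((h.integrableOn_ringSing hx).const_inner (𝕜 := ℝ) e).congr
    (ae_of_all _ fun y => real_inner_comm _ _)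

theorem integrableOn_integral_inner (h : RingProblem d w μ p A) {T : ℂ → ℝ} (hT : Continuous T)
    (e : ℂ) : IntegrableOn (fun x => ∫ y in A, ⟪ringSing x y, e⟫ * T x) A := by
  simp_rw [integral_mul_const]
  exact h.posDomain.integrableOn_of_continuousOn
    ((h.continuousOn_inner_ringSing e).mul hT.continuousOn)

theorem integral_stream_mul (h : RingProblem d w μ p A) {T T' : ℂ → ℝ} {e : ℂ}
    (hT : Continuous T) (hT' : Continuous T') (hd : ∀ x, HasLineDerivAt ℝ T (T' x) x e) :
    p.re ^ 2 * ∫ x in A, stream w μ p A x * T' x =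
      -(e.re * ∫ x in A, (ringPot A x / 2 - w * x.re ^ 2) * (T x / x.re)) +
        ∫ x in A, ∫ y in A, ⟪ringSing x y, e⟫ * T x := by
  rw [h.posDomain.integral_mul_deriv hT.continuousOn hT'.continuousOn fun x _ => hd x]
  have hre : ∀ x ∈ Metric.ball p (2 * d * p.re), x.re ≠ 0 := fun x hx => (h.re_of_mem_ball hx).2.ne'
  have hi1 : IntegrableOn (fun x => (ringPot A x / 2 - w * x.re ^ 2) * (T x / x.re)) A := by
    refine h.posDomain.integrableOn_of_continuousOn ?_
    have := h.continuousOn_ringPot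
    fun_prop (disch := assumption)
  have hi2 := h.integrableOn_integral_inner hT e
  rw [← integral_const_mul, mul_neg, ← integral_const_mul, neg_add_eq_sub,
    ← integral_sub hi2 (hi1.const_mul _), ← integral_neg]
  refine setIntegral_congr_fun h.measurableSet fun x hx => ?_
  have h1 := h.inner_streamGrad (h.subset_ball hx) e
  have h2 := hre x (h.subset_ball hx)
  simp only [integral_mul_const]
  rw [← mul_assoc, h1]
  field_simp
  ring

end RingProblem

end

section

theorem hasLineDerivAt_re (x e : ℂ) : HasLineDerivAt ℝ Complex.re e.re x e := by
  simpa [HasLineDerivAt] using ((hasDerivAt_id (0 : ℝ)).mul_const e.re).const_add x.re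

theorem hasLineDerivAt_im (x e : ℂ) : HasLineDerivAt ℝ Complex.im e.im x e := by
  simpa [HasLineDerivAt] using ((hasDerivAt_id (0 : ℝ)).mul_const e.im).const_add x.im

theorem hasLineDerivAt_mul {f g : ℂ → ℝ} {f' g' : ℝ} {x e : ℂ} (hf : HasLineDerivAt ℝ f f' x e)
    (hg : HasLineDerivAt ℝ g g' x e) :
    HasLineDerivAt ℝ (fun x => f x * g x) (f' * g x + f x * g') x e := by
  have h1 := HasDerivAt.mul hf hg
  rw [zero_smul, add_zero] at h1
  exact h1

namespace RingPair

variable {d : ℝ} {p x y : ℂ}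

theorem abs_mass_le (h : RingPair d p x y) :
    |ringK (ringArg x y) * √(x.re * y.re) - 1 / (4 * π) * p.re| ≤ 5 * d * p.re := by
  have h1 := h.abs_ringK_le
  have h2 := h.sqrt_bounds
  have h4 := h.d_le
  have h5 := h.d_pos
  have h3 := h.le_re
  have hpi : 1 / (4 * π) ≤ 1 / 12 := by
    have := pi_gt_three
    gcongr; linarith
  have hpi0 : 0 < 1 / (4 * π) := by positivity
  have h7 : |√(x.re * y.re) - p.re| ≤ 2 * d * p.re := by
    rw [abs_le]; constructor <;> linarith
  rw [show ringK (ringArg x y) * √(x.re * y.re) - 1 / (4 * π) * p.re =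
    (ringK (ringArg x y) - 1 / (4 * π)) * √(x.re * y.re) +
      1 / (4 * π) * (√(x.re * y.re) - p.re) by ring]
  refine (abs_add_le _ _).trans ?_
  rw [abs_mul, abs_mul, abs_of_nonneg (Real.sqrt_nonneg _), abs_of_pos hpi0]
  calc _ ≤ 4 * d * ((1 + 2 * d) * p.re) + 1 / 12 * (2 * d * p.re) := by
        gcongr; exact h2.2
    _ ≤ _ := by nlinarith [mul_nonneg (mul_nonneg h5.le (sub_nonneg.2 h4)) (by linarith : 0 ≤ p.re),
                  mul_nonneg h5.le (by linarith : 0 ≤ p.re)]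

end RingPair

/-- The first coordinate of the centre of mass of a set of area `π`. -/
def ringCenter (A : Set ℂ) : ℝ := π⁻¹ * ∫ x in A, x.re

namespace RingProblem

variable {d w μ : ℝ} {p : ℂ} {A : Set ℂ}

theorem abs_re_sub_le (h : RingProblem d w μ p A) {x : ℂ} (hx : x ∈ A) :
    |x.re - p.re| ≤ d * p.re := by
  have h1 := (Complex.abs_re_le_norm (x - p)).trans (h.close x hx)
  rwa [Complex.sub_re] at h1

theorem integrableOn_continuous (h : RingProblem d w μ p A) {F : ℂ → ℝ} (hF : Continuous F) :
    IntegrableOn F A := h.posDomain.integrableOn_of_continuousOn hF.continuousOn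

theorem integral_re_sub_const (h : RingProblem d w μ p A) (a : ℝ) :
    ∫ x in A, (x.re - a) = π * (ringCenter A - a) := by
  have h1 : IntegrableOn Complex.re A := h.integrableOn_continuous Complex.continuous_re
  rw [integral_sub h1 (integrableOn_const h.volume_lt_top.ne), setIntegral_const, h.vol,
    smul_eq_mul, ringCenter, mul_sub, mul_inv_cancel_left₀ pi_ne_zero]

theorem abs_ringCenter_sub_le (h : RingProblem d w μ p A) :
    |ringCenter A - p.re| ≤ d * p.re := by
  have h1 : ‖∫ x in A, (x.re - p.re)‖ ≤ d * p.re * volume.real A :=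
    norm_setIntegral_le_of_norm_le_const h.volume_lt_top fun x hx => h.abs_re_sub_le hx
  rw [h.integral_re_sub_const, h.vol, norm_mul, Real.norm_of_nonneg pi_pos.le,
    mul_comm (d * p.re)] at h1
  exact le_of_mul_le_mul_left h1 pi_pos

theorem virial_lower (h : RingProblem d w μ p A) :
    (1 - 70 * d) * (π / 4) * p.re ^ 3 ≤ ∫ x in A, ∫ y in A,
      (⟪ringSing x y, (1 : ℂ)⟫ * (x.re * (x.re - ringCenter A)) +
        ⟪ringSing x y, Complex.I⟫ * (x.re * x.im)) := by
  set q := ringCenter A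
  have hP := h.re_pos
  have hd := h.d_pos
  have hd1 := h.d_le
  have hq := abs_le.1 h.abs_ringCenter_sub_le
  obtain ⟨R, hR0, hR⟩ : ∃ R, 0 ≤ R ∧ ∀ x ∈ A, |x.re * (x.re - q)| + |x.re * x.im| ≤ R := by
    have hc : Continuous fun x : ℂ => |x.re * (x.re - q)| + |x.re * x.im| := by fun_prop
    obtain ⟨R, hR⟩ := h.bdd.isCompact_closure.exists_bound_of_continuousOn hc.continuousOn
    refine ⟨R, (norm_nonneg _).trans (hR p (subset_closure h.mem)), fun x hx => ?_⟩
    exact (le_abs_self _).trans (hR x (subset_closure hx))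
  have hm1 : Measurable fun z : ℂ × ℂ => ⟪ringSing z.1 z.2, (1 : ℂ)⟫ :=
    Measurable.inner measurable_ringSing measurable_const
  have hm2 : Measurable fun z : ℂ × ℂ => ⟪ringSing z.1 z.2, Complex.I⟫ :=
    Measurable.inner measurable_ringSing measurable_const
  have hpi : 1 / (4 * π) ≤ 1 / 12 := by
    have := pi_gt_three
    gcongr; linarith
  have hpi2 : 1 / 13 ≤ 1 / (4 * π) := by
    have := pi_lt_d2
    gcongr; linarith
  have hsym := le_integral_integral_of_symm (A := A) (C := p.re ^ 2 * R)
    (c := (1 - 70 * d) * (1 / (4 * π)) * p.re ^ 3) (H := fun x y =>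
      ⟪ringSing x y, (1 : ℂ)⟫ * (x.re * (x.re - q)) + ⟪ringSing x y, Complex.I⟫ * (x.re * x.im))
    (by unfold Function.uncurry; fun_prop) h.bdd h.measurableSet ?_ ?_
  · rw [h.vol] at hsym
    refine le_trans (le_of_eq ?_) hsym
    field_simp
  · intro x hx y hy hne
    have hp := (h.pair_of_mem hx hy hne).norm_ringSing_le
    have h1 : |⟪ringSing x y, (1 : ℂ)⟫| ≤ p.re ^ 2 * ‖x - y‖⁻¹ :=
      ((abs_real_inner_le_norm _ _).trans_eq (by simp)).trans hp
    have h2 : |⟪ringSing x y, Complex.I⟫| ≤ p.re ^ 2 * ‖x - y‖⁻¹ :=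
      ((abs_real_inner_le_norm _ _).trans_eq (by simp)).trans hp
    refine (abs_add_le _ _).trans ?_
    rw [abs_mul, abs_mul ⟪ringSing x y, Complex.I⟫]
    calc _ ≤ (p.re ^ 2 * ‖x - y‖⁻¹) * |x.re * (x.re - q)| +
          (p.re ^ 2 * ‖x - y‖⁻¹) * |x.re * x.im| := by gcongr
      _ = (p.re ^ 2 * ‖x - y‖⁻¹) * (|x.re * (x.re - q)| + |x.re * x.im|) := by ring
      _ ≤ (p.re ^ 2 * ‖x - y‖⁻¹) * R := by gcongr; exact hR x hx
      _ = _ := by ring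
  · intro x hx y hy hne
    have hp := h.pair_of_mem hx hy hne
    rw [hp.virial_add q]
    have h1 := (abs_le.1 hp.abs_mass_le).1
    have h2 := (abs_le.1 (h.abs_re_sub_le hx)).1
    have h3 := (abs_le.1 (h.abs_re_sub_le hy)).1
    have h4 : (1 / (4 * π) - 5 * d) * p.re ≤ ringK (ringArg x y) * √(x.re * y.re) := by linarith
    have h5 : 0 ≤ (1 / (4 * π) - 5 * d) * p.re := mul_nonneg (by linarith) hP.le
    have h6 : ((1 - d) * p.re) * (2 * ((1 - d) * p.re)) ≤ q * (x.re + y.re) :=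
      mul_le_mul (by linarith) (by linarith) (by nlinarith) (by nlinarith)
    have h7 := mul_le_mul h4 h6 (by nlinarith [mul_pos hP hP]) (h5.trans h4)
    refine le_trans ?_ h7
    have h8 : (1 / (4 * π) - 5 * d) * p.re * ((1 - d) * p.re * (2 * ((1 - d) * p.re))) =
      2 * ((1 / (4 * π) - 5 * d) * (1 - d) ^ 2) * p.re ^ 3 := by ring
    rw [h8, mul_assoc 2 ((1 / (4 * π) - 5 * d) * (1 - d) ^ 2)]
    refine mul_le_mul_of_nonneg_left (mul_le_mul_of_nonneg_right ?_ (by positivity)) zero_le_two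
    generalize 1 / (4 * π) = a at *
    nlinarith [mul_nonneg hd.le (sub_nonneg.2 hpi2), mul_nonneg hd.le hd.le,
      mul_nonneg (mul_nonneg hd.le hd.le) (sub_nonneg.2 hpi2)]

theorem energy (h : RingProblem d w μ p A) :
    (1 - 80 * d) * (π / 8) ≤ ∫ x in A, stream w μ p A x := by
  have hP := h.re_pos
  have hd := h.d_pos
  have hd1 := h.d_le
  have hvir := h.virial_lower
  have hcen := h.integral_re_sub_const (ringCenter A)
  have hq := abs_le.1 h.abs_ringCenter_sub_le
  rw [sub_self, mul_zero] at hcen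
  set q := ringCenter A
  set u := stream w μ p A with hu
  have huc : ContinuousOn u (Metric.ball p (2 * d * p.re)) := h.posDomain.cont
  have h1 := h.integral_stream_mul (T := fun x => x.re * (x.re - q)) (T' := fun x => 2 * x.re - q)
    (e := 1) (by fun_prop) (by fun_prop) fun x => by
      have h2 : HasLineDerivAt ℝ (fun x : ℂ => x.re - q) (1 : ℂ).re x 1 :=
        HasDerivAt.sub_const q (hasLineDerivAt_re x 1)
      convert hasLineDerivAt_mul (hasLineDerivAt_re x 1) h2 using 1
      simp; ring
  have h2 := h.integral_stream_mul (T := fun x => x.re * x.im) (T' := fun x => x.re)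
    (e := Complex.I) (by fun_prop) (by fun_prop) fun x => by
      convert hasLineDerivAt_mul (hasLineDerivAt_re x Complex.I)
        (hasLineDerivAt_im x Complex.I) using 1
      simp
  have hiu : IntegrableOn (fun x => u x * (x.re - q)) A :=
    h.posDomain.integrableOn_of_continuousOn (by fun_prop)
  have hix : IntegrableOn (fun x : ℂ => x.re - q) A := h.integrableOn_continuous (by fun_prop)
  have hix2 : IntegrableOn (fun x : ℂ => x.re ^ 2 * (x.re - q)) A :=
    h.integrableOn_continuous (by fun_prop)
  have h3 : ∫ x in A, (ringPot A x / 2 - w * x.re ^ 2) * (x.re * (x.re - q) / x.re) =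
      p.re ^ 2 / 2 * (∫ x in A, u x * (x.re - q)) -
        3 / 4 * w * ∫ x in A, x.re ^ 2 * (x.re - q) := by
    have h4 : ∫ x in A, (ringPot A x / 2 - w * x.re ^ 2) * (x.re * (x.re - q) / x.re) =
        ∫ x in A, (p.re ^ 2 / 2 * (u x * (x.re - q)) + μ / 2 * (x.re - q) -
          3 / 4 * w * (x.re ^ 2 * (x.re - q))) := by
      refine setIntegral_congr_fun h.measurableSet fun x hx => ?_
      have hx0 := (h.re_of_mem_ball (h.subset_ball hx)).2.ne'
      simp only [hu, stream]
      field_simp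
      ring
    have hi1 : IntegrableOn (fun x => p.re ^ 2 / 2 * (u x * (x.re - q)) + μ / 2 * (x.re - q)) A :=
      (hiu.const_mul _).add (hix.const_mul _)
    rw [h4, integral_sub hi1 (hix2.const_mul _),
      integral_add (hiu.const_mul _) (hix.const_mul _), integral_const_mul, integral_const_mul,
      integral_const_mul, hcen]
    ring
  have h5 : 0 ≤ ∫ x in A, x.re ^ 2 * (x.re - q) := by
    have h6 : ∫ x in A, q ^ 2 * (x.re - q) ≤ ∫ x in A, x.re ^ 2 * (x.re - q) := by
      refine setIntegral_mono_on (hix.const_mul _) hix2 h.measurableSet fun x hx => ?_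
      have hx0 := (h.re_of_mem_ball (h.subset_ball hx)).2
      have hq0 : 0 ≤ q := by nlinarith
      nlinarith [mul_nonneg (add_nonneg hx0.le hq0) (sq_nonneg (x.re - q))]
    rwa [integral_const_mul, hcen, mul_zero] at h6
  have h7 : ∫ x in A, ∫ y in A, (⟪ringSing x y, (1 : ℂ)⟫ * (x.re * (x.re - q)) +
        ⟪ringSing x y, Complex.I⟫ * (x.re * x.im)) =
      (∫ x in A, ∫ y in A, ⟪ringSing x y, (1 : ℂ)⟫ * (x.re * (x.re - q))) +
        ∫ x in A, ∫ y in A, ⟪ringSing x y, Complex.I⟫ * (x.re * x.im) := by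
    rw [← integral_add (h.integrableOn_integral_inner (T := fun x => x.re * (x.re - q))
      (by fun_prop) 1) (h.integrableOn_integral_inner (T := fun x => x.re * x.im)
      (by fun_prop) Complex.I)]
    refine setIntegral_congr_fun h.measurableSet fun x hx => ?_
    exact integral_add ((h.integrableOn_inner_ringSing (h.subset_ball hx) 1).mul_const _)
      ((h.integrableOn_inner_ringSing (h.subset_ball hx) Complex.I).mul_const _)
  rw [h7] at hvir
  have h8 : (∫ x in A, u x * (2 * x.re - q)) + (∫ x in A, u x * x.re) +
      1 / 2 * (∫ x in A, u x * (x.re - q)) ≤ (2 + 5 * d) * p.re * ∫ x in A, u x := by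
    have hi2 : IntegrableOn (fun x => u x * (2 * x.re - q)) A :=
      h.posDomain.integrableOn_of_continuousOn (by fun_prop)
    have hi3 : IntegrableOn (fun x => u x * x.re) A :=
      h.posDomain.integrableOn_of_continuousOn (by fun_prop)
    have hi4 : IntegrableOn (fun x => u x * (2 * x.re - q) + u x * x.re) A := hi2.add hi3
    rw [← integral_const_mul, ← integral_const_mul, ← integral_add hi2 hi3,
      ← integral_add hi4 (hiu.const_mul _)]
    refine setIntegral_mono_on (hi4.add (hiu.const_mul _))
      (h.posDomain.integrableOn.const_mul _) h.measurableSet fun x hx => ?_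
    have hux : 0 < u x := h.posDomain.pos x hx
    have hx1 := (abs_le.1 (h.abs_re_sub_le hx)).2
    have h9 : u x * (3.5 * x.re - 1.5 * q) ≤ u x * ((2 + 5 * d) * p.re) := by
      refine mul_le_mul_of_nonneg_left ?_ hux.le
      linarith
    linarith
  have h10 := mul_nonneg h.w_nonneg h5
  rw [h3, Complex.one_re, one_mul] at h1
  rw [Complex.I_re, zero_mul, neg_zero, zero_add] at h2
  have h11 : (1 - 70 * d) * (π / 4) * p.re ^ 3 ≤
      ((2 + 5 * d) * ∫ x in A, u x) * p.re ^ 3 := by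
    have h12 := mul_le_mul_of_nonneg_left h8 (sq_nonneg p.re)
    linarith
  have h13 := le_of_mul_le_mul_right h11 (pow_pos hP 3)
  by_contra! hc
  have h14 := mul_lt_mul_of_pos_left hc (by linarith : 0 < 2 + 5 * d)
  nlinarith [mul_pos hd pi_pos, mul_pos (mul_pos hd hd) pi_pos]

end RingProblem

end

section

theorem inv_four_pi_le : 1 / (4 * π) ≤ 1 / 12 := by
  have := pi_gt_three
  gcongr; linarith

namespace RingPair

variable {d : ℝ} {p x y : ℂ}

theorem abs_ringKer_sub_le (h : RingPair d p x y) :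
    |(p.re ^ 2)⁻¹ * ringKer x y - 1 / (2 * π) * (log 8 - 2 + log p.re - log ‖x - y‖)| ≤
      5 * d * ‖x - y‖⁻¹ + 7 * d * (1 + log p.re) := by
  have h1 := (abs_ringF_sub_le h.arg_pos h.arg_le_one).trans h.sqrt_arg_le
  have h2 := h.abs_ringF_le
  have h3 := h.amp_bounds
  have h4 := h.abs_log_mul_le
  have h5 := h.le_re
  have hl := h.log_re_nonneg
  have hd := h.d_pos
  have hr := h.norm_pos
  have hpi0 : 0 < 1 / (4 * π) := by positivity
  have h6 : |(p.re ^ 2)⁻¹ * ringAmp x y - 1| ≤ 5 * d := by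
    have hP : 0 < p.re ^ 2 := by positivity
    rw [← div_eq_inv_mul, abs_le, neg_le_sub_iff_le_add, sub_le_iff_le_add]
    constructor
    · rw [← sub_le_iff_le_add, le_div_iff₀ hP]; exact h3.1
    · rw [div_le_iff₀ hP]; linarith [h3.2]
  rw [h.log_arg] at h1
  rw [ringKer, show (p.re ^ 2)⁻¹ * (ringAmp x y * ringF (ringArg x y)) -
      1 / (2 * π) * (log 8 - 2 + log p.re - log ‖x - y‖) =
    ((p.re ^ 2)⁻¹ * ringAmp x y - 1) * ringF (ringArg x y) +
      ((ringF (ringArg x y) - 1 / (4 * π) * (2 * log 8 - 4 - (2 * log ‖x - y‖ -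
        log (x.re * y.re)))) + 1 / (4 * π) * (log (x.re * y.re) - 2 * log p.re)) by
      field_simp; ring]
  refine (abs_add_le _ _).trans ((add_le_add_right (abs_add_le _ _) _).trans ?_)
  rw [abs_mul, abs_mul, abs_of_pos hpi0]
  calc _ ≤ 5 * d * ((1 + log p.re) / 2 + ‖x - y‖⁻¹) + (4 * d + 1 / 12 * (5 * d)) := by
        refine add_le_add ?_ (add_le_add h1 ?_)
        · exact mul_le_mul h6 h2 (abs_nonneg _) (by positivity)
        · exact mul_le_mul inv_four_pi_le h4 (abs_nonneg _) (by norm_num)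
    _ ≤ _ := by nlinarith [mul_nonneg hd.le hl]

end RingPair

namespace RingProblem

variable {d w μ : ℝ} {p : ℂ} {A : Set ℂ}

theorem abs_ringPot_sub_le (h : RingProblem d w μ p A) {x : ℂ} (hx : x ∈ A) :
    |(p.re ^ 2)⁻¹ * ringPot A x - (1 / 2 * (log 8 - 2 + log p.re) -
      1 / (2 * π) * logPot A x)| ≤ 70 * d * (1 + log p.re) := by
  have hl := h.log_nonneg
  have hd := h.d_pos
  have hi1 := (h.integrableOn_ringKer (h.subset_ball hx)).const_mul (p.re ^ 2)⁻¹
  have hi2 : IntegrableOn (fun y => log ‖x - y‖) A := integrableOn_log_norm x h.bdd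
  have hi3 : IntegrableOn (fun _ : ℂ => log 8 - 2 + log p.re) A :=
    integrableOn_const h.volume_lt_top.ne
  have hi4 : IntegrableOn (fun y => log 8 - 2 + log p.re - log ‖x - y‖) A := hi3.sub hi2
  have h1 : (p.re ^ 2)⁻¹ * ringPot A x - (1 / 2 * (log 8 - 2 + log p.re) -
      1 / (2 * π) * logPot A x) = ∫ y in A, ((p.re ^ 2)⁻¹ * ringKer x y -
        1 / (2 * π) * (log 8 - 2 + log p.re - log ‖x - y‖)) := by
    rw [integral_sub hi1 (hi4.const_mul _), integral_const_mul, integral_const_mul,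
      integral_sub hi3 hi2, setIntegral_const, h.vol, ringPot, logPot, smul_eq_mul]
    field_simp
  rw [h1, ← Real.norm_eq_abs]
  refine (norm_integral_le_of_norm_le (h.integrable_bound x (5 * d)
    (7 * d * (1 + log p.re))) ?_).trans ((h.integral_bound x (by positivity)).trans ?_)
  · filter_upwards [h.ae_ne x] with y hy
    exact (h.pair_of_mem hx hy.1 hy.2).abs_ringKer_sub_le
  · have hdl : 0 ≤ d * (1 + log p.re) := by positivity
    nlinarith [mul_nonneg hdl (sub_nonneg.2 pi_lt_d2.le), mul_nonneg hd.le hl]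

theorem integrableOn_ringPot (h : RingProblem d w μ p A) : IntegrableOn (ringPot A) A :=
  h.posDomain.integrableOn_of_continuousOn h.continuousOn_ringPot

theorem abs_integral_ringPot_sub_le (h : RingProblem d w μ p A) :
    |(p.re ^ 2)⁻¹ * (∫ x in A, ringPot A x) - (π / 2 * (log 8 - 2 + log p.re) -
      1 / (2 * π) * ∫ x in A, logPot A x)| ≤ 70 * d * (1 + log p.re) * π := by
  have hi1 := h.integrableOn_ringPot.const_mul (p.re ^ 2)⁻¹
  have hi2 : IntegrableOn (logPot A) A :=
    integrableOn_logPot h.bdd h.measurableSet h.bdd h.measurableSet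
  have hi3 : IntegrableOn (fun _ : ℂ => 1 / 2 * (log 8 - 2 + log p.re)) A :=
    integrableOn_const h.volume_lt_top.ne
  have hi4 : IntegrableOn (fun x => 1 / 2 * (log 8 - 2 + log p.re) -
      1 / (2 * π) * logPot A x) A := hi3.sub (hi2.const_mul _)
  have h1 : (p.re ^ 2)⁻¹ * (∫ x in A, ringPot A x) - (π / 2 * (log 8 - 2 + log p.re) -
      1 / (2 * π) * ∫ x in A, logPot A x) = ∫ x in A, ((p.re ^ 2)⁻¹ * ringPot A x -
        (1 / 2 * (log 8 - 2 + log p.re) - 1 / (2 * π) * logPot A x)) := by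
    rw [integral_sub hi1 hi4, integral_const_mul,
      integral_sub hi3 (hi2.const_mul _), setIntegral_const, integral_const_mul, h.vol, smul_eq_mul]
    ring
  rw [h1, ← Real.norm_eq_abs]
  refine (norm_setIntegral_le_of_norm_le_const h.volume_lt_top fun x hx =>
    h.abs_ringPot_sub_le hx).trans_eq ?_
  rw [h.vol]

theorem abs_integral_sq_sub_le (h : RingProblem d w μ p A) :
    |(∫ x in A, x.re ^ 2) - π * p.re ^ 2| ≤ 3 * d * p.re ^ 2 * π := by
  have hi : IntegrableOn (fun x : ℂ => x.re ^ 2) A := h.integrableOn_continuous (by fun_prop)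
  have h1 : (∫ x in A, x.re ^ 2) - π * p.re ^ 2 = ∫ x in A, (x.re ^ 2 - p.re ^ 2) := by
    rw [integral_sub hi (integrableOn_const h.volume_lt_top.ne), setIntegral_const, h.vol,
      smul_eq_mul]
  rw [h1, ← h.vol, ← Real.norm_eq_abs]
  refine norm_setIntegral_le_of_norm_le_const h.volume_lt_top fun x hx => ?_
  have h2 := h.abs_re_sub_le hx
  have h3 := h.d_le
  have h4 := h.re_pos
  have h5 := h.d_pos
  rw [Real.norm_eq_abs, sq_sub_sq, abs_mul]
  have h6 : |x.re + p.re| ≤ 3 * p.re := by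
    rw [abs_le] at h2 ⊢
    constructor <;> nlinarith
  calc _ ≤ 3 * p.re * (d * p.re) := by gcongr
    _ = _ := by ring

theorem abs_force_add_le (h : RingProblem d w μ p A) :
    |(∫ x in A, ∫ y in A, ⟪ringSing x y, (1 : ℂ)⟫ * x.re) + π / 4 * p.re ^ 2| ≤
      60 * d * p.re ^ 2 := by
  have hP := h.re_pos
  have hd := h.d_pos
  have hd1 := h.d_le
  have hm : Measurable fun z : ℂ × ℂ => ⟪ringSing z.1 z.2, (1 : ℂ)⟫ :=
    Measurable.inner measurable_ringSing measurable_const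
  have hm' : Measurable (Function.uncurry fun x y : ℂ => ⟪ringSing x y, (1 : ℂ)⟫ * x.re) := by
    unfold Function.uncurry; fun_prop
  have hb : ∀ x ∈ A, ∀ y ∈ A, x ≠ y → |⟪ringSing x y, (1 : ℂ)⟫ * x.re| ≤
      p.re ^ 2 * (2 * p.re) * ‖x - y‖⁻¹ := by
    intro x hx y hy hne
    have h1 : |⟪ringSing x y, (1 : ℂ)⟫| ≤ p.re ^ 2 * ‖x - y‖⁻¹ :=
      ((abs_real_inner_le_norm _ _).trans_eq (by simp)).trans
        (h.pair_of_mem hx hy hne).norm_ringSing_le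
    have h2 : |x.re| ≤ 2 * p.re := by
      have := abs_le.1 (h.abs_re_sub_le hx)
      rw [abs_le]; constructor <;> nlinarith
    rw [abs_mul]
    calc _ ≤ (p.re ^ 2 * ‖x - y‖⁻¹) * (2 * p.re) := by gcongr
      _ = _ := by ring
  have hs : ∀ x ∈ A, ∀ y ∈ A, x ≠ y →
      2 * (-((1 / (4 * π) + 6 * d) * p.re ^ 2)) ≤
        ⟪ringSing x y, (1 : ℂ)⟫ * x.re + ⟪ringSing y x, (1 : ℂ)⟫ * y.re ∧
      ⟪ringSing x y, (1 : ℂ)⟫ * x.re + ⟪ringSing y x, (1 : ℂ)⟫ * y.re ≤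
        2 * (-((1 / (4 * π) - 6 * d) * p.re ^ 2)) := by
    intro x hx y hy hne
    have hp := h.pair_of_mem hx hy hne
    rw [hp.force_add]
    have h1 := abs_le.1 hp.abs_mass_le
    have h2 := abs_le.1 (h.abs_re_sub_le hx)
    have h3 := abs_le.1 (h.abs_re_sub_le hy)
    have hpi := inv_four_pi_le
    have hpi2 : 1 / 13 ≤ 1 / (4 * π) := by
      have := pi_lt_d2
      gcongr; linarith
    generalize ringK (ringArg x y) * √(x.re * y.re) = N at *
    generalize 1 / (4 * π) = a at *
    have h4 : (a - 5 * d) * p.re ≤ N := by linarith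
    have h5 : N ≤ (a + 5 * d) * p.re := by linarith
    have h6 : 0 ≤ (a - 5 * d) * p.re := mul_nonneg (by linarith) hP.le
    have h7 : 0 ≤ (1 - d) * p.re := mul_nonneg (by linarith) hP.le
    have h8 := mul_le_mul h4 (by linarith : 2 * ((1 - d) * p.re) ≤ x.re + y.re) (by linarith)
      (h6.trans h4)
    have h9 := mul_le_mul h5 (by linarith : x.re + y.re ≤ 2 * ((1 + d) * p.re))
      (by linarith) (h6.trans (by nlinarith))
    have h10 := mul_nonneg (mul_nonneg hd.le (sub_nonneg.2 hd1)) (sq_nonneg p.re)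
    have h11 := mul_nonneg (mul_nonneg hd.le (sub_nonneg.2 hpi)) (sq_nonneg p.re)
    have h12 := mul_nonneg hd.le (sq_nonneg p.re)
    have h13 := mul_nonneg hd.le h12
    constructor <;> nlinarith
  have h1 := le_integral_integral_of_symm hm' h.bdd h.measurableSet hb fun x hx y hy hne =>
    (hs x hx y hy hne).1
  have h2 := integral_integral_le_of_symm hm' h.bdd h.measurableSet hb fun x hx y hy hne =>
    (hs x hx y hy hne).2
  rw [h.vol] at h1 h2
  have h3 : 6 * d * p.re ^ 2 * π ^ 2 ≤ 60 * d * p.re ^ 2 := by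
    have : π ^ 2 ≤ 10 := by nlinarith [pi_lt_d2, pi_gt_three]
    nlinarith [mul_nonneg (mul_nonneg hd.le (sq_nonneg p.re)) (sub_nonneg.2 this)]
  have h4 : 1 / (4 * π) * p.re ^ 2 * π ^ 2 = π / 4 * p.re ^ 2 := by field_simp
  rw [abs_le]
  constructor <;> linarith

theorem abs_speed_sub_le (h : RingProblem d w μ p A) :
    |π * w - ((∫ x in A, stream w μ p A x) + π / 4 * (log 8 - 2 + log p.re) -
      1 / (4 * π) * (∫ x in A, logPot A x) + π / 4)| ≤ 600 * d * (1 + log p.re) := by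
  have hP := h.re_pos
  have hd := h.d_pos
  have hl := h.log_nonneg
  have h1 := h.integral_stream_mul (T := Complex.re) (T' := fun _ => 1) (e := 1)
    Complex.continuous_re continuous_const fun x => hasLineDerivAt_re x 1
  simp only [mul_one, Complex.one_re, one_mul] at h1
  have hi : IntegrableOn (fun x : ℂ => x.re ^ 2) A := h.integrableOn_continuous (by fun_prop)
  have h2 : ∫ x in A, (ringPot A x / 2 - w * x.re ^ 2) * (x.re / x.re) =
      (∫ x in A, ringPot A x) / 2 - w * ∫ x in A, x.re ^ 2 := by
    rw [← integral_div, ← integral_const_mul,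
      ← integral_sub (h.integrableOn_ringPot.div_const 2) (hi.const_mul w)]
    refine setIntegral_congr_fun h.measurableSet fun x hx => ?_
    have hx0 := (h.re_of_mem_ball (h.subset_ball hx)).2.ne'
    simp only [div_self hx0, mul_one]
  rw [h2] at h1
  have h3 := h.abs_integral_ringPot_sub_le
  have h4 := h.abs_force_add_le
  have h5 := h.abs_integral_sq_sub_le
  have hw := h.w_le
  have hw0 := h.w_nonneg
  generalize (∫ x in A, stream w μ p A x) = U at *
  generalize (∫ x in A, ringPot A x) = R at *
  generalize (∫ x in A, x.re ^ 2) = Q at *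
  generalize (∫ x in A, ∫ y in A, ⟪ringSing x y, (1 : ℂ)⟫ * x.re) = S at *
  generalize (∫ x in A, logPot A x) = M at *
  have hP2 : 0 < p.re ^ 2 := by positivity
  have h6 : π * w - (U + π / 4 * (log 8 - 2 + log p.re) - 1 / (4 * π) * M + π / 4) =
      (p.re ^ 2)⁻¹ * (-(w * (Q - π * p.re ^ 2)) - (S + π / 4 * p.re ^ 2)) +
        1 / 2 * ((p.re ^ 2)⁻¹ * R - (π / 2 * (log 8 - 2 + log p.re) - 1 / (2 * π) * M)) := by
    have : U = (p.re ^ 2)⁻¹ * (-(R / 2 - w * Q) + S) := by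
      rw [← h1, inv_mul_cancel_left₀ hP2.ne']
    rw [this]
    field_simp
    ring
  rw [h6]
  refine (abs_add_le _ _).trans ?_
  rw [abs_mul, abs_mul, abs_of_pos (inv_pos.2 hP2), abs_of_pos (by norm_num : (0:ℝ) < 1 / 2)]
  have h7 : |-(w * (Q - π * p.re ^ 2)) - (S + π / 4 * p.re ^ 2)| ≤
      (44 * (1 + log p.re) * (3 * d * π) + 60 * d) * p.re ^ 2 := by
    refine (abs_sub _ _).trans ?_
    rw [abs_neg, abs_mul, abs_of_nonneg hw0]
    calc _ ≤ 44 * (1 + log p.re) * (3 * d * p.re ^ 2 * π) + 60 * d * p.re ^ 2 :=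
          add_le_add (mul_le_mul hw h5 (abs_nonneg _) (by positivity)) h4
      _ = _ := by ring
  calc _ ≤ (p.re ^ 2)⁻¹ * ((44 * (1 + log p.re) * (3 * d * π) + 60 * d) * p.re ^ 2) +
        1 / 2 * (70 * d * (1 + log p.re) * π) := by gcongr
    _ = 44 * (1 + log p.re) * (3 * d * π) + 60 * d + 1 / 2 * (70 * d * (1 + log p.re) * π) := by
        field_simp
    _ ≤ _ := by
        have : 0 ≤ d * (1 + log p.re) := by positivity
        nlinarith [mul_nonneg this (sub_nonneg.2 pi_lt_d2.le), mul_nonneg hd.le hl]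

end RingProblem

end

section

namespace RingProblem

variable {d w μ δ σ : ℝ} {p : ℂ} {A : Set ℂ}

theorem nearVortex (h : RingProblem d w μ p A) (hδ : 110 * (d + (1 + log p.re) / p.re) ≤ δ)
    (hδ1 : δ ≤ 1) :
    NearVortex δ (Metric.ball p (2 * d * p.re)) A (stream w μ p A) (streamGrad w p A) := by
  have hd := h.d_pos
  have hP := h.re_pos
  have hl := h.log_nonneg
  have hdδ : 110 * d ≤ δ := by
    have : 0 ≤ (1 + log p.re) / p.re := by positivity
    linarith
  exact
    { h.posDomain with
      pos_delta := by linarith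
      delta_le := hδ1
      vol := h.vol
      near := fun x hx => (h.near hx).trans hδ
      ball_subset := fun x hx => Metric.ball_subset_ball' (by
        rw [dist_eq_norm]; linarith [h.close x hx, h.large])
      preconnected := h.preconnected
      energy := h.energy.trans' (mul_le_mul_of_nonneg_right (by linarith) (by positivity)) }

/-- Once its diameter is known to be bounded, the cross-section is small relative to `p.re`. -/
theorem of_diam_le (h : RingProblem d w μ p A) (hA : Metric.diam A ≤ 5) :
    RingProblem (5 / p.re) w μ p A := by
  have hP := h.re_pos
  exact
    { h with
      d_pos := by positivity
      d_le := by rw [div_le_iff₀ hP]; linarith [h.le_re]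
      large := by rw [div_mul_cancel₀ _ hP.ne']
      close := fun x hx => by
        rw [div_mul_cancel₀ _ hP.ne', ← dist_eq_norm]
        exact (Metric.dist_le_diam_of_mem h.bdd hx h.mem).trans hA }

theorem asymptotics (h : RingProblem d w μ p A) (hσ : 0 < σ) (hσ1 : σ ≤ 1 / 2000)
    (hd : 110 * (d + (1 + log p.re) / p.re) ≤ σ ^ 24) :
    |w - (1 / 4 * log (8 * p.re) - 1 / 16)| ≤ 400 * σ ∧ |Metric.diam A / 2 - 1| ≤ 1000 * σ := by
  have hP := h.re_pos
  have hl := h.log_nonneg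
  have h24 : σ ^ 24 ≤ σ := by
    simpa using pow_le_pow_of_le_one hσ.le (by linarith : σ ≤ 1) (by norm_num : 1 ≤ 24)
  have hN := h.nearVortex hd (by linarith)
  have hdiam := hN.abs_diam_le hσ hσ1
  refine ⟨?_, hdiam⟩
  have hs := (h.of_diam_le (by linarith [(abs_le.1 hdiam).2])).abs_speed_sub_le
  have hM := hN.abs_integral_logPot_le hσ hσ1
  have hU := hN.integral_le
  have hU' := hN.energy
  generalize (∫ x in A, stream w μ p A x) = U at *
  generalize (∫ x in A, logPot A x) = M at *
  have h1 : 600 * (5 / p.re) * (1 + log p.re) ≤ 30 * σ := by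
    have h2 : 600 * (5 / p.re) * (1 + log p.re) = 3000 * ((1 + log p.re) / p.re) := by ring
    rw [h2]
    linarith [h.d_pos]
  have h3 : |U - π / 8| ≤ 16 * σ := by
    have h4 : 5 * π * σ ^ 24 ≤ 16 * σ := by nlinarith [pi_lt_d2, pow_pos hσ 24]
    have h5 : σ ^ 24 * (π / 8) ≤ 16 * σ := by nlinarith [pi_lt_d2, pow_pos hσ 24]
    rw [abs_le]; constructor <;> linarith
  have h6 : |1 / (4 * π) * (M + π ^ 2 / 4)| ≤ 334 * σ := by
    rw [abs_mul, abs_of_pos (by positivity : 0 < 1 / (4 * π))]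
    calc _ ≤ 1 / 12 * (4000 * σ) := mul_le_mul inv_four_pi_le hM (abs_nonneg _) (by norm_num)
      _ ≤ _ := by linarith
  have h7 : π * (w - (1 / 4 * log (8 * p.re) - 1 / 16)) =
      (π * w - (U + π / 4 * (log 8 - 2 + log p.re) - 1 / (4 * π) * M + π / 4)) +
        (U - π / 8) - 1 / (4 * π) * (M + π ^ 2 / 4) := by
    rw [Real.log_mul (by norm_num) hP.ne']
    field_simp
    ring
  have h8 : π * |w - (1 / 4 * log (8 * p.re) - 1 / 16)| ≤ 400 * σ := by
    have h9 (a : ℝ) : π * |a| = |π * a| := by rw [abs_mul, abs_of_pos pi_pos]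
    rw [h9, h7]
    refine (abs_sub _ _).trans ?_
    linarith [abs_add_le (π * w - (U + π / 4 * (log 8 - 2 + log p.re) - 1 / (4 * π) * M + π / 4))
      (U - π / 8)]
  nlinarith [pi_gt_three, abs_nonneg (w - (1 / 4 * log (8 * p.re) - 1 / 16))]

theorem kelvin_hicks (h : RingProblem d w μ p A) (hσ : 0 < σ) (hσ1 : σ ≤ 1 / 2000)
    (hd : 110 * (d + (1 + log p.re) / p.re) ≤ σ ^ 24) {κ K : ℝ} (hκ : 0 < κ)
    (hK : κ = K * ∫ x in A, x.re) :
    |w * K * p.re - κ / (4 * π) * log (8 * p.re / (Metric.diam A / 2)) + κ / (16 * π)| ≤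
      400 * κ * σ := by
  have hP := h.re_pos
  have hP5 := h.le_re
  have hl := h.log_nonneg
  have h24 : σ ^ 24 ≤ σ := by
    simpa using pow_le_pow_of_le_one hσ.le (by linarith : σ ≤ 1) (by norm_num : 1 ≤ 24)
  obtain ⟨h1, h2⟩ := h.asymptotics hσ hσ1 hd
  have hc := (h.of_diam_le (by linarith [(abs_le.1 h2).2])).abs_ringCenter_sub_le
  rw [div_mul_cancel₀ _ hP.ne'] at hc
  have hci : ∫ x in A, x.re = π * ringCenter A := by
    rw [ringCenter, mul_inv_cancel_left₀ pi_ne_zero]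
  rw [hci] at hK
  generalize ringCenter A = c at *
  have hw := h.w_le
  have hw0 := h.w_nonneg
  generalize Metric.diam A / 2 = D at *
  have hc0 : p.re / 2 ≤ c := by linarith [(abs_le.1 hc).1]
  have hcpos : 0 < c := by linarith
  have hD := abs_le.1 h2
  have hD0 : 0 < D := by linarith
  have hlog : |log D| ≤ 2000 * σ := by
    have h3 := Real.log_le_sub_one_of_pos hD0
    have h4 := Real.one_sub_inv_le_log_of_pos hD0
    have h5 : D⁻¹ ≤ 1 + 2000 * σ := by
      rw [inv_le_iff_one_le_mul₀ hD0]
      nlinarith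
    rw [abs_le]; constructor <;> linarith
  have hw2 : |w * (p.re - c) / c| ≤ 4 * σ := by
    rw [abs_div, abs_mul, abs_of_nonneg hw0, abs_of_pos hcpos, abs_sub_comm p.re c]
    calc _ ≤ 44 * (1 + log p.re) * 5 / (p.re / 2) := by gcongr
      _ = 440 * ((1 + log p.re) / p.re) := by field_simp; norm_num
      _ ≤ _ := by linarith [h.d_pos]
  have hK' : K = κ / (π * c) := by rw [hK]; field_simp
  have h3 : w * K * p.re - κ / (4 * π) * log (8 * p.re / D) + κ / (16 * π) =
      κ / π * (w * (p.re - c) / c + (w - (1 / 4 * log (8 * p.re) - 1 / 16)) + 1 / 4 * log D) := by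
    rw [Real.log_div (by positivity) hD0.ne', hK']
    field_simp
    ring
  have h4 : |w * (p.re - c) / c + (w - (1 / 4 * log (8 * p.re) - 1 / 16)) + 1 / 4 * log D| ≤
      1000 * σ := by
    refine (abs_add_le _ _).trans ?_
    rw [abs_mul, abs_of_pos (by norm_num : (0 : ℝ) < 1 / 4)]
    linarith [abs_add_le (w * (p.re - c) / c) (w - (1 / 4 * log (8 * p.re) - 1 / 16))]
  rw [h3, abs_mul, abs_of_pos (by positivity : 0 < κ / π)]
  calc _ ≤ κ / π * (1000 * σ) := by gcongr
    _ ≤ κ / 2.5 * (1000 * σ) := by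
      have := pi_gt_three
      gcongr; linarith
    _ = _ := by ring

end RingProblem

end

section

theorem Gstar_eq_ringKer {x y : ℂ} (hx : 0 < x.re) (hy : 0 < y.re) (hne : x ≠ y) :
    Gstar (mk2 x.re x.im) (mk2 y.re y.im) = ringKer x y := by
  have hξ : 0 < ringArg x y := ringArg_pos hx hy hne
  have hxy : 0 < x.re * y.re := mul_pos hx hy
  set ξ := ringArg x y with hξd
  have hn : ‖x - y‖ ^ 2 = (x.re - y.re) ^ 2 + (x.im - y.im) ^ 2 := by
    rw [Complex.sq_norm, Complex.normSq_apply]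
    simp only [Complex.sub_re, Complex.sub_im]
    ring
  set f : ℝ → ℝ := fun θ => cos θ / √(ξ + 2 * (1 - cos θ)) with hf
  have hfpos : ∀ θ, 0 < ξ + 2 * (1 - cos θ) := fun θ => by linarith [cos_le_one θ]
  have hfc : Continuous f := by
    have : ∀ θ, √(ξ + 2 * (1 - cos θ)) ≠ 0 := fun θ => (Real.sqrt_pos.2 (hfpos θ)).ne'
    fun_prop (disch := assumption)
  have h1 : ∀ θ, cos θ / √((x.im - y.im) ^ 2 + x.re ^ 2 + y.re ^ 2 - 2 * x.re * y.re * cos θ) =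
      (√(x.re * y.re))⁻¹ * f θ := by
    intro θ
    have h2 : (x.im - y.im) ^ 2 + x.re ^ 2 + y.re ^ 2 - 2 * x.re * y.re * cos θ =
        (x.re * y.re) * (ξ + 2 * (1 - cos θ)) := by
      rw [hξd, ringArg, hn]
      field_simp
      ring
    rw [h2, Real.sqrt_mul hxy.le, hf]
    simp only
    rw [div_mul_eq_div_div, div_eq_mul_inv, div_eq_mul_inv, div_eq_mul_inv]
    ring
  have h3 : ∫ θ in (-π)..π, f θ = 2 * ∫ θ in (0)..π, f θ := by
    rw [← intervalIntegral.integral_add_adjacent_intervals (hfc.intervalIntegrable (-π) 0)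
      (hfc.intervalIntegrable 0 π)]
    have h4 : ∫ θ in (-π)..0, f θ = ∫ θ in (0)..π, f θ := by
      have h5 := intervalIntegral.integral_comp_neg (a := 0) (b := π) f
      rw [neg_zero] at h5
      rw [← h5]
      simp only [hf, cos_neg]
    rw [h4]; ring
  have h6 : ∫ θ in (0)..π, f θ = 2 * ∫ φ in (0)..(π / 2),
      (1 - 2 * sin φ ^ 2) / √(ξ + 4 * sin φ ^ 2) := by
    have h7 := intervalIntegral.integral_comp_mul_left (a := 0) (b := π / 2) f (two_ne_zero' ℝ)
    rw [mul_zero, mul_div_cancel₀ π (two_ne_zero' ℝ), smul_eq_mul] at h7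
    have h8 : ∫ φ in (0)..(π / 2), (1 - 2 * sin φ ^ 2) / √(ξ + 4 * sin φ ^ 2) =
        ∫ φ in (0)..(π / 2), f (2 * φ) := by
      refine intervalIntegral.integral_congr fun φ _ => ?_
      have h9 : cos (2 * φ) = 1 - 2 * sin φ ^ 2 := by
        rw [cos_two_mul, cos_sq']; ring
      simp only [hf, h9]
      congr 3
      ring
    rw [h8, h7]; ring
  have h0 : ∀ a b : ℝ, mk2 a b 0 = a ∧ mk2 a b 1 = b := fun a b => ⟨rfl, rfl⟩
  rw [Gstar, (h0 _ _).1, (h0 _ _).1, (h0 _ _).2, (h0 _ _).2]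
  simp_rw [h1]
  rw [intervalIntegral.integral_const_mul, h3, h6, ringKer, ringAmp, ringF]
  have hs : 0 < √(x.re * y.re) := Real.sqrt_pos.2 hxy
  have hs2 : √(x.re * y.re) ^ 2 = x.re * y.re := Real.sq_sqrt hxy.le
  generalize √(x.re * y.re) = r at *
  field_simp
  rw [hs2]
  ring

theorem ringKer_mul {s : ℝ} (hs : 0 < s) (x y : ℂ) :
    ringKer (s • x) (s • y) = s ^ 2 * ringKer x y := by
  have h1 : ringArg (s • x) (s • y) = ringArg x y := by
    rw [ringArg, ringArg, ← smul_sub, norm_smul, Real.norm_of_nonneg hs.le, Complex.smul_re,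
      Complex.smul_re, smul_eq_mul, smul_eq_mul, mul_pow, mul_mul_mul_comm, ← sq,
      mul_div_mul_left _ _ (pow_pos hs 2).ne']
  rw [ringKer, ringKer, h1, ringAmp, ringAmp, Complex.smul_re, Complex.smul_re, smul_eq_mul,
    smul_eq_mul, mul_mul_mul_comm, ← sq, Real.sqrt_mul (sq_nonneg s), Real.sqrt_sq hs.le]
  ring

/-- The point of the plane with complex coordinate `s • z`. -/
def planeScale (s : ℝ) (z : ℂ) : Plane := mk2 (s * z.re) (s * z.im)

theorem planeScale_eq (s : ℝ) (z : ℂ) :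
    planeScale s z = Complex.orthonormalBasisOneI.repr (s • z) := by
  ext i
  rw [Complex.orthonormalBasisOneI_repr_apply, planeScale, mk2]
  simp

section planeScale

open scoped Pointwise

variable {s : ℝ} (B : Set Plane)

theorem continuous_planeScale (s : ℝ) : Continuous (planeScale s) := by
  rw [funext (planeScale_eq s)]
  fun_prop

theorem smul_preimage_planeScale (hs : 0 < s) :
    s • (planeScale s ⁻¹' B) = Complex.orthonormalBasisOneI.repr ⁻¹' B := by
  ext z
  rw [Set.mem_smul_set_iff_inv_smul_mem₀ hs.ne', Set.mem_preimage, planeScale_eq,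
    smul_inv_smul₀ hs.ne', Set.mem_preimage]

theorem image_smul_preimage_planeScale (hs : 0 < s) :
    Complex.orthonormalBasisOneI.repr '' (s • (planeScale s ⁻¹' B)) = B := by
  rw [smul_preimage_planeScale B hs]
  exact Set.image_preimage_eq _ (LinearIsometryEquiv.surjective _)

theorem setIntegral_planeScale (hs : 0 < s) (f : Plane → ℝ) :
    ∫ x in B, f x = s ^ 2 * ∫ z in planeScale s ⁻¹' B, f (planeScale s z) := by
  have h1 := Measure.setIntegral_comp_smul_of_pos volume
    (fun z => f (Complex.orthonormalBasisOneI.repr z)) (planeScale s ⁻¹' B) hs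
  have h2 : ∫ z in Complex.orthonormalBasisOneI.repr ⁻¹' B,
      f (Complex.orthonormalBasisOneI.repr z) = ∫ x in B, f x :=
    (Complex.orthonormalBasisOneI.measurePreserving_repr).setIntegral_preimage_emb
      Complex.orthonormalBasisOneI.repr.toHomeomorph.measurableEmbedding f B
  have h3 : ∫ z in planeScale s ⁻¹' B, f (planeScale s z) =
      ∫ z in planeScale s ⁻¹' B, f (Complex.orthonormalBasisOneI.repr (s • z)) :=
    integral_congr_ae (ae_of_all _ fun z => by simp only [planeScale_eq])
  rw [h3, h1, Complex.finrank_real_complex, smul_eq_mul, smul_preimage_planeScale B hs, h2,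
    mul_inv_cancel_left₀ (by positivity)]

theorem diam_planeScale (hs : 0 < s) :
    Metric.diam B = s * Metric.diam (planeScale s ⁻¹' B) := by
  conv_lhs => rw [← image_smul_preimage_planeScale B hs]
  rw [Complex.orthonormalBasisOneI.repr.isometry.diam_image, diam_smul₀,
    Real.norm_of_nonneg hs.le]

theorem isPreconnected_planeScale (hs : 0 < s) (hB : IsPreconnected B) :
    IsPreconnected (planeScale s ⁻¹' B) := by
  have h1 : planeScale s ⁻¹' B =
      (fun x : Plane => s⁻¹ • Complex.orthonormalBasisOneI.repr.symm x) '' B := by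
    ext z
    simp only [Set.mem_preimage, Set.mem_image, planeScale_eq]
    constructor
    · intro h
      exact ⟨_, h, by rw [LinearIsometryEquiv.symm_apply_apply, inv_smul_smul₀ hs.ne']⟩
    · rintro ⟨x, hx, rfl⟩
      rwa [smul_inv_smul₀ hs.ne', LinearIsometryEquiv.apply_symm_apply]
  rw [h1]
  exact hB.image _ (by fun_prop)

theorem norm_sub_le_diam_planeScale (hs : 0 < s) (hB : Bornology.IsBounded B) {z p : ℂ}
    (hz : planeScale s z ∈ B) (hp : planeScale s p ∈ B) : ‖z - p‖ ≤ Metric.diam B / s := by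
  rw [le_div_iff₀ hs]
  have h1 := Metric.dist_le_diam_of_mem hB hz hp
  rw [planeScale_eq, planeScale_eq, LinearIsometryEquiv.dist_map, dist_eq_norm, ← smul_sub,
    norm_smul, Real.norm_of_nonneg hs.le] at h1
  linarith

end planeScale

end

section

theorem planeScale_mem_halfPlane {s : ℝ} (hs : 0 < s) {x : ℂ} :
    planeScale s x ∈ halfPlane ↔ 0 < x.re :=
  mul_pos_iff_of_pos_left hs

namespace IsVortexRingStream

variable {ψ : Plane → ℝ} {ε W μ s : ℝ}

theorem isOpen_crossSection (h : IsVortexRingStream ψ ε W μ) : IsOpen (crossSection ψ ε W μ) := by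
  have h0 : Continuous fun x : Plane => x 0 := by fun_prop
  have h1 : IsOpen halfPlane := isOpen_lt continuous_const h0
  have h2 : ContinuousOn (fun x => ψ x - W / 2 * (x 0) ^ 2 * Real.log (1 / ε)) halfPlane := by
    have := h.continuousOn
    fun_prop
  exact h2.isOpen_inter_preimage h1 (isOpen_Ioi (a := μ))

theorem apply_planeScale (h : IsVortexRingStream ψ ε W μ) (hs : 0 < s) {x : ℂ} (hx : 0 < x.re) :
    ψ (planeScale s x) =
      s ^ 4 / ε ^ 2 * ringPot (planeScale s ⁻¹' crossSection ψ ε W μ) x := by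
  rw [h.repr _ ((planeScale_mem_halfPlane hs).2 hx), setIntegral_planeScale _ hs, ringPot]
  have h1 : ∫ z in planeScale s ⁻¹' crossSection ψ ε W μ, Gstar (planeScale s x) (planeScale s z) =
      ∫ z in planeScale s ⁻¹' crossSection ψ ε W μ, s ^ 2 * ringKer x z := by
    have hm : MeasurableSet (planeScale s ⁻¹' crossSection ψ ε W μ) :=
      (h.isOpen_crossSection.preimage (continuous_planeScale s)).measurableSet
    refine integral_congr_ae ?_
    filter_upwards [ae_restrict_mem hm, Measure.ae_ne _ x] with z hz hne
    have hz0 : 0 < z.re := (planeScale_mem_halfPlane hs).1 hz.1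
    have h2 : s • x ≠ s • z := fun hc => hne (smul_right_injective ℂ hs.ne' hc).symm
    have h3 := Gstar_eq_ringKer (x := s • x) (y := s • z)
      (by rw [Complex.smul_re]; exact mul_pos hs hx)
      (by rw [Complex.smul_re]; exact mul_pos hs hz0) h2
    rw [ringKer_mul hs] at h3
    rw [← h3]
    simp only [planeScale, Complex.smul_re, Complex.smul_im, smul_eq_mul]
  rw [h1, integral_const_mul]
  ring

theorem ringProblem (h : IsVortexRingStream ψ ε W μ) (hε : 0 < ε) (hε1 : ε ≤ 1) (hW : 0 ≤ W)
    (hμ : 0 ≤ μ) (hs : 0 < s) (hvol : volume.real (crossSection ψ ε W μ) = s ^ 2 * π)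
    (hpre : IsPreconnected (crossSection ψ ε W μ)) {d p₁ : ℝ} (hd : 0 < d) (hd1 : d ≤ 1 / 100)
    (hp : mk2 p₁ 0 ∈ crossSection ψ ε W μ) (hlarge : 5 ≤ d * (p₁ / s))
    (hdiam : Metric.diam (crossSection ψ ε W μ) ≤ d * p₁) :
    RingProblem d (W * log (1 / ε) * (ε ^ 2 / s ^ 2)) (μ * (ε ^ 2 / s ^ 4)) ((p₁ / s : ℝ) : ℂ)
      (planeScale s ⁻¹' crossSection ψ ε W μ) := by
  have hL : 0 ≤ log (1 / ε) := Real.log_nonneg (by rwa [le_div_iff₀ hε, one_mul])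
  have hpm : planeScale s ((p₁ / s : ℝ) : ℂ) ∈ crossSection ψ ε W μ := by
    rw [planeScale, Complex.ofReal_re, Complex.ofReal_im, mul_div_cancel₀ _ hs.ne', mul_zero]
    exact hp
  have hkey : ∀ x : ℂ, 0 < x.re →
      ringPot (planeScale s ⁻¹' crossSection ψ ε W μ) x - μ * (ε ^ 2 / s ^ 4) -
        W * log (1 / ε) * (ε ^ 2 / s ^ 2) / 2 * x.re ^ 2 =
      ε ^ 2 / s ^ 4 * (ψ (planeScale s x) - W / 2 * (planeScale s x 0) ^ 2 * log (1 / ε) - μ) := by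
    intro x hx
    have h0 : planeScale s x 0 = s * x.re := rfl
    rw [h.apply_planeScale hs hx, h0]
    field_simp
    ring
  have hpos : 0 < ε ^ 2 / s ^ 4 := by positivity
  refine
    { d_pos := hd
      d_le := hd1
      large := by rwa [Complex.ofReal_re]
      isOpen := h.isOpen_crossSection.preimage (continuous_planeScale s)
      preconnected := isPreconnected_planeScale _ hs hpre
      vol := ?_
      mem := hpm
      close := fun x hx => ?_
      w_nonneg := by positivity
      mu_nonneg := by positivity
      cont := ?_
      pos := fun x hx => ?_
      nonpos := fun x hx0 hx => ?_ }
  · have h1 := setIntegral_planeScale (crossSection ψ ε W μ) hs fun _ => 1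
    rw [setIntegral_const, setIntegral_const, smul_eq_mul, smul_eq_mul, mul_one, mul_one,
      hvol] at h1
    exact (mul_left_cancel₀ (by positivity) h1).symm
  · rw [Complex.ofReal_re]
    refine (norm_sub_le_diam_planeScale _ hs h.bounded hx hpm).trans ?_
    rw [← mul_div_assoc]
    gcongr
  · have h1 : ContinuousOn (fun x => ε ^ 2 / s ^ 4 * ψ (planeScale s x)) {x : ℂ | 0 < x.re} :=
      (h.continuousOn.comp (continuous_planeScale s).continuousOn fun x hx =>
        (planeScale_mem_halfPlane hs).2 hx).const_mul _
    refine h1.congr fun x hx => ?_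
    simp only [h.apply_planeScale hs hx]
    field_simp
  · rw [hkey x ((planeScale_mem_halfPlane hs).1 hx.1)]
    exact mul_pos hpos (by linarith [hx.2])
  · rw [hkey x hx0]
    refine mul_nonpos_of_nonneg_of_nonpos hpos.le ?_
    by_contra! hc
    exact hx ⟨(planeScale_mem_halfPlane hs).2 hx0, by linarith⟩

end IsVortexRingStream

theorem exists_large_ring {t d : ℝ} (ht : 0 < t) (hd : 0 < d) :
    ∃ P₀ > 0, ∀ P ≥ P₀, 5 ≤ d * P ∧ (1 + log P) / P ≤ t := by
  have h1 : Tendsto (fun P : ℝ => (1 + log P) / P) atTop (nhds 0) := by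
    have h2 : Tendsto (fun P : ℝ => P⁻¹ + log P / P) atTop (nhds (0 + 0)) :=
      tendsto_inv_atTop_zero.add
        (Real.isLittleO_log_id_atTop.tendsto_div_nhds_zero)
    rw [add_zero] at h2
    refine h2.congr fun P => ?_
    rw [add_div, one_div]
  have h3 := (h1.eventually_le_const ht).and (eventually_ge_atTop (max 1 (5 / d)))
  obtain ⟨P₀, hP₀⟩ := eventually_atTop.1 (h3.and (eventually_gt_atTop 0))
  refine ⟨P₀, (hP₀ P₀ le_rfl).2, fun P hP => ⟨?_, (hP₀ P hP).1.1⟩⟩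
  have h4 := (le_max_right _ _).trans (hP₀ P hP).1.2
  rw [div_le_iff₀ hd] at h4
  linarith

end

/-- **Asymptotic Kelvin–Hicks relation** (Proposition 3.3). For a centralized steady vortex
ring of small cross-section with circulation `κ`, maximum point `p = (p₁, 0)` of the stream
function and cross-section parameter `σ = diam A / 2`, the quantity
`W p₁ ln(1/ε) − (κ/4π) ln(8p₁/σ) + κ/(16π)` is arbitrarily small as `ε, diam A → 0`. -/
theorem asymptotic_kelvin_hicks (κ W δ₀ m₀ : ℝ)
    (hκ : 0 < κ) (hW : 0 < W) (hδ₀ : 0 < δ₀) (hm₀ : 0 < m₀) :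
    ∀ η > (0 : ℝ), ∃ ε₀ > (0 : ℝ), ∃ d₀ > (0 : ℝ), ∀ ε ∈ Set.Ioc (0 : ℝ) ε₀,
      ∀ ψ : Plane → ℝ, ∀ μ : ℝ, m₀ ≤ μ →
        IsVortexRingStream ψ ε W μ → Centralized ψ →
        circulation ψ ε W μ = κ →
        SimplyConnectedSpace ↥(crossSection ψ ε W μ) →
        crossSection ψ ε W μ ⊆ {x : Plane | δ₀ ≤ x 0 ∧ x 0 ≤ 1 / δ₀} →
        Metric.diam (crossSection ψ ε W μ) ≤ d₀ →
        ∀ p₁ : ℝ, mk2 p₁ 0 ∈ crossSection ψ ε W μ →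
          (∀ x ∈ closure (crossSection ψ ε W μ), ψ x ≤ ψ (mk2 p₁ 0)) →
          |W * p₁ * Real.log (1 / ε)
              - κ / (4 * π) *
                Real.log (8 * p₁ / ((1 / 2) * Metric.diam (crossSection ψ ε W μ)))
              + κ / (16 * π)|
            ≤ η := by
  intro η hη
  obtain ⟨σ, hσ, hσ1, hση⟩ : ∃ σ : ℝ, 0 < σ ∧ σ ≤ 1 / 2000 ∧ 400 * κ * σ ≤ η := by
    refine ⟨min (1 / 2000) (η / (400 * κ)), by positivity, min_le_left _ _, ?_⟩
    calc _ ≤ 400 * κ * (η / (400 * κ)) := by gcongr; exact min_le_right _ _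
      _ = η := by field_simp
  have h24 : σ ^ 24 ≤ 1 := pow_le_one₀ hσ.le (by linarith)
  have h24' : 0 < σ ^ 24 := by positivity
  obtain ⟨P₀, hP₀, hP⟩ := exists_large_ring (t := σ ^ 24 / 220) (d := σ ^ 24 / 220)
    (by positivity) (by positivity)
  refine ⟨min 1 (δ₀ / P₀ * √(π * δ₀ / κ)), by positivity, σ ^ 24 / 220 * δ₀, by positivity, ?_⟩
  intro ε hε ψ μ hμ h _ hcirc hsc hsub hdiam p₁ hp _
  have hε0 := hε.1
  have hε1 := hε.2.trans (min_le_left _ _)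
  have hε2 := hε.2.trans (min_le_right _ _)
  set B := crossSection ψ ε W μ with hB
  have hopen : IsOpen B := h.isOpen_crossSection
  have hfin : volume B < ⊤ := h.bounded.measure_lt_top
  have hvpos : 0 < volume.real B :=
    ENNReal.toReal_pos (hopen.measure_pos volume ⟨_, hp⟩).ne' hfin.ne
  set s := √(volume.real B / π) with hs_def
  have hs : 0 < s := by positivity
  have hs2 : volume.real B = s ^ 2 * π := by
    rw [hs_def, Real.sq_sqrt (by positivity)]; field_simp
  have hp1 : δ₀ ≤ p₁ := (hsub hp).1
  have hint : κ * ε ^ 2 = ∫ x in B, x 0 := by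
    rw [← hcirc, circulation, div_mul_cancel₀ _ (by positivity)]
  have hs3 : s ≤ δ₀ / P₀ := by
    have h1 : δ₀ * (s ^ 2 * π) ≤ κ * ε ^ 2 := by
      rw [hint, ← hs2]
      have h2 : IntegrableOn (fun x : Plane => x 0) B := by
        have h3 : Continuous fun x : Plane => x 0 := by fun_prop
        exact (h3.continuousOn.integrableOn_compact h.bounded.isCompact_closure).mono_set
          subset_closure
      have h4 := setIntegral_mono_on (integrableOn_const (C := δ₀) hfin.ne) h2
        hopen.measurableSet fun x hx => (hsub hx).1
      rwa [setIntegral_const, smul_eq_mul, mul_comm] at h4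
    have h5 : ε ^ 2 ≤ (δ₀ / P₀) ^ 2 * (π * δ₀ / κ) := by
      calc ε ^ 2 ≤ (δ₀ / P₀ * √(π * δ₀ / κ)) ^ 2 := by gcongr
        _ = _ := by rw [mul_pow, Real.sq_sqrt (by positivity)]
    have h6 : κ * ε ^ 2 ≤ (δ₀ / P₀) ^ 2 * (π * δ₀) := by
      calc κ * ε ^ 2 ≤ κ * ((δ₀ / P₀) ^ 2 * (π * δ₀ / κ)) := by gcongr
        _ = _ := by field_simp
    have h7 : s ^ 2 ≤ (δ₀ / P₀) ^ 2 := by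
      refine le_of_mul_le_mul_right ?_ (by positivity : 0 < π * δ₀)
      linarith
    exact (pow_le_pow_iff_left₀ hs.le (by positivity) two_ne_zero).1 h7
  have hPP : P₀ ≤ p₁ / s := by
    rw [le_div_iff₀ hs]
    rw [le_div_iff₀ hP₀] at hs3
    linarith
  obtain ⟨hlarge, hsmall⟩ := hP _ hPP
  have hpre : IsPreconnected B := by
    have : ConnectedSpace B := inferInstance
    exact (isConnected_iff_connectedSpace.2 this).isPreconnected
  have hR := h.ringProblem hε0 hε1 hW.le (hm₀.le.trans hμ) hs hs2 hpre
    (by positivity : 0 < σ ^ 24 / 220) (by linarith) hp hlarge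
    (hdiam.trans (by gcongr))
  have hK : κ = s ^ 3 / ε ^ 2 * ∫ x in planeScale s ⁻¹' B, x.re := by
    have h1 := setIntegral_planeScale B hs fun x => x 0
    have h2 : ∫ z in planeScale s ⁻¹' B, planeScale s z 0 =
        s * ∫ z in planeScale s ⁻¹' B, z.re := by
      rw [← integral_const_mul]; rfl
    rw [h2, ← hint] at h1
    field_simp
    linarith
  have hfinal := hR.kelvin_hicks hσ hσ1 (by rw [Complex.ofReal_re]; linarith) hκ hK
  rw [Complex.ofReal_re] at hfinal
  have hd := diam_planeScale B hs
  have e1 : W * log (1 / ε) * (ε ^ 2 / s ^ 2) * (s ^ 3 / ε ^ 2) * (p₁ / s) =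
      W * p₁ * log (1 / ε) := by field_simp
  have e2 : 8 * (p₁ / s) / (Metric.diam (planeScale s ⁻¹' B) / 2) =
      8 * p₁ / (1 / 2 * Metric.diam B) := by
    rw [hd, ← mul_div_assoc, div_div]
    congr 1
    ring
  rw [e1, e2] at hfinal
  exact hfinal.trans hση
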